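/- A strongly regular cellulation of the 3-sphere with N vertices may have fatness Ω(N^{1/12}): there is a constant c > 0 such that for every N₀ there exists a finite strongly regular CW cellulation of S³ with f₀ ≥ N₀ vertices and fatness φ ≥ c · f₀^{1/12}. -/

import Mathlib

noncomputable section

/-- The closed `n`-disk. -/
abbrev Disk (n : ℕ) : Set (EuclideanSpace ℝ (Fin n)) := Metric.closedBall 0 1
/-- The open `n`-disk. -/
abbrev OpenDisk (n : ℕ) : Set (EuclideanSpace ℝ (Fin n)) := Metric.ball 0 1
/-- The boundary sphere of the `n`-disk. -/
abbrev DiskBdry (n : ℕ) : Set (EuclideanSpace ℝ (Fin n)) := Metric.sphere 0 1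

/-- The 3-sphere, as a topological space. -/
abbrev Sphere3 : Type := ↥(Metric.sphere (0 : EuclideanSpace ℝ (Fin 4)) 1)

/-- A finite CW cellulation of the 3-sphere. -/
structure FinCellulation3 where
  /-- the number of cells of each dimension -/
  count : Fin 4 → ℕ
  /-- the characteristic maps -/
  char : ∀ n : Fin 4, Fin (count n) → EuclideanSpace ℝ (Fin (n : ℕ)) → Sphere3
  continuousOn : ∀ (n : Fin 4) (i : Fin (count n)), ContinuousOn (char n i) (Disk (n : ℕ))
  /-- each characteristic map is a homeomorphism from the open disk onto its image -/
  embeds_open : ∀ (n : Fin 4) (i : Fin (count n)),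
    Topology.IsEmbedding ((OpenDisk (n : ℕ)).restrict (char n i))
  /-- the open cells are pairwise disjoint -/
  disjoint_open : ∀ (n m : Fin 4) (i : Fin (count n)) (j : Fin (count m)),
    (⟨n, i⟩ : Σ k : Fin 4, Fin (count k)) ≠ ⟨m, j⟩ →
      Disjoint (char n i '' OpenDisk (n : ℕ)) (char m j '' OpenDisk (m : ℕ))
  /-- the open cells cover the 3-sphere -/
  covers : (⋃ (n : Fin 4) (i : Fin (count n)), char n i '' OpenDisk (n : ℕ)) = Set.univ
  /-- the boundary of each cell is contained in the cells of lower dimension -/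
  bdry : ∀ (n : Fin 4) (i : Fin (count n)),
    char n i '' DiskBdry (n : ℕ) ⊆
      ⋃ (m : Fin 4) (_ : (m : ℕ) < (n : ℕ)) (j : Fin (count m)), char m j '' Disk (m : ℕ)

/-- A cellulation is regular if every characteristic map is a homeomorphism
from the whole closed disk onto its image. -/
def FinCellulation3.Regular (C : FinCellulation3) : Prop :=
  ∀ (n : Fin 4) (i : Fin (C.count n)),
    Topology.IsEmbedding ((Disk (n : ℕ)).restrict (C.char n i))

/-- A cellulation is strongly regular if it is regular and the intersection of
any two closed cells is empty or a single closed cell. -/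
def FinCellulation3.StronglyRegular (C : FinCellulation3) : Prop :=
  C.Regular ∧
  ∀ (n m : Fin 4) (i : Fin (C.count n)) (j : Fin (C.count m)),
    (C.char n i '' Disk (n : ℕ)) ∩ (C.char m j '' Disk (m : ℕ)) = ∅ ∨
    ∃ (p : Fin 4) (k : Fin (C.count p)),
      (C.char n i '' Disk (n : ℕ)) ∩ (C.char m j '' Disk (m : ℕ)) =
        C.char p k '' Disk (p : ℕ)

section
open Metric Set Topology
namespace FatS

abbrev E (n : ℕ) := EuclideanSpace ℝ (Fin n)

/-- `c` is an embedded closed disc with open part `o`. -/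
def IsCell {X : Type*} [TopologicalSpace X] (n : ℕ) (c o : Set X) : Prop :=
  ∃ f : E n → X, ContinuousOn f (closedBall 0 1) ∧ InjOn f (closedBall 0 1) ∧
    f '' closedBall 0 1 = c ∧ f '' ball 0 1 = o

variable {X Y : Type*} [TopologicalSpace X] [TopologicalSpace Y]

lemma IsCell.sub {n : ℕ} {c o : Set X} (h : IsCell n c o) : o ⊆ c := by
  obtain ⟨f, -, -, rfl, rfl⟩ := h
  exact image_mono ball_subset_closedBall

lemma IsCell.ne {n : ℕ} {c o : Set X} (h : IsCell n c o) : o.Nonempty := by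
  obtain ⟨f, -, -, rfl, rfl⟩ := h
  exact ⟨f 0, 0, by simp, rfl⟩

lemma IsCell.map {n : ℕ} {c o : Set X} (h : IsCell n c o) {g : X → Y}
    (hg : ContinuousOn g c) (hi : InjOn g c) : IsCell n (g '' c) (g '' o) := by
  obtain ⟨f, h1, h2, rfl, rfl⟩ := h
  refine ⟨g ∘ f, hg.comp h1 (mapsTo_image _ _), hi.comp h2 (mapsTo_image _ _), ?_, ?_⟩ <;>
  rw [image_comp]

lemma IsCell.of_convex {V : Type*} [NormedAddCommGroup V] [NormedSpace ℝ V]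
    [FiniteDimensional ℝ V] {n : ℕ} (hn : Module.finrank ℝ V = n) {K : Set V}
    (hK : Convex ℝ K) (hc : IsCompact K) (hi : (interior K).Nonempty) :
    IsCell n K (interior K) := by
  have hfr : Module.finrank ℝ (E n) = Module.finrank ℝ V := by simp [hn]
  let e : E n ≃L[ℝ] V := ContinuousLinearEquiv.ofFinrankEq hfr
  have hInt : interior (e ⁻¹' K) = e ⁻¹' interior K :=
    (e.toHomeomorph.preimage_interior K).symm
  have hc' : IsCompact (e ⁻¹' K) := e.toHomeomorph.isCompact_preimage.2 hc
  obtain ⟨h, h1, h2, h3⟩ := exists_homeomorph_image_interior_closure_frontier_eq_unitBall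
    (s := e ⁻¹' K) (hK.linear_preimage (e : E n →ₗ[ℝ] V)) (by
      rw [hInt]; obtain ⟨x, hx⟩ := hi; exact ⟨e.symm x, by simpa using hx⟩) hc'.isBounded
  rw [hc'.isClosed.closure_eq] at h2
  refine ⟨fun x => e (h.symm x), ?_, ?_, ?_, ?_⟩
  · fun_prop
  · exact (e.injective.comp h.symm.injective).injOn
  · have : (fun x => e (h.symm x)) = e ∘ h.symm := rfl
    rw [this, image_comp, ← h2, ← image_comp (⇑h.symm)]
    simp [image_preimage_eq _ e.surjective]
  · have : (fun x => e (h.symm x)) = e ∘ h.symm := rfl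
    rw [this, image_comp, ← h1, ← image_comp (⇑h.symm)]
    simp [hInt, image_preimage_eq _ e.surjective]

lemma IsCell.of_Icc {a b : ℝ} (hab : a < b) : IsCell 1 (Icc a b) (Ioo a b) := by
  have := IsCell.of_convex (V := ℝ) (n := 1) (by simp) (convex_Icc a b) isCompact_Icc
    (by rw [interior_Icc]; exact nonempty_Ioo.2 hab)
  rwa [interior_Icc] at this

lemma IsCell.point (x : X) : IsCell 0 ({x} : Set X) {x} := by
  refine ⟨fun _ => x, continuousOn_const, fun a _ b _ _ => Subsingleton.elim _ _, ?_, ?_⟩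
  · exact Nonempty.image_const ⟨0, by simp⟩ x
  · exact Nonempty.image_const ⟨0, by simp⟩ x

lemma coneBody_cell (d : ℕ) : IsCell (d+1) {p : E d × ℝ | ‖p.1‖ ≤ p.2 ∧ p.2 ≤ 1}
    {p : E d × ℝ | ‖p.1‖ < p.2 ∧ p.2 < 1} := by
  set K := {p : E d × ℝ | ‖p.1‖ ≤ p.2 ∧ p.2 ≤ 1} with hKd
  have hcl : IsClosed K := by
    apply IsClosed.inter (s₁ := {p : E d × ℝ | ‖p.1‖ ≤ p.2}) (s₂ := {p : E d × ℝ | p.2 ≤ 1})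
    · exact isClosed_le (by fun_prop) (by fun_prop)
    · exact isClosed_le (by fun_prop) (by fun_prop)
  have hop : IsOpen {p : E d × ℝ | ‖p.1‖ < p.2 ∧ p.2 < 1} := by
    apply IsOpen.inter (s := {p : E d × ℝ | ‖p.1‖ < p.2}) (t := {p : E d × ℝ | p.2 < 1})
    · exact isOpen_lt (by fun_prop) (by fun_prop)
    · exact isOpen_lt (by fun_prop) (by fun_prop)
  have hInt : interior K = {p : E d × ℝ | ‖p.1‖ < p.2 ∧ p.2 < 1} := by
    apply Subset.antisymm
    · intro p hp
      obtain ⟨ε, he, hb⟩ := Metric.isOpen_iff.1 isOpen_interior p hp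
      have hb := hb.trans interior_subset
      have m1 : (p.1, p.2 - ε/2) ∈ ball p ε := by
        rw [mem_ball, Prod.dist_eq]; simp [Real.dist_eq, abs_of_pos he, he]
      have m2 : (p.1, p.2 + ε/2) ∈ ball p ε := by
        rw [mem_ball, Prod.dist_eq]; simp [Real.dist_eq, abs_of_pos he, he]
      have h1 := (hb m1).1
      have h2 := (hb m2).2
      simp only at h1 h2
      exact ⟨by linarith, by linarith⟩
    · exact interior_maximal (fun p hp => ⟨hp.1.le, hp.2.le⟩) hop
  rw [← hInt]
  apply IsCell.of_convex (by simp)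
  · intro p hp q hq a b ha hb hab
    refine ⟨?_, ?_⟩
    · calc ‖a • p.1 + b • q.1‖ ≤ ‖a • p.1‖ + ‖b • q.1‖ := norm_add_le _ _
        _ = a * ‖p.1‖ + b * ‖q.1‖ := by
          rw [norm_smul, norm_smul, Real.norm_of_nonneg ha, Real.norm_of_nonneg hb]
        _ ≤ a * p.2 + b * q.2 := by gcongr; exacts [hp.1, hq.1]
    · have : a * p.2 + b * q.2 ≤ a * 1 + b * 1 := by gcongr; exacts [hp.2, hq.2]
      simpa [hab] using this
  · apply Metric.isCompact_of_isClosed_isBounded hcl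
    apply (isBounded_closedBall (x := (0 : E d × ℝ)) (r := 1)).subset
    intro p hp
    rw [mem_closedBall, dist_zero_right, Prod.norm_def]
    have := norm_nonneg p.1
    refine max_le (hp.1.trans hp.2) ?_
    rw [Real.norm_of_nonneg (this.trans hp.1)]; exact hp.2
  · rw [hInt]; exact ⟨(0, 1/2), by norm_num, by norm_num⟩

/-- coning inside a ball -/
def coneC {n : ℕ} (F : E n → X) (c : Set X) : Set X :=
  {x | ∃ t : ℝ, 0 ≤ t ∧ t ≤ 1 ∧ ∃ b : E n, ‖b‖ = 1 ∧ F b ∈ c ∧ F (t • b) = x}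
def coneO {n : ℕ} (F : E n → X) (c : Set X) : Set X :=
  {x | ∃ t : ℝ, 0 < t ∧ t < 1 ∧ ∃ b : E n, ‖b‖ = 1 ∧ F b ∈ c ∧ F (t • b) = x}

lemma cone_cell [T2Space X] {n d : ℕ} {F : E n → X} (hF : ContinuousOn F (closedBall 0 1))
    (hFi : InjOn F (closedBall 0 1)) {c o : Set X} (hc : IsCell d c o)
    (hs : c ⊆ F '' sphere 0 1) : IsCell (d+1) (coneC F c) (coneO F o) := by
  obtain ⟨f, h1, h2, rfl, rfl⟩ := hc
  set B := closedBall (0 : E d) 1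
  have hex : ∀ y : E d, ∃ b : E n, ‖b‖ = 1 ∧ (y ∈ B → F b = f y) := by
    intro y
    have h0 : (0 : E d) ∈ B := by simp [B]
    by_cases hy : y ∈ B
    · obtain ⟨b, hb, hb'⟩ := hs ⟨y, hy, rfl⟩
      exact ⟨b, by simpa using hb, fun _ => hb'⟩
    · obtain ⟨b, hb, hb'⟩ := hs ⟨0, h0, rfl⟩
      exact ⟨b, by simpa using hb, fun h => absurd h hy⟩
  choose b hb1 hbf using hex
  have hbc : ContinuousOn b B := by
    rw [continuousOn_iff_continuous_domRestrict]
    have hemb : IsClosedEmbedding ((closedBall (0 : E n) 1).domRestrict F) := by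
      haveI : CompactSpace (closedBall (0 : E n) 1) :=
        isCompact_iff_compactSpace.1 (isCompact_closedBall _ _)
      exact Continuous.isClosedEmbedding (continuousOn_iff_continuous_domRestrict.1 hF)
        (injOn_iff_injective.1 hFi)
    let b' : B → closedBall (0 : E n) 1 := fun y => ⟨b y, by simp [hb1]⟩
    have hb' : Continuous b' := by
      rw [hemb.isEmbedding.continuous_iff]
      have : (closedBall (0 : E n) 1).domRestrict F ∘ b' = B.domRestrict f := by
        ext y; exact hbf y y.2
      rw [this]; exact continuousOn_iff_continuous_domRestrict.1 h1
    exact continuous_subtype_val.comp hb'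
  have hbi : InjOn b B := fun x hx y hy hxy => h2 hx hy (by rw [← hbf x hx, ← hbf y hy, hxy])
  let a : E d × ℝ → E n := fun p => p.2 • b (p.2⁻¹ • p.1)
  have hK := coneBody_cell d
  set K := {p : E d × ℝ | ‖p.1‖ ≤ p.2 ∧ p.2 ≤ 1}
  have hdiv : ∀ p ∈ K, 0 < p.2 → p.2⁻¹ • p.1 ∈ B := by
    intro p hp h0
    simp only [B, mem_closedBall, dist_zero_right, norm_smul, norm_inv, Real.norm_of_nonneg h0.le]
    rw [inv_mul_le_iff₀ h0]; simpa using hp.1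
  have ha : ContinuousOn a K := by
    intro p hp
    have h0 : 0 ≤ p.2 := (norm_nonneg _).trans hp.1
    rcases h0.eq_or_lt with h0 | h0
    · have e0 : a p = 0 := by simp [a, ← h0]
      rw [ContinuousWithinAt, e0]
      apply squeeze_zero_norm' (a := fun q : E d × ℝ => ‖q.2‖)
      · refine Filter.Eventually.of_forall fun q => ?_
        simp [a, norm_smul, hb1]
      · have : ContinuousWithinAt (fun q : E d × ℝ => ‖q.2‖) K p := by fun_prop
        rw [ContinuousWithinAt, ← h0] at this
        simpa using this
    · have hm : MapsTo (fun q : E d × ℝ => q.2⁻¹ • q.1) (K ∩ {q | 0 < q.2}) B :=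
        fun q hq => hdiv q hq.1 hq.2
      have hc1 : ContinuousWithinAt (fun q : E d × ℝ => q.2⁻¹ • q.1) (K ∩ {q | 0 < q.2}) p := by
        have e1 : ContinuousWithinAt (fun q : E d × ℝ => q.2⁻¹) (K ∩ {q | 0 < q.2}) p :=
          ContinuousWithinAt.inv₀ (by fun_prop) h0.ne'
        have e2 : ContinuousWithinAt (fun q : E d × ℝ => q.1) (K ∩ {q | 0 < q.2}) p := by fun_prop
        exact e1.smul e2
      have hc2 : ContinuousWithinAt a (K ∩ {q | 0 < q.2}) p := by
        have e2 : ContinuousWithinAt (fun q : E d × ℝ => q.2) (K ∩ {q | 0 < q.2}) p := by fun_prop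
        have e3 := ContinuousWithinAt.comp (f := fun q : E d × ℝ => q.2⁻¹ • q.1) (g := b) (t := B)
          (x := p) (hbc _ (hdiv p hp h0)) hc1 hm
        exact e2.smul e3
      rwa [continuousWithinAt_inter] at hc2
      exact (isOpen_lt continuous_const continuous_snd).mem_nhds h0
  have hnorm : ∀ p ∈ K, ‖a p‖ = p.2 := by
    intro p hp
    have h0 : 0 ≤ p.2 := (norm_nonneg _).trans hp.1
    simp [a, norm_smul, hb1, abs_of_nonneg h0]
  have hmaps : MapsTo a K (closedBall 0 1) := by
    intro p hp; simpa [hnorm p hp] using hp.2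
  have hai : InjOn a K := by
    intro p hp q hq hpq
    have e2 : p.2 = q.2 := by rw [← hnorm p hp, ← hnorm q hq, hpq]
    have h0 : 0 ≤ p.2 := (norm_nonneg _).trans hp.1
    rcases h0.eq_or_lt with h0 | h0
    · have z1 : p.1 = 0 := norm_le_zero_iff.1 (h0 ▸ hp.1)
      have z2 : q.1 = 0 := norm_le_zero_iff.1 ((e2 ▸ h0) ▸ hq.1)
      exact Prod.ext (z1.trans z2.symm) e2
    · simp only [a] at hpq
      rw [← e2] at hpq
      have := smul_right_injective (E n) h0.ne' hpq
      have := hbi (hdiv p hp h0) (e2 ▸ hdiv q hq (e2 ▸ h0)) this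
      exact Prod.ext (smul_right_injective (E d) (inv_pos.2 h0).ne' this) e2
  have key := hK.map (hF.comp ha hmaps) (hFi.comp hai hmaps)
  convert key using 1
  · ext x; constructor
    · rintro ⟨t, ht0, ht1, b', hb', ⟨y, hy, hyb⟩, rfl⟩
      have hbb : b' = b y := hFi (by simp [hb']) (by simp [hb1]) (by rw [hbf y hy, hyb])
      have hyn : ‖y‖ ≤ 1 := by simpa [B] using hy
      refine ⟨(t • y, t), ⟨?_, ht1⟩, ?_⟩
      · simp only [norm_smul, Real.norm_of_nonneg ht0]
        exact mul_le_of_le_one_right ht0 hyn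
      · rcases ht0.eq_or_lt with h0 | h0
        · simp [a, ← h0]
        · simp [a, smul_smul, inv_mul_cancel₀ h0.ne', hbb]
    · rintro ⟨p, hp, rfl⟩
      have h0 : 0 ≤ p.2 := (norm_nonneg _).trans hp.1
      rcases h0.eq_or_lt with h0 | h0
      · refine ⟨0, le_rfl, zero_le_one, b 0, hb1 _, ?_, ?_⟩
        · rw [hbf 0 (by simp [B])]; exact ⟨0, by simp [B], rfl⟩
        · simp [a, ← h0]
      · refine ⟨p.2, h0.le, hp.2, b (p.2⁻¹ • p.1), hb1 _, ?_, rfl⟩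
        rw [hbf _ (hdiv p hp h0)]; exact ⟨_, hdiv p hp h0, rfl⟩
  · ext x; constructor
    · rintro ⟨t, ht0, ht1, b', hb', ⟨y, hy, hyb⟩, rfl⟩
      have hyB : y ∈ B := ball_subset_closedBall hy
      have hbb : b' = b y := hFi (by simp [hb']) (by simp [hb1]) (by rw [hbf y hyB, hyb])
      have hyn : ‖y‖ < 1 := by simpa using hy
      refine ⟨(t • y, t), ⟨?_, ht1⟩, ?_⟩
      · simp only [norm_smul, Real.norm_of_nonneg ht0.le]
        exact mul_lt_of_lt_one_right ht0 hyn
      · simp [a, smul_smul, inv_mul_cancel₀ ht0.ne', hbb]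
    · rintro ⟨p, hp, rfl⟩
      have h0 : 0 < p.2 := (norm_nonneg _).trans_lt hp.1
      refine ⟨p.2, h0, hp.2, b (p.2⁻¹ • p.1), hb1 _, ?_, rfl⟩
      rw [hbf _ (hdiv p ⟨hp.1.le, hp.2.le⟩ h0)]
      refine ⟨_, ?_, rfl⟩
      simp only [mem_ball, dist_zero_right, norm_smul, norm_inv, Real.norm_of_nonneg h0.le]
      rw [inv_mul_lt_iff₀ h0]; simpa using hp.1

/-- partial strongly regular complexes -/
structure PC (X : Type) [TopologicalSpace X] (ι : Type) where
  d : ι → ℕ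
  c : ι → Set X
  o : ι → Set X
  cell : ∀ i, IsCell (d i) (c i) (o i)
  clo : ∀ j i, (o j ∩ c i).Nonempty → c j ⊆ c i
  dim : ∀ j i, (o j ∩ c i).Nonempty → j ≠ i → d j < d i
  bd : ∀ i, c i ⊆ ⋃ j, o j
  inter : ∀ i j, c i ∩ c j = ∅ ∨ ∃ k, c k = c i ∩ c j

lemma coneC_mono {n : ℕ} {F : E n → X} {c c' : Set X} (h : c ⊆ c') : coneC F c ⊆ coneC F c' := by
  rintro x ⟨t, h0, h1, b, hb, hc, rfl⟩
  exact ⟨t, h0, h1, b, hb, h hc, rfl⟩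

/-- data of holes in a partial complex -/
structure Holes {X : Type} [TopologicalSpace X] {ι : Type} (P : PC X ι) (κ : Type) where
  n : κ → ℕ
  D : κ → Set X
  O : κ → Set X
  cell : ∀ k, IsCell (n k) (D k) (O k)
  disj : ∀ k k', k ≠ k' → Disjoint (O k) (O k')
  disj' : ∀ k i, Disjoint (O k) (P.o i)
  bd : ∀ k, D k ⊆ O k ∪ ⋃ i, P.o i
  clo : ∀ k i, (P.o i ∩ D k).Nonempty → P.c i ⊆ D k

namespace Holes
variable {X : Type} [TopologicalSpace X] [T2Space X] {ι κ : Type} {P : PC X ι} (S : Holes P κ)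

abbrev Ix (S : Holes P κ) : Type := ι ⊕ (Σ k : κ, Option {i : ι // P.c i ⊆ S.D k})

def F (k : κ) : E (S.n k) → X := (S.cell k).choose
lemma F_cont (k : κ) : ContinuousOn (S.F k) (closedBall 0 1) := (S.cell k).choose_spec.1
lemma F_inj (k : κ) : InjOn (S.F k) (closedBall 0 1) := (S.cell k).choose_spec.2.1
lemma F_D (k : κ) : S.F k '' (closedBall 0 1) = S.D k := (S.cell k).choose_spec.2.2.1
lemma F_O (k : κ) : S.F k '' (ball 0 1) = S.O k := (S.cell k).choose_spec.2.2.2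

lemma c_disj (k : κ) (i : ι) : Disjoint (S.O k) (P.c i) := by
  rw [Set.disjoint_left]
  intro x hx hx'
  obtain ⟨j, hj⟩ := mem_iUnion.1 (P.bd i hx')
  exact Set.disjoint_left.1 (S.disj' k j) hx hj

def d : S.Ix → ℕ
  | .inl i => P.d i
  | .inr ⟨_, none⟩ => 0
  | .inr ⟨_, some i⟩ => P.d i.1 + 1
def c : S.Ix → Set X
  | .inl i => P.c i
  | .inr ⟨k, none⟩ => {S.F k 0}
  | .inr ⟨k, some i⟩ => coneC (S.F k) (P.c i.1)
def o : S.Ix → Set X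
  | .inl i => P.o i
  | .inr ⟨k, none⟩ => {S.F k 0}
  | .inr ⟨k, some i⟩ => coneO (S.F k) (P.o i.1)

lemma O_eq {k : κ} {p : E (S.n k)} (hp : ‖p‖ ≤ 1) (h : S.F k p ∉ S.O k) : ‖p‖ = 1 := by
  by_contra hne
  exact h (S.F_O k ▸ ⟨p, by simpa using lt_of_le_of_ne hp hne, rfl⟩)

lemma norm_lt {k : κ} {p : E (S.n k)} (hp : ‖p‖ ≤ 1) (h : S.F k p ∈ S.O k) : ‖p‖ < 1 := by
  rw [← S.F_O k] at h
  obtain ⟨q, hq, hqp⟩ := h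
  have : q = p := S.F_inj k (ball_subset_closedBall hq) (by simpa using hp) hqp
  rw [← this]; simpa using hq

lemma mem_O {k : κ} {p : E (S.n k)} (hp : ‖p‖ < 1) : S.F k p ∈ S.O k :=
  S.F_O k ▸ ⟨p, by simpa using hp, rfl⟩
lemma mem_D {k : κ} {p : E (S.n k)} (hp : ‖p‖ ≤ 1) : S.F k p ∈ S.D k :=
  S.F_D k ▸ ⟨p, by simpa using hp, rfl⟩

lemma cone_notO {k : κ} {A : Set X} {x : X} (hx : x ∈ coneC (S.F k) A) (h : x ∉ S.O k) : x ∈ A := by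
  obtain ⟨t, h0, h1, b, hb, hc, rfl⟩ := hx
  have : ‖t • b‖ = 1 := S.O_eq (by rw [norm_smul, hb, Real.norm_of_nonneg h0]; linarith) h
  rw [norm_smul, hb, Real.norm_of_nonneg h0, mul_one] at this
  subst this; simpa using hc

lemma sub_cone {k : κ} {i : ι} (h : P.c i ⊆ S.D k) : P.c i ⊆ coneC (S.F k) (P.c i) := by
  intro x hx
  have hD := h hx
  rw [← S.F_D k] at hD
  obtain ⟨b, hb, rfl⟩ := hD
  have : ‖b‖ = 1 := S.O_eq (by simpa using hb) fun h' => Set.disjoint_left.1 (S.c_disj k i) h' hx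
  exact ⟨1, zero_le_one, le_rfl, b, this, hx, by simp⟩

lemma cone_sub_D {k : κ} {A : Set X} : coneC (S.F k) A ⊆ S.D k := by
  rintro x ⟨t, h0, h1, b, hb, hc, rfl⟩
  exact S.mem_D (by rw [norm_smul, hb, Real.norm_of_nonneg h0]; linarith)

lemma coneO_sub_O {k : κ} {A : Set X} : coneO (S.F k) A ⊆ S.O k := by
  rintro x ⟨t, h0, h1, b, hb, hc, rfl⟩
  exact S.mem_O (by rw [norm_smul, hb, Real.norm_of_nonneg h0.le]; linarith)

lemma apex_mem (k : κ) : S.F k 0 ∈ S.O k := S.mem_O (by simp)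

lemma apex_cone {k : κ} {i : ι} (h : P.c i ⊆ S.D k) : S.F k 0 ∈ coneC (S.F k) (P.c i) := by
  obtain ⟨x, hx⟩ := (P.cell i).ne.mono (P.cell i).sub
  obtain ⟨t, h0, h1, b, hb, hc, rfl⟩ := S.sub_cone h hx
  exact ⟨0, le_rfl, zero_le_one, b, hb, hc, by simp⟩

lemma cone_eq {k : κ} {t t' : ℝ} {b b' : E (S.n k)} (h0 : 0 ≤ t) (h1 : t ≤ 1) (h0' : 0 ≤ t')
    (h1' : t' ≤ 1) (hb : ‖b‖ = 1) (hb' : ‖b'‖ = 1) (h : S.F k (t • b) = S.F k (t' • b')) :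
    t = t' ∧ (0 < t → b = b') := by
  have e : t • b = t' • b' := S.F_inj k (by simp [norm_smul, hb, abs_of_nonneg h0, h1])
    (by simp [norm_smul, hb', abs_of_nonneg h0', h1']) h
  have : t = t' := by
    have := congrArg norm e
    simpa [norm_smul, hb, hb', abs_of_nonneg h0, abs_of_nonneg h0'] using this
  refine ⟨this, fun hp => ?_⟩
  subst this
  exact smul_right_injective _ hp.ne' e

lemma apex_coneO {k : κ} {A : Set X} : S.F k 0 ∉ coneO (S.F k) A := by
  rintro ⟨t, h0, h1, b, hb, hc, h⟩
  have := S.cone_eq h0.le h1.le le_rfl zero_le_one hb hb (by simpa using h)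
  linarith [this.1]

lemma o_sub_O (k : κ) (x) : S.o (.inr ⟨k, x⟩) ⊆ S.O k := by
  rcases x with _ | i
  · rintro _ rfl; exact S.apex_mem k
  · exact S.coneO_sub_O
lemma c_sub_D (k : κ) (x) : S.c (.inr ⟨k, x⟩) ⊆ S.D k := by
  rcases x with _ | i
  · rintro _ rfl; exact (S.cell k).sub (S.apex_mem k)
  · exact S.cone_sub_D

lemma main (j i : S.Ix) (h : (S.o j ∩ S.c i).Nonempty) :
    S.c j ⊆ S.c i ∧ (j ≠ i → S.d j < S.d i) := by
  obtain ⟨x, hxj, hxi⟩ := h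
  rcases j with j | ⟨k, j⟩ <;> rcases i with i | ⟨k', i⟩
  · exact ⟨P.clo j i ⟨x, hxj, hxi⟩, fun hne => P.dim j i ⟨x, hxj, hxi⟩ (by simpa using hne)⟩
  · have hnO : x ∉ S.O k' := fun h => Set.disjoint_left.1 (S.disj' k' j) h hxj
    rcases i with _ | i
    · rw [mem_singleton_iff.1 hxi] at hnO; exact absurd (S.apex_mem k') hnO
    · have hx : x ∈ P.c i.1 := S.cone_notO hxi hnO
      refine ⟨(P.clo j i.1 ⟨x, hxj, hx⟩).trans (S.sub_cone i.2), fun _ => ?_⟩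
      change P.d j < P.d i.1 + 1
      by_cases hji : j = i.1
      · rw [hji]; omega
      · have := P.dim j i.1 ⟨x, hxj, hx⟩ hji; omega
  · exact absurd hxi (Set.disjoint_left.1 (S.c_disj k i) (S.o_sub_O k j hxj))
  · have hxO := S.o_sub_O k j hxj
    have hxD := S.c_sub_D k' i hxi
    have hk : k = k' := by
      by_contra hne
      rcases S.bd k' hxD with h | h
      · exact Set.disjoint_left.1 (S.disj k k' hne) hxO h
      · obtain ⟨l, hl⟩ := mem_iUnion.1 h
        exact Set.disjoint_left.1 (S.disj' k l) hxO hl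
    subst hk
    rcases j with _ | j <;> rcases i with _ | i
    · exact ⟨Subset.rfl, fun h => absurd rfl h⟩
    · refine ⟨?_, fun _ => Nat.succ_pos _⟩
      rintro _ rfl; exact S.apex_cone i.2
    · rw [mem_singleton_iff.1 hxi] at hxj; exact absurd hxj S.apex_coneO
    · obtain ⟨t, h0, h1, b, hb, hc, rfl⟩ := hxj
      obtain ⟨t', h0', h1', b', hb', hc', he⟩ := hxi
      obtain ⟨-, e⟩ := S.cone_eq h0.le h1.le h0' h1' hb hb' he.symm
      rw [← e h0] at hc'
      refine ⟨coneC_mono (P.clo _ _ ⟨_, hc, hc'⟩), fun hne => ?_⟩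
      have := P.dim _ _ ⟨_, hc, hc'⟩ (fun h => hne (by rw [Subtype.ext h]))
      exact Nat.succ_lt_succ this

lemma old_inter {A : Set X} (h : A = ∅ ∨ ∃ k, P.c k = A) : A = ∅ ∨ ∃ k, S.c k = A := by
  rcases h with h | ⟨k, h⟩
  · exact .inl h
  · exact .inr ⟨.inl k, h⟩

lemma inter1 (i : ι) (k : κ) (j) : P.c i ∩ S.c (.inr ⟨k, j⟩) = ∅ ∨
    ∃ l, S.c l = P.c i ∩ S.c (.inr ⟨k, j⟩) := by
  rcases j with _ | j
  · left
    rw [eq_empty_iff_forall_notMem]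
    rintro x ⟨hx, rfl⟩
    exact Set.disjoint_left.1 (S.c_disj k i) (S.apex_mem k) hx
  · have : P.c i ∩ S.c (.inr ⟨k, some j⟩) = P.c i ∩ P.c j.1 := by
      ext x; constructor
      · rintro ⟨hx, hx'⟩
        exact ⟨hx, S.cone_notO hx' fun h => Set.disjoint_left.1 (S.c_disj k i) h hx⟩
      · rintro ⟨hx, hx'⟩; exact ⟨hx, S.sub_cone j.2 hx'⟩
    rw [this]; exact S.old_inter (P.inter i j.1)

lemma inter2 (k k' : κ) (i j) : S.c (.inr ⟨k, i⟩) ∩ S.c (.inr ⟨k', j⟩) = ∅ ∨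
    ∃ l, S.c l = S.c (.inr ⟨k, i⟩) ∩ S.c (.inr ⟨k', j⟩) := by
  by_cases hk : k = k'
  · subst hk
    have apx : ∀ j, S.F k 0 ∈ S.c (.inr ⟨k, j⟩) := by
      rintro (_ | j)
      · exact rfl
      · exact S.apex_cone j.2
    have a1 : S.c (.inr ⟨k, none⟩) = {S.F k 0} := rfl
    rcases i with _ | i
    · right
      refine ⟨.inr ⟨k, none⟩, ?_⟩
      rw [a1]; exact (inter_eq_left.2 (singleton_subset_iff.2 (apx j))).symm
    rcases j with _ | j
    · right
      refine ⟨.inr ⟨k, none⟩, ?_⟩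
      rw [a1]; exact (inter_eq_right.2 (singleton_subset_iff.2 (apx (some i)))).symm
    have key : S.c (.inr ⟨k, some i⟩) ∩ S.c (.inr ⟨k, some j⟩) =
        {S.F k 0} ∪ coneC (S.F k) (P.c i.1 ∩ P.c j.1) := by
      ext x; constructor
      · rintro ⟨⟨t, h0, h1, b, hb, hc, rfl⟩, t', h0', h1', b', hb', hc', he⟩
        obtain ⟨-, e⟩ := S.cone_eq h0 h1 h0' h1' hb hb' he.symm
        rcases h0.eq_or_lt with h0 | h0
        · left; simp [← h0]
        · right; rw [← e h0] at hc'; exact ⟨t, h0.le, h1, b, hb, ⟨hc, hc'⟩, rfl⟩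
      · rintro (rfl | h)
        · exact ⟨apx (some i), apx (some j)⟩
        · exact ⟨coneC_mono inter_subset_left h, coneC_mono inter_subset_right h⟩
    right
    rw [key]
    rcases P.inter i.1 j.1 with h | ⟨l, h⟩
    · refine ⟨.inr ⟨k, none⟩, ?_⟩
      rw [h, a1]; symm
      rw [union_eq_left]
      rintro x ⟨t, h0, h1, b, hb, hc, rfl⟩
      exact absurd hc (by simp)
    · have hl : P.c l ⊆ S.D k := by rw [h]; exact inter_subset_left.trans i.2
      refine ⟨.inr ⟨k, some ⟨l, hl⟩⟩, ?_⟩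
      rw [← h]; symm
      exact union_eq_right.2 (singleton_subset_iff.2 (S.apex_cone hl))
  · have hno : ∀ k k' i j, k ≠ k' → ∀ x, x ∈ S.c (.inr ⟨k, i⟩) → x ∈ S.c (.inr ⟨k', j⟩) →
        x ∉ S.O k := by
      intro k k' i j hk x hx hx' h
      rcases S.bd k' (S.c_sub_D k' j hx') with h' | h'
      · exact Set.disjoint_left.1 (S.disj k k' hk) h h'
      · obtain ⟨l, hl⟩ := mem_iUnion.1 h'
        exact Set.disjoint_left.1 (S.disj' k l) h hl
    rcases i with _ | i
    · left
      rw [eq_empty_iff_forall_notMem]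
      rintro x ⟨hx, hx'⟩
      have := hno _ _ _ _ hk x hx hx'
      rw [mem_singleton_iff.1 hx] at this
      exact this (S.apex_mem k)
    rcases j with _ | j
    · left
      rw [eq_empty_iff_forall_notMem]
      rintro x ⟨hx, hx'⟩
      have := hno _ _ _ _ (Ne.symm hk) x hx' hx
      rw [mem_singleton_iff.1 hx'] at this
      exact this (S.apex_mem k')
    have key : S.c (.inr ⟨k, some i⟩) ∩ S.c (.inr ⟨k', some j⟩) = P.c i.1 ∩ P.c j.1 := by
      ext x; constructor
      · rintro ⟨hx, hx'⟩
        exact ⟨S.cone_notO hx (hno _ _ _ _ hk x hx hx'),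
          S.cone_notO hx' (hno _ _ _ _ (Ne.symm hk) x hx' hx)⟩
      · rintro ⟨hx, hx'⟩; exact ⟨S.sub_cone i.2 hx, S.sub_cone j.2 hx'⟩
    rw [key]; exact S.old_inter (P.inter _ _)

lemma exists_o {k : κ} {b : E (S.n k)} (hb : ‖b‖ = 1) :
    ∃ j, S.F k b ∈ P.o j ∧ P.c j ⊆ S.D k := by
  have hD := S.mem_D (k := k) hb.le
  rcases S.bd k hD with h | h
  · exact absurd (S.norm_lt hb.le h) (by linarith)
  · obtain ⟨j, hj⟩ := mem_iUnion.1 h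
    exact ⟨j, hj, S.clo k j ⟨_, hj, hD⟩⟩

lemma O_cov (k : κ) : S.O k ⊆ ⋃ j, S.o j := by
  intro x hx
  rw [← S.F_O k] at hx
  obtain ⟨p, hp, rfl⟩ := hx
  have hp : ‖p‖ < 1 := by simpa using hp
  by_cases h0 : p = 0
  · exact mem_iUnion.2 ⟨.inr ⟨k, none⟩, by rw [h0]; exact rfl⟩
  · have hn : 0 < ‖p‖ := norm_pos_iff.2 h0
    have hb : ‖‖p‖⁻¹ • p‖ = 1 := by simp [norm_smul, inv_mul_cancel₀ hn.ne']
    obtain ⟨j, hj, hD⟩ := S.exists_o hb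
    refine mem_iUnion.2 ⟨.inr ⟨k, some ⟨j, hD⟩⟩, ‖p‖, hn, hp, _, hb, hj, ?_⟩
    rw [smul_smul, mul_inv_cancel₀ hn.ne', one_smul]

def fill : PC X S.Ix where
  d := S.d
  c := S.c
  o := S.o
  cell := by
    rintro (i | ⟨k, _ | i⟩)
    · exact P.cell i
    · exact IsCell.point _
    · apply cone_cell (S.F_cont k) (S.F_inj k) (P.cell i.1)
      intro x hx
      have hD := i.2 hx
      rw [← S.F_D k] at hD
      obtain ⟨b, hb, rfl⟩ := hD
      have : ‖b‖ = 1 := S.O_eq (by simpa using hb)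
        fun h' => Set.disjoint_left.1 (S.c_disj k i) h' hx
      exact ⟨b, by simpa using this, rfl⟩
  clo := fun j i h => (S.main j i h).1
  dim := fun j i h => (S.main j i h).2
  bd := by
    rintro (i | ⟨k, _ | i⟩) x hx
    · obtain ⟨j, hj⟩ := mem_iUnion.1 (P.bd i hx)
      exact mem_iUnion.2 ⟨.inl j, hj⟩
    · exact mem_iUnion.2 ⟨.inr ⟨k, none⟩, hx⟩
    · rcases S.bd k (S.c_sub_D k _ hx) with h | h
      · exact S.O_cov k h
      · obtain ⟨j, hj⟩ := mem_iUnion.1 h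
        exact mem_iUnion.2 ⟨.inl j, hj⟩
  inter := by
    rintro (i | ⟨k, i⟩) (j | ⟨k', j⟩)
    · exact S.old_inter (P.inter i j)
    · exact S.inter1 i k' j
    · rw [inter_comm]; exact S.inter1 j k i
    · exact S.inter2 k k' i j

lemma fill_union : (⋃ j, S.fill.o j) = (⋃ i, P.o i) ∪ ⋃ k, S.O k := by
  apply Subset.antisymm
  · rintro x hx
    obtain ⟨j | ⟨k, j⟩, hj⟩ := mem_iUnion.1 hx
    · exact .inl (mem_iUnion.2 ⟨j, hj⟩)
    · exact .inr (mem_iUnion.2 ⟨k, S.o_sub_O k j hj⟩)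
  · rintro x (hx | hx)
    · obtain ⟨j, hj⟩ := mem_iUnion.1 hx
      exact mem_iUnion.2 ⟨.inl j, hj⟩
    · obtain ⟨k, hk⟩ := mem_iUnion.1 hx
      exact S.O_cov k hk

end Holes
end FatS
end

section
open Metric Set Topology
namespace FatS

def nsq (z : E 2) : ℝ := z 0 ^ 2 + z 1 ^ 2
def Phi (z : E 2) (w : ℂ) : E 4 := !₂[z 0, z 1, √(1 - nsq z) * w.re, √(1 - nsq z) * w.im]

lemma nsq_cont : Continuous nsq := by unfold nsq; fun_prop
lemma nsq_nonneg (z : E 2) : 0 ≤ nsq z := by unfold nsq; positivity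

lemma Phi_inj {z z' : E 2} {w w' : ℂ} (h : Phi z w = Phi z' w') : z = z' ∧ (nsq z < 1 → w = w') := by
  have h0 := congrArg (fun x : E 4 => x 0) h
  have h1 := congrArg (fun x : E 4 => x 1) h
  have h2 := congrArg (fun x : E 4 => x 2) h
  have h3 := congrArg (fun x : E 4 => x 3) h
  simp only [Phi, PiLp.toLp_apply, Matrix.cons_val] at h0 h1 h2 h3
  have e : z = z' := by ext i; fin_cases i <;> assumption
  refine ⟨e, fun hn => ?_⟩
  subst e
  have : 0 < √(1 - nsq z) := Real.sqrt_pos.2 (by linarith)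
  exact Complex.ext (mul_left_cancel₀ this.ne' h2) (mul_left_cancel₀ this.ne' h3)

lemma Phi_circle {z : E 2} {w w' : ℂ} (h : 1 ≤ nsq z) : Phi z w = Phi z w' := by
  have : √(1 - nsq z) = 0 := Real.sqrt_eq_zero_of_nonpos (by linarith)
  simp [Phi, this]

lemma normsq_one {w : ℂ} (hw : ‖w‖ = 1) : w.re ^ 2 + w.im ^ 2 = 1 := by
  have := Complex.sq_norm w
  rw [hw, Complex.normSq_apply] at this; nlinarith

lemma Phi_sphere {z : E 2} {w : ℂ} (h : nsq z ≤ 1) (hw : ‖w‖ = 1) : Phi z w ∈ sphere (0 : E 4) 1 := by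
  rw [mem_sphere_zero_iff_norm, EuclideanSpace.norm_eq, Real.sqrt_eq_one]
  have h1 := normsq_one hw
  have h2 := Real.sq_sqrt (show 0 ≤ 1 - nsq z by linarith)
  simp only [Fin.sum_univ_four, Phi, PiLp.toLp_apply, Matrix.cons_val, Real.norm_eq_abs, sq_abs, mul_pow, h2]
  have : z 0 ^ 2 + z 1 ^ 2 = nsq z := rfl
  linear_combination this + (1 - nsq z) * h1

lemma Phi_surj {x : E 4} (hx : x ∈ sphere (0 : E 4) 1) :
    ∃ z w, nsq z ≤ 1 ∧ ‖w‖ = 1 ∧ Phi z w = x := by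
  rw [mem_sphere_zero_iff_norm, EuclideanSpace.norm_eq, Real.sqrt_eq_one] at hx
  simp only [Fin.sum_univ_four, Real.norm_eq_abs, sq_abs] at hx
  have hn : nsq !₂[x 0, x 1] = x 0 ^ 2 + x 1 ^ 2 := by simp [nsq]
  by_cases h : x 2 ^ 2 + x 3 ^ 2 = 0
  · have h2 : x 2 = 0 := by nlinarith [sq_nonneg (x 2), sq_nonneg (x 3)]
    have h3 : x 3 = 0 := by nlinarith [sq_nonneg (x 2), sq_nonneg (x 3)]
    refine ⟨!₂[x 0, x 1], 1, by rw [hn]; nlinarith, by simp, ?_⟩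
    have : √(1 - nsq !₂[x 0, x 1]) = 0 := Real.sqrt_eq_zero_of_nonpos (by rw [hn]; nlinarith)
    ext i; fin_cases i <;> simp [Phi, this, h2, h3]
  · have hp : 0 < x 2 ^ 2 + x 3 ^ 2 := lt_of_le_of_ne (by positivity) (Ne.symm h)
    have hs : 0 < √(x 2 ^ 2 + x 3 ^ 2) := Real.sqrt_pos.2 hp
    have hsq := Real.sq_sqrt hp.le
    have e : 1 - nsq !₂[x 0, x 1] = x 2 ^ 2 + x 3 ^ 2 := by rw [hn]; linarith
    refine ⟨!₂[x 0, x 1], ⟨x 2 / √(x 2 ^ 2 + x 3 ^ 2), x 3 / √(x 2 ^ 2 + x 3 ^ 2)⟩,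
      by linarith, ?_, ?_⟩
    · rw [Complex.norm_def, Real.sqrt_eq_one, Complex.normSq_apply]
      field_simp
      rw [hsq]
    · ext i; fin_cases i <;> simp [Phi, e, mul_div_cancel₀ _ hs.ne']

lemma Phi_cont {α : Type*} [TopologicalSpace α] {zf : α → E 2} {W : α → ℂ} {S : Set α} {a : α}
    (hz : ContinuousWithinAt zf S a) (hW : ∀ x, ‖W x‖ = 1) (h1 : nsq (zf a) ≤ 1)
    (hc : nsq (zf a) < 1 → ContinuousWithinAt W S a) :
    ContinuousWithinAt (fun x => Phi (zf x) (W x)) S a := by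
  have hzc : ∀ i, ContinuousWithinAt (fun x => zf x i) S a := fun i =>
    (EuclideanSpace.proj (𝕜 := ℝ) i).continuous.continuousAt.comp_continuousWithinAt hz
  have hn : ContinuousWithinAt (fun x => √(1 - nsq (zf x))) S a := by
    have : Continuous (fun z => √(1 - nsq z)) := by have := nsq_cont; fun_prop
    exact this.continuousAt.comp_continuousWithinAt hz
  have key : ∀ u : ℂ → ℝ, Continuous u → (∀ w, ‖w‖ = 1 → |u w| ≤ 1) →
      ContinuousWithinAt (fun x => √(1 - nsq (zf x)) * u (W x)) S a := by
    intro u hu hb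
    rcases h1.lt_or_eq with h | h
    · exact hn.mul (hu.continuousAt.comp_continuousWithinAt (hc h))
    · have e0 : √(1 - nsq (zf a)) = 0 := by simp [h]
      rw [ContinuousWithinAt, e0, zero_mul]
      apply squeeze_zero_norm (a := fun x => √(1 - nsq (zf x)))
      · intro x
        rw [Real.norm_eq_abs, abs_mul, abs_of_nonneg (Real.sqrt_nonneg _)]
        exact mul_le_of_le_one_right (Real.sqrt_nonneg _) (hb _ (hW x))
      · rw [ContinuousWithinAt, e0] at hn; exact hn
  have kr := key Complex.re Complex.continuous_re fun w hw => by
    rw [← hw]; exact Complex.abs_re_le_norm w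
  have ki := key Complex.im Complex.continuous_im fun w hw => by
    rw [← hw]; exact Complex.abs_im_le_norm w
  have : ContinuousWithinAt (fun x => (![zf x 0, zf x 1, √(1 - nsq (zf x)) * (W x).re,
      √(1 - nsq (zf x)) * (W x).im] : Fin 4 → ℝ)) S a := by
    rw [continuousWithinAt_pi]
    intro i; fin_cases i
    · exact hzc 0
    · exact hzc 1
    · exact kr
    · exact ki
  exact (PiLp.continuous_toLp 2 (fun _ : Fin 4 => ℝ)).continuousAt.comp_continuousWithinAt this

lemma graph_cell {n : ℕ} {Z O : Set (E 2)} (h : IsCell n Z O) (hZ : ∀ z ∈ Z, nsq z ≤ 1)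
    (w : E 2 → ℂ) (hw : ∀ z, ‖w z‖ = 1) (hc : ∀ z ∈ Z, nsq z < 1 → ContinuousAt w z) :
    IsCell n ((fun z => Phi z (w z)) '' Z) ((fun z => Phi z (w z)) '' O) := by
  apply h.map
  · intro z hz
    exact Phi_cont continuousWithinAt_id hw (hZ z hz) fun h => (hc z hz h).continuousWithinAt
  · intro z _ z' _ h; exact (Phi_inj h).1

lemma bicone_cell : IsCell 3 {p : E 2 × ℝ | |p.2| ≤ 1 - ‖p.1‖} {p : E 2 × ℝ | |p.2| < 1 - ‖p.1‖} := by
  set K := {p : E 2 × ℝ | |p.2| ≤ 1 - ‖p.1‖} with hKd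
  have hcl : IsClosed K := isClosed_le (by fun_prop) (by fun_prop)
  have hop : IsOpen {p : E 2 × ℝ | |p.2| < 1 - ‖p.1‖} := isOpen_lt (by fun_prop) (by fun_prop)
  have hInt : interior K = {p : E 2 × ℝ | |p.2| < 1 - ‖p.1‖} := by
    apply Subset.antisymm
    · intro p hp
      obtain ⟨ε, he, hb⟩ := Metric.isOpen_iff.1 isOpen_interior p hp
      have hb := hb.trans interior_subset
      have m1 : (p.1, p.2 - ε/2) ∈ ball p ε := by
        rw [mem_ball, Prod.dist_eq]; simp [abs_of_pos he, he]
      have m2 : (p.1, p.2 + ε/2) ∈ ball p ε := by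
        rw [mem_ball, Prod.dist_eq]; simp [abs_of_pos he, he]
      have h1 := (abs_le.1 (show |p.2 - ε/2| ≤ 1 - ‖p.1‖ from hb m1)).1
      have h2 := (abs_le.1 (show |p.2 + ε/2| ≤ 1 - ‖p.1‖ from hb m2)).2
      exact abs_lt.2 (show -(1 - ‖p.1‖) < p.2 ∧ p.2 < 1 - ‖p.1‖ from ⟨by linarith, by linarith⟩)
    · exact interior_maximal (fun p hp => le_of_lt (show |p.2| < 1 - ‖p.1‖ from hp)) hop
  rw [← hInt]
  apply IsCell.of_convex (by simp)
  · intro p hp q hq a b ha hb hab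
    have hp : |p.2| ≤ 1 - ‖p.1‖ := hp
    have hq : |q.2| ≤ 1 - ‖q.1‖ := hq
    change |a * p.2 + b * q.2| ≤ 1 - ‖a • p.1 + b • q.1‖
    have h1 : ‖a • p.1 + b • q.1‖ ≤ a * ‖p.1‖ + b * ‖q.1‖ := by
      refine (norm_add_le _ _).trans ?_
      rw [norm_smul, norm_smul, Real.norm_of_nonneg ha, Real.norm_of_nonneg hb]
    have h2 : |a * p.2 + b * q.2| ≤ a * |p.2| + b * |q.2| := by
      refine (abs_add_le _ _).trans ?_
      rw [abs_mul, abs_mul, abs_of_nonneg ha, abs_of_nonneg hb]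
    nlinarith [mul_le_mul_of_nonneg_left hp ha, mul_le_mul_of_nonneg_left hq hb]
  · apply Metric.isCompact_of_isClosed_isBounded hcl
    apply (isBounded_closedBall (x := (0 : E 2 × ℝ)) (r := 1)).subset
    intro p hp
    have hp : |p.2| ≤ 1 - ‖p.1‖ := hp
    rw [mem_closedBall, dist_zero_right, Prod.norm_def]
    have := norm_nonneg p.1
    have := abs_nonneg p.2
    refine max_le (by linarith) (by rw [Real.norm_eq_abs]; linarith)
  · rw [hInt]; exact ⟨(0, 0), by simp⟩

lemma lens_cell {Z O : Set (E 2)} (h : IsCell 2 Z O) (hZ : ∀ z ∈ Z, nsq z ≤ 1)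
    (hO : ∀ z ∈ O, nsq z < 1) {f g : E 2 → ℝ}
    (hf : ∀ z ∈ Z, nsq z < 1 → ContinuousAt f z) (hg : ∀ z ∈ Z, nsq z < 1 → ContinuousAt g z)
    (hfg : ∀ z ∈ O, f z < g z) (hfe : ∀ z ∈ Z, z ∉ O → nsq z < 1 → f z = g z)
    (hf0 : ∀ z ∈ Z, nsq z < 1 → 0 ≤ f z) (hg1 : ∀ z ∈ Z, nsq z < 1 → g z ≤ 1)
    {γ : ℝ → ℂ} (hγ : Continuous γ) (hγ1 : ∀ t, ‖γ t‖ = 1) (hγi : InjOn γ (Icc 0 1)) :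
    IsCell 3 {x | ∃ z ∈ Z, ∃ s ∈ Icc (0:ℝ) 1, Phi z (γ (f z + s * (g z - f z))) = x}
      {x | ∃ z ∈ O, ∃ s ∈ Ioo (0:ℝ) 1, Phi z (γ (f z + s * (g z - f z))) = x} := by
  have hOZ := h.sub
  obtain ⟨F, F1, F2, rfl, rfl⟩ := h
  let r : E 2 × ℝ → ℝ := fun p => (1 + p.2 / (1 - ‖p.1‖)) / 2
  let W : E 2 × ℝ → ℂ := fun p => γ (f (F p.1) + r p * (g (F p.1) - f (F p.1)))
  set K := {p : E 2 × ℝ | |p.2| ≤ 1 - ‖p.1‖} with hKd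
  have hr : ∀ p ∈ K, 0 ≤ r p ∧ r p ≤ 1 := by
    intro p hp
    have hp : |p.2| ≤ 1 - ‖p.1‖ := hp
    have h0 : 0 ≤ 1 - ‖p.1‖ := (abs_nonneg _).trans hp
    have : |p.2 / (1 - ‖p.1‖)| ≤ 1 := by
      rw [abs_div, abs_of_nonneg h0]; exact div_le_one_of_le₀ hp h0
    have := abs_le.1 this
    constructor <;> simp only [r] <;> linarith
  have hB : ∀ p ∈ K, p.1 ∈ closedBall (0 : E 2) 1 := by
    intro p hp
    have hp : |p.2| ≤ 1 - ‖p.1‖ := hp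
    have := (abs_nonneg _).trans hp
    simpa using this
  have hbd : ∀ y : E 2, ‖y‖ = 1 → F y ∉ F '' ball 0 1 := by
    rintro y hy ⟨y', hy', he⟩
    rw [F2 (ball_subset_closedBall hy') (by simp [hy]) he] at hy'
    simp [hy] at hy'
  have hFz : ContinuousOn (fun p : E 2 × ℝ => F p.1) K := F1.comp continuous_fst.continuousOn hB
  have hcont : ContinuousOn (fun p => Phi (F p.1) (W p)) K := by
    intro p hp
    apply Phi_cont (hFz p hp) (fun _ => hγ1 _) (hZ _ ⟨_, hB p hp, rfl⟩)
    intro hlt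
    have hmem : F p.1 ∈ F '' closedBall 0 1 := ⟨_, hB p hp, rfl⟩
    have cf : ContinuousWithinAt (fun p : E 2 × ℝ => f (F p.1)) K p :=
      ContinuousAt.comp_continuousWithinAt (f := fun p : E 2 × ℝ => F p.1) (hf _ hmem hlt) (hFz p hp)
    have cg : ContinuousWithinAt (fun p : E 2 × ℝ => g (F p.1)) K p :=
      ContinuousAt.comp_continuousWithinAt (f := fun p : E 2 × ℝ => F p.1) (hg _ hmem hlt) (hFz p hp)
    refine hγ.continuousAt.comp_continuousWithinAt (cf.add ?_)
    have hp1 : ‖p.1‖ ≤ 1 := by simpa using hB p hp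
    rcases hp1.lt_or_eq with h1 | h1
    · refine ContinuousWithinAt.mul ?_ (cg.sub cf)
      have hne : 1 - ‖p.1‖ ≠ 0 := by linarith
      have : ContinuousWithinAt (fun p : E 2 × ℝ => p.2 / (1 - ‖p.1‖)) K p :=
        ContinuousWithinAt.div (by fun_prop) (by fun_prop) hne
      exact (continuousWithinAt_const.add this).div_const 2
    · have e := hfe _ hmem (hbd _ h1) hlt
      have cgf := cg.sub cf
      have e0 : g (F p.1) - f (F p.1) = 0 := by rw [e, sub_self]
      have e0' : r p * (g (F p.1) - f (F p.1)) = 0 := by rw [e0, mul_zero]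
      rw [ContinuousWithinAt, e0']
      apply squeeze_zero_norm' (a := fun q : E 2 × ℝ => ‖g (F q.1) - f (F q.1)‖)
      · filter_upwards [self_mem_nhdsWithin] with q hq
        rw [norm_mul]
        apply mul_le_of_le_one_left (norm_nonneg _)
        rw [Real.norm_of_nonneg (hr q hq).1]; exact (hr q hq).2
      · have := cgf.norm
        rw [ContinuousWithinAt] at this
        simpa [e0] using this
  have hθ : ∀ z ∈ F '' closedBall 0 1, nsq z < 1 → ∀ s, 0 ≤ s → s ≤ 1 →
      f z + s * (g z - f z) ∈ Icc (0:ℝ) 1 := by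
    intro z hz hn s h0 h1
    have hle : f z ≤ g z := by
      by_cases hzO : z ∈ F '' ball 0 1
      · exact (hfg z hzO).le
      · exact (hfe z hz hzO hn).le
    have a := hf0 z hz hn
    have b := hg1 z hz hn
    constructor <;> nlinarith
  have hinj : InjOn (fun p => Phi (F p.1) (W p)) K := by
    intro p hp q hq hpq
    obtain ⟨e1, e2⟩ := Phi_inj hpq
    have e := F2 (hB p hp) (hB q hq) e1
    have hp1 : ‖p.1‖ ≤ 1 := by simpa using hB p hp
    rcases hp1.lt_or_eq with h1 | h1
    · have hO' : F p.1 ∈ F '' ball 0 1 := ⟨_, by simpa using h1, rfl⟩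
      have hn := hO _ hO'
      have e3 := hγi (hθ _ (hOZ hO') hn _ (hr p hp).1 (hr p hp).2)
        (hθ _ (by rw [← e]; exact hOZ hO') (by rw [← e]; exact hn) _ (hr q hq).1 (hr q hq).2) (e2 hn)
      rw [← e] at e3
      have hlt := hfg _ hO'
      have e4 : r p = r q := by
        have : (r p - r q) * (g (F p.1) - f (F p.1)) = 0 := by linarith
        rcases mul_eq_zero.1 this with h | h <;> linarith
      simp only [r, ← e] at e4
      have hne : 1 - ‖p.1‖ ≠ 0 := by linarith
      have e5 : p.2 / (1 - ‖p.1‖) = q.2 / (1 - ‖p.1‖) := by linarith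
      rw [div_left_inj' hne] at e5
      exact Prod.ext e e5
    · have hp : |p.2| ≤ 1 - ‖p.1‖ := hp
      have hq : |q.2| ≤ 1 - ‖q.1‖ := hq
      have a : p.2 = 0 := abs_eq_zero.1 (le_antisymm (by linarith) (abs_nonneg _))
      have b : q.2 = 0 := abs_eq_zero.1 (le_antisymm (by rw [← e] at hq; linarith) (abs_nonneg _))
      exact Prod.ext e (a.trans b.symm)
  convert bicone_cell.map hcont hinj using 1
  · ext x; constructor
    · rintro ⟨_, ⟨y, hy, rfl⟩, s, ⟨hs0, hs1⟩, rfl⟩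
      have hy1 : ‖y‖ ≤ 1 := by simpa using hy
      refine ⟨(y, (1 - ‖y‖) * (2 * s - 1)), ?_, ?_⟩
      · change |(1 - ‖y‖) * (2 * s - 1)| ≤ 1 - ‖y‖
        rw [abs_mul, abs_of_nonneg (by linarith : 0 ≤ 1 - ‖y‖)]
        exact mul_le_of_le_one_right (by linarith) (abs_le.2 ⟨by linarith, by linarith⟩)
      · rcases hy1.lt_or_eq with h1 | h1
        · have hne : 1 - ‖y‖ ≠ 0 := by linarith
          simp only [W, r]
          rw [mul_div_cancel_left₀ _ hne]; congr 2; ring_nf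
        · by_cases hn : nsq (F y) < 1
          · have := hfe _ ⟨y, hy, rfl⟩ (hbd _ h1) hn
            simp only [W, this, sub_self, mul_zero]
          · exact Phi_circle (not_lt.1 hn)
    · rintro ⟨p, hp, rfl⟩
      exact ⟨_, ⟨_, hB p hp, rfl⟩, r p, hr p hp, rfl⟩
  · ext x; constructor
    · rintro ⟨_, ⟨y, hy, rfl⟩, s, ⟨hs0, hs1⟩, rfl⟩
      have hy1 : ‖y‖ < 1 := by simpa using hy
      refine ⟨(y, (1 - ‖y‖) * (2 * s - 1)), ?_, ?_⟩
      · change |(1 - ‖y‖) * (2 * s - 1)| < 1 - ‖y‖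
        rw [abs_mul, abs_of_nonneg (by linarith : 0 ≤ 1 - ‖y‖)]
        exact mul_lt_of_lt_one_right (by linarith) (abs_lt.2 ⟨by linarith, by linarith⟩)
      · have hne : 1 - ‖y‖ ≠ 0 := by linarith
        simp only [W, r]
        rw [mul_div_cancel_left₀ _ hne]; congr 2; ring_nf
    · rintro ⟨p, hp, rfl⟩
      have hp : |p.2| < 1 - ‖p.1‖ := hp
      have h0 : 0 < 1 - ‖p.1‖ := (abs_nonneg _).trans_lt hp
      refine ⟨_, ⟨p.1, by simpa using h0, rfl⟩, r p, ?_, rfl⟩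
      have : |p.2 / (1 - ‖p.1‖)| < 1 := by
        rw [abs_div, abs_of_nonneg h0.le, div_lt_one h0]; exact hp
      have := abs_lt.1 this
      constructor <;> simp only [r] <;> linarith

end FatS
end

section
open Metric Set Topology
namespace FatS

def cA (z : E 2) : ℝ := (1 + z 0) / 2
def cB (z : E 2) : ℝ := z 1 / 2
def cC (z : E 2) : ℝ := (1 - z 0) / 2
def ell (s t : ℝ) (z : E 2) : ℝ := (t - s) * (cC z - (s + t) * cB z + s * t * cA z)
/-- the circle point with homogeneous parameter `a : b` -/
def cp (a b : ℝ) : E 2 := !₂[(b ^ 2 - a ^ 2) / (a ^ 2 + b ^ 2), 2 * a * b / (a ^ 2 + b ^ 2)]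

lemma cAC (z : E 2) : cA z + cC z = 1 := by unfold cA cC; ring
lemma cdet (z : E 2) : cA z * cC z - cB z ^ 2 = (1 - nsq z) / 4 := by unfold cA cC cB nsq; ring

lemma ell_swap (s t : ℝ) (z : E 2) : ell t s z = - ell s t z := by unfold ell; ring

@[fun_prop] lemma ell_cont (s t : ℝ) : Continuous (ell s t) := by
  unfold ell cA cB cC; fun_prop

lemma cA_nonneg {z : E 2} (h : nsq z ≤ 1) : 0 ≤ cA z := by
  unfold nsq at h; unfold cA; nlinarith [sq_nonneg (z 1)]
lemma cC_nonneg {z : E 2} (h : nsq z ≤ 1) : 0 ≤ cC z := by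
  unfold nsq at h; unfold cC; nlinarith [sq_nonneg (z 1)]

lemma cA_pos {s t : ℝ} {z : E 2} (h : nsq z ≤ 1)
    (hq : cC z - (s + t) * cB z + s * t * cA z ≤ 0) : 0 < cA z := by
  rcases (cA_nonneg h).eq_or_lt with h0 | h0
  · have h1 := cdet z
    rw [← h0] at h1
    have hB : cB z = 0 := by nlinarith [sq_nonneg (cB z)]
    have := cAC z
    rw [← h0, hB] at hq
    linarith
  · exact h0

lemma quad_id (s t : ℝ) (z : E 2) : cA z * (cC z - (s + t) * cB z + s * t * cA z) =
    (1 - nsq z) / 4 + (cB z - s * cA z) * (cB z - t * cA z) := by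
  rw [← cdet]; ring

lemma quad_le {s t : ℝ} {z : E 2} (h : nsq z ≤ 1) (hst : s ≤ t)
    (hq : cC z - (s + t) * cB z + s * t * cA z ≤ 0) :
    0 < cA z ∧ s * cA z ≤ cB z ∧ cB z ≤ t * cA z ∧
      (1 - nsq z) / 4 ≤ (cB z - s * cA z) * (t * cA z - cB z) := by
  have hA := cA_pos h hq
  have h1 := quad_id s t z
  have h2 : cA z * (cC z - (s + t) * cB z + s * t * cA z) ≤ 0 := by nlinarith
  have h3 : s * cA z ≤ t * cA z := by nlinarith
  refine ⟨hA, ?_, ?_, by nlinarith⟩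
  · by_contra hc; push Not at hc; nlinarith
  · by_contra hc; push Not at hc; nlinarith

/-- disjoint caps, linear position -/
lemma quad_disj {s t u v : ℝ} {z : E 2} (h : nsq z ≤ 1) (hst : s < t)
    (hq : cC z - (s + t) * cB z + s * t * cA z ≤ 0)
    (ho : (t ≤ u ∧ u < v) ∨ (u < v ∧ v ≤ s)) :
    0 ≤ cC z - (u + v) * cB z + u * v * cA z ∧
    ((nsq z < 1 ∨ (t < u ∨ v < s)) → 0 < cC z - (u + v) * cB z + u * v * cA z) := by
  obtain ⟨hA, h1, h2, h3⟩ := quad_le h hst.le hq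
  have hid := quad_id u v z
  have hp : 0 ≤ (cB z - u * cA z) * (cB z - v * cA z) ∧ ((t < u ∨ v < s) →
      0 < (cB z - u * cA z) * (cB z - v * cA z)) := by
    rcases ho with ⟨a, b⟩ | ⟨a, b⟩
    · have e1 : t * cA z ≤ u * cA z := by nlinarith
      have e2 : u * cA z < v * cA z := by nlinarith
      refine ⟨by nlinarith, ?_⟩
      rintro (e | e)
      · have e1 : t * cA z < u * cA z := by nlinarith
        nlinarith
      · linarith
    · have e1 : v * cA z ≤ s * cA z := by nlinarith
      have e2 : u * cA z < v * cA z := by nlinarith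
      refine ⟨by nlinarith, ?_⟩
      rintro (e | e)
      · linarith
      · have e1 : v * cA z < s * cA z := by nlinarith
        nlinarith
  constructor
  · by_contra hc; push Not at hc; nlinarith [hp.1]
  · intro hs
    by_contra hc; push Not at hc
    have : cA z * (cC z - (u + v) * cB z + u * v * cA z) ≤ 0 := by nlinarith
    rcases hs with hs | hs
    · linarith [hp.1]
    · linarith [hp.2 hs]

/-- nested caps, linear position -/
lemma quad_nest {s t u v : ℝ} {z : E 2} (h : nsq z ≤ 1) (hst : s < t)
    (hq : cC z - (s + t) * cB z + s * t * cA z ≤ 0) (hu : u ≤ s) (hv : t ≤ v) :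
    cC z - (u + v) * cB z + u * v * cA z ≤ 0 ∧
    ((nsq z < 1 ∧ (u < s ∨ t < v)) ∨ (u < s ∧ t < v) → cC z - (u + v) * cB z + u * v * cA z < 0) := by
  obtain ⟨hA, h1, h2, h3⟩ := quad_le h hst.le hq
  have hid := quad_id u v z
  have hid' := quad_id s t z
  have e1 : u * cA z ≤ s * cA z := by nlinarith
  have e2 : t * cA z ≤ v * cA z := by nlinarith
  have h5 : (cB z - s * cA z) * (t * cA z - cB z) ≤ (cB z - u * cA z) * (v * cA z - cB z) :=
    mul_le_mul (by linarith) (by linarith) (by linarith) (by linarith)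
  constructor
  · by_contra hc; push Not at hc
    have := mul_pos hA hc
    linarith
  · intro hs
    by_contra hc; push Not at hc
    have h6 := mul_nonneg hA.le hc
    have hlt : (cB z - s * cA z) * (t * cA z - cB z) < (cB z - u * cA z) * (v * cA z - cB z) := by
      rcases hs with ⟨hn, hs⟩ | ⟨a, b⟩
      · have hp : 0 < (cB z - s * cA z) * (t * cA z - cB z) := by linarith
        have p1 : 0 < cB z - s * cA z := by
          rcases (show 0 ≤ cB z - s * cA z by linarith).eq_or_lt with e | e
          · rw [← e] at hp; linarith
          · exact e
        have p2 : 0 < t * cA z - cB z := by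
          rcases (show 0 ≤ t * cA z - cB z by linarith).eq_or_lt with e | e
          · rw [← e] at hp; linarith
          · exact e
        rcases hs with a | b
        · have : u * cA z < s * cA z := by nlinarith
          exact mul_lt_mul (by linarith) (by linarith) p2 (by linarith)
        · have : t * cA z < v * cA z := by nlinarith
          exact mul_lt_mul' (by linarith) (by linarith) p2.le (by linarith)
      · have : u * cA z < s * cA z := by nlinarith
        have : t * cA z < v * cA z := by nlinarith
        exact mul_lt_mul'' (by linarith) (by linarith) (by linarith) (by linarith)
    linarith

/-- (weak) cyclic order of four reals -/
def cyc4 (a b c d : ℝ) : Prop :=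
  (a < b ∧ b < c ∧ c < d) ∨ (b < c ∧ c < d ∧ d < a) ∨ (c < d ∧ d < a ∧ a < b) ∨
    (d < a ∧ a < b ∧ b < c)
def cyc4w (a b c d : ℝ) : Prop :=
  (a < b ∧ b ≤ c ∧ c < d) ∨ (b ≤ c ∧ c < d ∧ d ≤ a) ∨ (c < d ∧ d ≤ a ∧ a < b) ∨
    (d ≤ a ∧ a < b ∧ b ≤ c)

lemma cyc4.weak {a b c d : ℝ} (h : cyc4 a b c d) : cyc4w a b c d := by
  unfold cyc4 at h; unfold cyc4w
  rcases h with h | h | h | h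
  · exact .inl ⟨h.1, h.2.1.le, h.2.2⟩
  · exact .inr (.inl ⟨h.1.le, h.2.1, h.2.2.le⟩)
  · exact .inr (.inr (.inl ⟨h.1, h.2.1.le, h.2.2⟩))
  · exact .inr (.inr (.inr ⟨h.1.le, h.2.1, h.2.2.le⟩))

lemma quad_comm (s t : ℝ) (z : E 2) : cC z - (s + t) * cB z + s * t * cA z =
    cC z - (t + s) * cB z + t * s * cA z := by ring

lemma cyc4w_pos {a b c d : ℝ} {z : E 2} (hz : nsq z ≤ 1) (h : cyc4w a b c d)
    (he : ell a b z ≤ 0) (hs : nsq z < 1 ∧ ¬ (b = c ∧ a = d) ∨ cyc4 a b c d) : 0 < ell c d z := by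
  unfold ell at *
  rcases h with h | h | h | h
  · have hq : cC z - (a + b) * cB z + a * b * cA z ≤ 0 := by
      by_contra hc; push Not at hc
      have : 0 < b - a := by linarith
      nlinarith
    apply mul_pos (by linarith)
    apply (quad_disj hz h.1 hq (.inl h.2)).2
    rcases hs with hs | hs
    · exact .inl hs.1
    · unfold cyc4 at hs
      right; left
      rcases hs with hs | hs | hs | hs <;> linarith
  · have hab : b < a := by linarith
    apply mul_pos (by linarith)
    by_contra hc; push Not at hc
    have := (quad_nest hz h.2.1 hc h.1 h.2.2).2 (by
      rcases hs with hs | hs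
      · left
        refine ⟨hs.1, ?_⟩
        by_contra hcon; push Not at hcon
        exact hs.2 ⟨by linarith, by linarith⟩
      · right
        unfold cyc4 at hs
        rcases hs with hs | hs | hs | hs
        · linarith
        · exact ⟨hs.1, hs.2.2⟩
        · linarith
        · linarith)
    rw [quad_comm] at this
    have : 0 < (b - a) * (cC z - (a + b) * cB z + a * b * cA z) := mul_pos_of_neg_of_neg (by linarith) this
    linarith
  · have hq : cC z - (a + b) * cB z + a * b * cA z ≤ 0 := by
      by_contra hc; push Not at hc
      have : 0 < b - a := by linarith
      nlinarith
    apply mul_pos (by linarith)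
    apply (quad_disj hz h.2.2 hq (.inr ⟨h.1, h.2.1⟩)).2
    rcases hs with hs | hs
    · exact .inl hs.1
    · unfold cyc4 at hs
      right; right
      rcases hs with hs | hs | hs | hs <;> linarith
  · have hq : cC z - (a + b) * cB z + a * b * cA z ≤ 0 := by
      by_contra hc; push Not at hc
      have : 0 < b - a := by linarith
      nlinarith
    have := (quad_nest hz h.2.1 hq h.1 h.2.2).2 (by
      rcases hs with hs | hs
      · left
        refine ⟨hs.1, ?_⟩
        by_contra hcon; push Not at hcon
        exact hs.2 ⟨by linarith, by linarith⟩
      · right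
        unfold cyc4 at hs
        rcases hs with hs | hs | hs | hs
        · linarith
        · linarith
        · linarith
        · exact ⟨hs.1, hs.2.2⟩)
    rw [quad_comm] at this
    exact mul_pos_of_neg_of_neg (by linarith) this

lemma cyc4w_nonneg {a b c d : ℝ} {z : E 2} (hz : nsq z ≤ 1) (h : cyc4w a b c d)
    (he : ell a b z ≤ 0) : 0 ≤ ell c d z := by
  unfold ell at *
  rcases h with h | h | h | h
  · have hq : cC z - (a + b) * cB z + a * b * cA z ≤ 0 := by
      by_contra hc; push Not at hc
      have : 0 < b - a := by linarith
      nlinarith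
    apply mul_nonneg (by linarith)
    exact (quad_disj hz h.1 hq (.inl h.2)).1
  · have hab : b < a := by linarith
    apply mul_nonneg (by linarith)
    by_contra hc; push Not at hc
    have hA := cA_pos hz hc.le
    have := (quad_nest hz h.2.1 hc.le h.1 h.2.2).1
    rw [quad_comm] at this
    obtain ⟨-, h1, h2, h3⟩ := quad_le hz h.2.1.le hc.le
    have i1 := quad_id c d z
    have i2 := quad_id a b z
    have m1 : cA z * (cC z - (c + d) * cB z + c * d * cA z) < 0 := mul_neg_of_pos_of_neg hA hc
    have m2 : 0 ≤ cA z * (cC z - (a + b) * cB z + a * b * cA z) := by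
      apply mul_nonneg hA.le
      by_contra hh; push Not at hh
      have := mul_pos_of_neg_of_neg (show b - a < 0 by linarith) hh
      linarith
    have e1 : b * cA z ≤ c * cA z := by nlinarith
    have e2 : d * cA z ≤ a * cA z := by nlinarith
    have h5 : (cB z - c * cA z) * (d * cA z - cB z) ≤ (cB z - b * cA z) * (a * cA z - cB z) :=
      mul_le_mul (by linarith) (by linarith) (by linarith) (by linarith)
    linarith
  · have hq : cC z - (a + b) * cB z + a * b * cA z ≤ 0 := by
      by_contra hc; push Not at hc
      have : 0 < b - a := by linarith
      nlinarith
    apply mul_nonneg (by linarith)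
    exact (quad_disj hz h.2.2 hq (.inr ⟨h.1, h.2.1⟩)).1
  · have hq : cC z - (a + b) * cB z + a * b * cA z ≤ 0 := by
      by_contra hc; push Not at hc
      have : 0 < b - a := by linarith
      nlinarith
    have := (quad_nest hz h.2.1 hq h.1 h.2.2).1
    rw [quad_comm] at this
    exact mul_nonneg_of_nonpos_of_nonpos (by linarith) this

/-! circle points -/
lemma cp_nsq {a b : ℝ} (h : 0 < a ^ 2 + b ^ 2) : nsq (cp a b) = 1 := by
  simp [nsq, cp]; field_simp; ring
lemma cp_A {a b : ℝ} (h : 0 < a ^ 2 + b ^ 2) : cA (cp a b) = b ^ 2 / (a ^ 2 + b ^ 2) := by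
  simp [cA, cp]; field_simp; ring
lemma cp_B (a b : ℝ) : cB (cp a b) = a * b / (a ^ 2 + b ^ 2) := by
  simp [cB, cp]; ring
lemma cp_C {a b : ℝ} (h : 0 < a ^ 2 + b ^ 2) : cC (cp a b) = a ^ 2 / (a ^ 2 + b ^ 2) := by
  simp [cC, cp]; field_simp; ring
lemma ell_cp {a b : ℝ} (h : 0 < a ^ 2 + b ^ 2) (s t : ℝ) :
    ell s t (cp a b) = (t - s) * (a - s * b) * (a - t * b) / (a ^ 2 + b ^ 2) := by
  rw [ell, cp_A h, cp_B, cp_C h]; field_simp; ring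

abbrev pt (τ : ℝ) : E 2 := cp τ 1
lemma pt_pos (τ : ℝ) : 0 < τ ^ 2 + (1:ℝ) ^ 2 := by positivity
lemma pt_inj {s t : ℝ} (h : pt s = pt t) : s = t := by
  have h1 := cp_A (pt_pos s); have h2 := cp_A (pt_pos t)
  have h3 := cp_B s 1; have h4 := cp_B t 1
  have : pt s = cp s 1 := rfl
  rw [← this, h] at h1 h3
  rw [h1] at h2; rw [h3] at h4
  have p := pt_pos s; have q := pt_pos t
  have : s ^ 2 + (1:ℝ) ^ 2 = t ^ 2 + 1 ^ 2 := by
    field_simp at h2; linarith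
  rw [this] at h4; field_simp at h4; linarith
lemma ell_pt (s t τ : ℝ) : ell s t (pt τ) = (t - s) * (τ - s) * (τ - t) / (τ ^ 2 + 1) := by
  rw [ell_cp (pt_pos τ)]; norm_num

lemma z_ext {z z' : E 2} (hA : cA z = cA z') (hB : cB z = cB z') : z = z' := by
  unfold cA at hA; unfold cB at hB
  ext i; fin_cases i
  · show z 0 = z' 0; linarith
  · show z 1 = z' 1; linarith

/-- circle point is `pt τ` -/
lemma circle_pt {z : E 2} (hz : nsq z = 1) (hA : 0 < cA z) : z = pt (cB z / cA z) := by
  have hd := cdet z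
  rw [hz] at hd
  have hs := cAC z
  have hp := pt_pos (cB z / cA z)
  have hC : cC z = cB z ^ 2 / cA z := by field_simp; linarith
  apply z_ext
  · rw [cp_A hp]; field_simp; rw [hC] at hs; field_simp at hs; linarith
  · rw [cp_B]; field_simp; rw [hC] at hs; field_simp at hs; rw [add_comm, hs]
lemma circle_pt' {z : E 2} (hz : nsq z = 1) (hC : 0 < cC z) : z = cp 1 (cB z / cC z) := by
  have hd := cdet z
  rw [hz] at hd
  have hs := cAC z
  have hp : 0 < (1:ℝ) ^ 2 + (cB z / cC z) ^ 2 := by positivity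
  have hA : cA z = cB z ^ 2 / cC z := by field_simp; linarith
  apply z_ext
  · rw [cp_A hp]; field_simp; rw [hA] at hs ⊢; field_simp at hs ⊢; rw [add_comm] at hs; rw [hs]
  · rw [cp_B]; field_simp; rw [hA] at hs; field_simp at hs; rw [add_comm] at hs; rw [hs]

lemma ell_zero_circle {s t : ℝ} (hst : s ≠ t) {z : E 2} (hz : nsq z = 1) (h : ell s t z = 0) :
    z = pt s ∨ z = pt t := by
  have hq : cC z - (s + t) * cB z + s * t * cA z = 0 := by
    rcases mul_eq_zero.1 h with h | h
    · exact absurd (by linarith) hst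
    · exact h
  have hA := cA_pos hz.le hq.le
  have e := circle_pt hz hA
  have hid := quad_id s t z
  rw [hq, hz] at hid
  have : (cB z - s * cA z) * (cB z - t * cA z) = 0 := by linarith
  rcases mul_eq_zero.1 this with h | h
  · left; rw [e]; congr 1; field_simp; linarith
  · right; rw [e]; congr 1; field_simp; linarith

/-! chords -/
lemma ell_affine (s t : ℝ) (x y : E 2) {a b : ℝ} (h : a + b = 1) :
    ell s t (a • x + b • y) = a * ell s t x + b * ell s t y := by
  have ha : a = 1 - b := by linarith
  subst ha
  simp [ell, cA, cB, cC]; ring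

lemma chord_cell {s t : ℝ} (hst : s ≠ t) :
    IsCell 1 {z | nsq z ≤ 1 ∧ ell s t z = 0} {z | nsq z < 1 ∧ ell s t z = 0} := by
  have h0 := IsCell.of_Icc (zero_lt_one (α := ℝ))
  let g : ℝ → E 2 := fun x => (1 - x) • pt s + x • pt t
  have hts : t - s ≠ 0 := sub_ne_zero.2 hst.symm
  have hgA : ∀ x, cA (g x) = (1 - x) * cA (pt s) + x * cA (pt t) := by
    intro x; simp [g, cA]; ring
  have hgB : ∀ x, cB (g x) = (1 - x) * cB (pt s) + x * cB (pt t) := by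
    intro x; simp [g, cB]; ring
  have hn : ∀ x, 1 - nsq (g x) = 4 * x * (1 - x) * ((t - s) ^ 2 / ((s^2+1) * (t^2+1))) := by
    intro x
    have h1 := cdet (g x)
    have h2 : cC (g x) = 1 - cA (g x) := by linarith [cAC (g x)]
    rw [h2, hgA, hgB, cp_A (pt_pos _), cp_A (pt_pos _), cp_B, cp_B] at h1
    have : 1 - nsq (g x) = 4 * ((1 - nsq (g x)) / 4) := by ring
    rw [this, ← h1]; field_simp; ring
  have hell : ∀ x, ell s t (g x) = 0 := by
    intro x
    rw [ell_affine s t _ _ (by ring : (1 - x) + x = 1), ell_pt, ell_pt]; simp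
  have hpos : 0 < (t - s) ^ 2 / ((s^2+1) * (t^2+1)) := by positivity
  have hsurj : ∀ z, ell s t z = 0 → ∃ x, g x = z := by
    intro z hz
    refine ⟨(cB z - s * cA z) / (t - s) * (t ^ 2 + 1), ?_⟩
    have hq : cC z - (s + t) * cB z + s * t * cA z = 0 := by
      rcases mul_eq_zero.1 hz with h | h
      · exact absurd h hts
      · exact h
    have hC : cC z = 1 - cA z := by linarith [cAC z]
    rw [hC] at hq
    apply z_ext
    · rw [hgA, cp_A (pt_pos _), cp_A (pt_pos _)]; field_simp
      linear_combination (t - s) * hq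
    · rw [hgB, cp_B, cp_B]; field_simp
      linear_combination (s * (t - s)) * hq
  convert h0.map (g := g) ?_ ?_ using 1
  · ext z; constructor
    · rintro ⟨h1, h2⟩
      obtain ⟨x, rfl⟩ := hsurj z h2
      have := hn x
      refine ⟨x, ?_, rfl⟩
      have h3 : 0 ≤ x * (1 - x) := by
        by_contra hc; push Not at hc
        have := mul_neg_of_neg_of_pos hc hpos
        nlinarith
      constructor <;> nlinarith
    · rintro ⟨x, ⟨hx0, hx1⟩, rfl⟩
      refine ⟨?_, hell x⟩
      have : 0 ≤ 4 * x * (1 - x) * ((t - s) ^ 2 / ((s^2+1) * (t^2+1))) :=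
        mul_nonneg (mul_nonneg (by linarith) (by linarith)) hpos.le
      linarith [hn x]
  · ext z; constructor
    · rintro ⟨h1, h2⟩
      obtain ⟨x, rfl⟩ := hsurj z h2
      have := hn x
      refine ⟨x, ?_, rfl⟩
      have h3 : 0 < x * (1 - x) := by
        by_contra hc; push Not at hc
        have := mul_nonpos_of_nonpos_of_nonneg hc hpos.le
        nlinarith
      constructor <;> nlinarith
    · rintro ⟨x, ⟨hx0, hx1⟩, rfl⟩
      refine ⟨?_, hell x⟩
      have : 0 < 4 * x * (1 - x) * ((t - s) ^ 2 / ((s^2+1) * (t^2+1))) :=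
        mul_pos (mul_pos (by linarith) (by linarith)) hpos
      linarith [hn x]
  · exact Continuous.continuousOn (by fun_prop)
  · intro x _ y _ hxy
    have : (x - y) • (pt t - pt s) = 0 := by
      have : (1 - x) • pt s + x • pt t = (1 - y) • pt s + y • pt t := hxy
      have h : (x - y) • (pt t - pt s) = ((1 - x) • pt s + x • pt t) - ((1 - y) • pt s + y • pt t) := by
        module
      rw [h, this, sub_self]
    rcases smul_eq_zero.1 this with h | h
    · linarith
    · exact absurd (pt_inj (sub_eq_zero.1 h)).symm hst

/-! regions -/
def Rg (S : Set (ℝ × ℝ)) : Set (E 2) := {z | nsq z ≤ 1 ∧ ∀ p ∈ S, 0 ≤ ell p.1 p.2 z}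
def Rgo (S : Set (ℝ × ℝ)) : Set (E 2) := {z | nsq z < 1 ∧ ∀ p ∈ S, 0 < ell p.1 p.2 z}

lemma nsq_conv (x y : E 2) {a b : ℝ} (ha : 0 ≤ a) (hb : 0 ≤ b) (h : a + b = 1) :
    nsq (a • x + b • y) = a * nsq x + b * nsq y - a * b * ((x 0 - y 0)^2 + (x 1 - y 1)^2) := by
  have ha : a = 1 - b := by linarith
  subst ha
  simp [nsq]; ring

lemma nsq_conv_le (x y : E 2) {a b : ℝ} (ha : 0 ≤ a) (hb : 0 ≤ b) (h : a + b = 1) :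
    nsq (a • x + b • y) ≤ a * nsq x + b * nsq y := by
  rw [nsq_conv x y ha hb h]
  have : 0 ≤ a * b * ((x 0 - y 0)^2 + (x 1 - y 1)^2) := by positivity
  linarith

lemma rg_cell {S : Set (ℝ × ℝ)} (hS : S.Finite) (hne : ∀ p ∈ S, p.1 ≠ p.2) {p₁ p₂ p₃ : E 2}
    (h1 : p₁ ∈ Rg S) (h2 : p₂ ∈ Rg S) (h3 : p₃ ∈ Rg S)
    (n1 : nsq p₁ = 1) (n2 : nsq p₂ = 1) (n3 : nsq p₃ = 1)
    (h12 : p₁ ≠ p₂) (h13 : p₁ ≠ p₃) (h23 : p₂ ≠ p₃) :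
    IsCell 2 (Rg S) (Rgo S) := by
  have hcl : IsClosed (Rg S) := by
    have : Rg S = {z | nsq z ≤ 1} ∩ ⋂ p ∈ S, {z | 0 ≤ ell p.1 p.2 z} := by
      ext z; simp [Rg]
    rw [this]
    apply IsClosed.inter (isClosed_le nsq_cont continuous_const)
    exact isClosed_biInter fun p _ => isClosed_le continuous_const (ell_cont _ _)
  have hop : IsOpen (Rgo S) := by
    have : Rgo S = {z | nsq z < 1} ∩ ⋂ p ∈ S, {z | 0 < ell p.1 p.2 z} := by
      ext z; simp [Rgo]
    rw [this]
    apply IsOpen.inter (isOpen_lt nsq_cont continuous_const)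
    exact hS.isOpen_biInter fun p _ => isOpen_lt continuous_const (ell_cont _ _)
  have hconv : Convex ℝ (Rg S) := by
    intro x hx y hy a b ha hb hab
    refine ⟨?_, fun p hp => ?_⟩
    · have := nsq_conv_le x y ha hb hab
      nlinarith [mul_le_mul_of_nonneg_left hx.1 ha, mul_le_mul_of_nonneg_left hy.1 hb]
    · rw [ell_affine _ _ _ _ hab]
      exact add_nonneg (mul_nonneg ha (hx.2 p hp)) (mul_nonneg hb (hy.2 p hp))
  have hsl : ∃ x0, x0 ∈ Rgo S := by
    let m : E 2 := (1/2 : ℝ) • p₁ + (1/2 : ℝ) • p₂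
    have hm : nsq m < 1 := by
      rw [nsq_conv _ _ (by norm_num) (by norm_num) (by norm_num), n1, n2]
      have : 0 < (p₁ 0 - p₂ 0)^2 + (p₁ 1 - p₂ 1)^2 := by
        by_contra hc; push Not at hc
        apply h12
        have a0 : p₁ 0 - p₂ 0 = 0 := by nlinarith [sq_nonneg (p₁ 0 - p₂ 0), sq_nonneg (p₁ 1 - p₂ 1)]
        have a1 : p₁ 1 - p₂ 1 = 0 := by nlinarith [sq_nonneg (p₁ 0 - p₂ 0), sq_nonneg (p₁ 1 - p₂ 1)]
        ext i; fin_cases i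
        · show p₁ 0 = p₂ 0; linarith
        · show p₁ 1 = p₂ 1; linarith
      linarith
    refine ⟨(1/2 : ℝ) • m + (1/2 : ℝ) • p₃, ?_, fun p hp => ?_⟩
    · have := nsq_conv_le m p₃ (a := 1/2) (b := 1/2) (by norm_num) (by norm_num) (by norm_num)
      linarith
    · rw [ell_affine _ _ _ _ (by norm_num), ell_affine _ _ _ _ (by norm_num)]
      have e1 := h1.2 p hp
      have e2 := h2.2 p hp
      have e3 := h3.2 p hp
      by_contra hc; push Not at hc
      have z1 := ell_zero_circle (hne p hp) n1 (by linarith)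
      have z2 := ell_zero_circle (hne p hp) n2 (by linarith)
      have z3 := ell_zero_circle (hne p hp) n3 (by linarith)
      rcases z1 with z1 | z1 <;> rcases z2 with z2 | z2 <;> rcases z3 with z3 | z3 <;>
        simp_all
  have hInt : interior (Rg S) = Rgo S := by
    apply Subset.antisymm
    · intro z hz
      obtain ⟨x0, hx0⟩ := hsl
      obtain ⟨ε, he, hmem⟩ : ∃ ε : ℝ, 0 < ε ∧ z + ε • (z - x0) ∈ Rg S := by
        have hc : Filter.Tendsto (fun ε : ℝ => z + ε • (z - x0)) (𝓝[>] 0) (𝓝 z) := by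
          have : Continuous (fun ε : ℝ => z + ε • (z - x0)) := by fun_prop
          have := this.tendsto 0
          simp only [zero_smul, add_zero] at this
          exact this.mono_left nhdsWithin_le_nhds
        have h1 := hc.eventually (mem_interior_iff_mem_nhds.1 hz)
        obtain ⟨ε, h, h'⟩ := (h1.and self_mem_nhdsWithin).exists
        exact ⟨ε, h', h⟩
      set w := z + ε • (z - x0) with hw
      have hp : 0 < 1 + ε := by linarith
      have hab : (1 / (1 + ε)) + ε / (1 + ε) = 1 := by field_simp
      have hzw : z = (1 / (1 + ε)) • w + (ε / (1 + ε)) • x0 := by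
        have : z = ((1 / (1 + ε)) + ε / (1 + ε)) • z := by rw [hab, one_smul]
        rw [hw]
        have h5 : (1 / (1 + ε)) • (z + ε • (z - x0)) + (ε / (1 + ε)) • x0 =
          ((1 / (1 + ε)) + ε / (1 + ε)) • z := by module
        rw [h5, hab, one_smul]
      have ha : 0 < 1 / (1 + ε) := by positivity
      have hb : 0 < ε / (1 + ε) := by positivity
      refine ⟨?_, fun p hpS => ?_⟩
      · have := nsq_conv_le w x0 ha.le hb.le hab
        rw [← hzw] at this
        nlinarith [mul_le_mul_of_nonneg_left hmem.1 ha.le, mul_lt_mul_of_pos_left hx0.1 hb]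
      · rw [hzw, ell_affine _ _ _ _ hab]
        exact add_pos_of_nonneg_of_pos (mul_nonneg ha.le (hmem.2 p hpS)) (mul_pos hb (hx0.2 p hpS))
    · exact interior_maximal (fun z hz => ⟨hz.1.le, fun p hp => (hz.2 p hp).le⟩) hop
  rw [← hInt]
  apply IsCell.of_convex (by simp) hconv
  · apply Metric.isCompact_of_isClosed_isBounded hcl
    apply (isBounded_closedBall (x := (0 : E 2)) (r := 1)).subset
    intro z hz
    rw [mem_closedBall_zero_iff, EuclideanSpace.norm_eq]
    have : nsq z ≤ 1 := hz.1
    simp only [Fin.sum_univ_two, Real.norm_eq_abs, sq_abs]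
    exact Real.sqrt_le_one.2 this
  · rw [hInt]; exact hsl

end FatS
end

section
open Metric Set Topology
namespace FatS

def pU (K : ℕ) : ℕ := 12 * K ^ 4
def pH (K : ℕ) : ℕ := K ^ 11
def pY (K : ℕ) : ℕ := pH K + pU K
def pT (K : ℕ) : ℕ := pH K + 2 * pU K + 2
def pM (K : ℕ) : ℕ := 2 * K * (pT K + 1)
def pB (K : ℕ) : ℕ := 6 * K ^ 2

variable (K : ℕ)

def hh (i : ℕ) : ℕ := ((i + 1) / 2) % K
def fE (π i : ℕ) : ℤ := ((3 * π * hh K i : ℕ) : ℤ)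
def gO (π i : ℕ) : ℤ := ((pB K * π * (i / 2) : ℕ) : ℤ)
def hgt (π i : ℕ) (y : ℤ) : ℤ := if π % 2 = 0 then 1 + fE K π i + y else 1 + gO K π i + pY K - y
def inP (π l i : ℕ) : Prop := if π % 2 = 0 then i / 2 = l else hh K i = l
def iL (π l : ℕ) : ℕ := if π % 2 = 0 then 2 * l else if l = 0 then 2 * K - 1 else 2 * l - 1
def iR (π l : ℕ) : ℕ := if π % 2 = 0 then 2 * l + 1 else 2 * l
def posn (i : ℕ) (n : ℤ) : ℤ :=
  if i % 2 = 1 then ((i * (pT K + 1) : ℕ) : ℤ) + n - 1 else ((i * (pT K + 1) : ℕ) : ℤ) + pT K - n - 1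
def chS (π l : ℕ) (y : ℤ) : ℤ := posn K (iL K π l) (hgt K π (iL K π l) y)
def chT (π l : ℕ) (y : ℤ) : ℤ := posn K (iR π l) (hgt K π (iR π l) y)
def ee (π l : ℕ) (y : ℤ) (z : E 2) : ℝ := ell (chS K π l y) (chT K π l y) z

section
variable {K}
lemma hh_eq {i : ℕ} (hi : i < 2 * K) : hh K i = if i = 2 * K - 1 then 0 else (i + 1) / 2 := by
  unfold hh
  split_ifs with h
  · have : (i + 1) / 2 = K := by omega
    rw [this, Nat.mod_self]
  · exact Nat.mod_eq_of_lt (by omega)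
lemma hh_lt {i : ℕ} (hi : i < 2 * K) : hh K i < K := by
  rw [hh_eq hi]; split_ifs <;> omega

lemma prod_le {a b c d : ℕ} (h : a ≤ c) (h' : b ≤ d) : a * b ≤ c * d := Nat.mul_le_mul h h'

lemma fE_nonneg (π i : ℕ) : 0 ≤ fE K π i := by unfold fE; positivity
lemma gO_nonneg (π i : ℕ) : 0 ≤ gO K π i := by unfold gO; positivity
lemma pB_mul_le {π l : ℕ} (hπ : π ≤ 2 * K) (hl : l ≤ K) : pB K * π * l ≤ pU K := by
  unfold pB pU
  calc 6 * K ^ 2 * π * l ≤ 6 * K ^ 2 * (2 * K) * K :=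
        Nat.mul_le_mul (Nat.mul_le_mul le_rfl hπ) hl
    _ = 12 * K ^ 4 := by ring
lemma p3_mul_le {π l : ℕ} (hπ : π ≤ 2 * K) (hl : l ≤ K) : 3 * π * l ≤ pU K := by
  unfold pU
  rcases Nat.eq_zero_or_pos K with h | h
  · subst h; simp_all
  calc 3 * π * l ≤ 3 * (2 * K) * K :=
        Nat.mul_le_mul (Nat.mul_le_mul le_rfl hπ) hl
    _ = 6 * K ^ 2 := by ring
    _ ≤ 12 * K ^ 4 := Nat.mul_le_mul (by norm_num) (Nat.pow_le_pow_right h (by norm_num))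
lemma fE_le {π i : ℕ} (hπ : π < 2 * K) (hi : i < 2 * K) : fE K π i ≤ pU K := by
  unfold fE; exact_mod_cast p3_mul_le hπ.le (hh_lt hi).le
lemma gO_le {π i : ℕ} (hπ : π < 2 * K) (hi : i < 2 * K) : gO K π i ≤ pU K := by
  unfold gO; exact_mod_cast pB_mul_le hπ.le (by omega)

lemma hgt_range {π i : ℕ} (hπ : π < 2 * K) (hi : i < 2 * K) {y : ℤ} (h0 : 0 ≤ y) (h1 : y ≤ pY K) :
    1 ≤ hgt K π i y ∧ hgt K π i y + 1 ≤ pT K := by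
  have a1 := fE_nonneg (K := K) π i; have a2 := gO_nonneg (K := K) π i
  have b1 := fE_le hπ hi; have b2 := gO_le hπ hi
  have e1 : (pY K : ℤ) = pH K + pU K := by unfold pY; push_cast; rfl
  have e2 : (pT K : ℤ) = pH K + 2 * pU K + 2 := by unfold pT; push_cast; rfl
  unfold hgt
  split_ifs <;> constructor <;> linarith

lemma iL_lt {π l : ℕ} (hl : l < K) : iL K π l < 2 * K := by unfold iL; split_ifs <;> omega
lemma iR_lt {π l : ℕ} (hl : l < K) : iR π l < 2 * K := by unfold iR; split_ifs <;> omega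
lemma inP_iff {π l i : ℕ} (hl : l < K) (hi : i < 2 * K) : inP K π l i ↔ i = iL K π l ∨ i = iR π l := by
  unfold inP iL iR
  rw [hh_eq hi]
  split_ifs <;> omega

lemma block {i j : ℕ} (h : i < j) : i * (pT K + 1) + (pT K + 1) ≤ j * (pT K + 1) := by
  have := Nat.mul_le_mul_right (pT K + 1) (show i + 1 ≤ j from h)
  linarith [Nat.succ_mul i (pT K + 1)]

lemma posn_lt {i j : ℕ} {n n' : ℤ} (h : i < j) (h0 : 0 ≤ n) (h1 : n ≤ pT K) (h0' : 0 ≤ n')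
    (h1' : n' ≤ pT K) : posn K i n < posn K j n' := by
  have := block (K := K) h
  have : ((i * (pT K + 1) : ℕ) : ℤ) + (pT K + 1) ≤ ((j * (pT K + 1) : ℕ) : ℤ) := by exact_mod_cast this
  unfold posn
  split_ifs <;> linarith

lemma posn_odd {i : ℕ} {n n' : ℤ} (hi : i % 2 = 1) (h : n < n') : posn K i n < posn K i n' := by
  unfold posn; rw [if_pos hi, if_pos hi]; linarith
lemma posn_even {i : ℕ} {n n' : ℤ} (hi : i % 2 = 0) (h : n < n') : posn K i n' < posn K i n := by
  unfold posn; rw [if_neg (by omega), if_neg (by omega)]; linarith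

lemma posn_inj {i j : ℕ} {n n' : ℤ} (h0 : 0 ≤ n) (h1 : n ≤ pT K) (h0' : 0 ≤ n')
    (h1' : n' ≤ pT K) (h : posn K i n = posn K j n') : i = j ∧ n = n' := by
  have hij : i = j := by
    rcases lt_trichotomy i j with hl | hl | hl
    · have := posn_lt hl h0 h1 h0' h1'; omega
    · exact hl
    · have := posn_lt hl h0' h1' h0 h1; omega
  subst hij
  refine ⟨rfl, ?_⟩
  unfold posn at h
  split_ifs at h <;> linarith

lemma posn_range {i : ℕ} {n : ℤ} (hi : i < 2 * K) (h0 : 0 ≤ n) (h1 : n ≤ pT K) :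
    -1 ≤ posn K i n ∧ posn K i n ≤ pM K - 2 := by
  have := block (K := K) hi
  have : ((i * (pT K + 1) : ℕ) : ℤ) + (pT K + 1) ≤ pM K := by unfold pM; exact_mod_cast this
  have : (0 : ℤ) ≤ ((i * (pT K + 1) : ℕ) : ℤ) := by positivity
  unfold posn
  split_ifs <;> constructor <;> linarith

lemma posn_surj {p : ℤ} (h0 : -1 ≤ p) (h1 : p ≤ pM K - 2) :
    ∃ (i : ℕ) (n : ℤ), i < 2 * K ∧ 0 ≤ n ∧ n ≤ pT K ∧ posn K i n = p := by
  obtain ⟨q, hq⟩ := Int.eq_ofNat_of_zero_le (show 0 ≤ p + 1 by linarith)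
  have hp : p = (q : ℤ) - 1 := by linarith
  have hqM : q < 2 * K * (pT K + 1) := by
    have : (q : ℤ) < pM K := by linarith
    unfold pM at this; exact_mod_cast this
  have hd : q / (pT K + 1) < 2 * K := Nat.div_lt_of_lt_mul (by linarith [mul_comm (2*K) (pT K + 1)])
  have hm : q % (pT K + 1) < pT K + 1 := Nat.mod_lt _ (Nat.succ_pos _)
  have hs := Nat.div_add_mod q (pT K + 1)
  have hs' : ((q / (pT K + 1) * (pT K + 1) : ℕ) : ℤ) + ((q % (pT K + 1) : ℕ) : ℤ) = q := by
    rw [mul_comm]; exact_mod_cast hs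
  by_cases hpar : (q / (pT K + 1)) % 2 = 1
  · refine ⟨q / (pT K + 1), ((q % (pT K + 1) : ℕ) : ℤ), hd, by positivity, by omega, ?_⟩
    unfold posn; rw [if_pos hpar]; linarith
  · refine ⟨q / (pT K + 1), (pT K : ℤ) - ((q % (pT K + 1) : ℕ) : ℤ), hd, by omega, by omega, ?_⟩
    unfold posn; rw [if_neg hpar]; linarith

lemma ch_range {π l : ℕ} (hπ : π < 2 * K) (hl : l < K) {y : ℤ} (h0 : 0 ≤ y) (h1 : y ≤ pY K) :
    (-1 ≤ chS K π l y ∧ chS K π l y ≤ pM K - 2) ∧ (-1 ≤ chT K π l y ∧ chT K π l y ≤ pM K - 2) := by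
  have a := hgt_range hπ (iL_lt (π := π) hl) h0 h1
  have b := hgt_range hπ (iR_lt (π := π) hl) h0 h1
  exact ⟨posn_range (iL_lt hl) (by linarith) (by linarith),
    posn_range (iR_lt hl) (by linarith) (by linarith)⟩

/-- the trichotomy of shapes of a pair -/
lemma pair_cases (π : ℕ) {l : ℕ} (hl : l < K) :
    (π % 2 = 0 ∧ iL K π l % 2 = 0 ∧ iR π l % 2 = 1 ∧ iL K π l + 1 = iR π l ∧ iL K π l = 2 * l) ∨
    (π % 2 = 1 ∧ iL K π l % 2 = 1 ∧ iR π l % 2 = 0 ∧ iL K π l + 1 = iR π l ∧ 0 < l ∧ iR π l = 2 * l) ∨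
    (π % 2 = 1 ∧ iL K π l % 2 = 1 ∧ iR π l % 2 = 0 ∧ iL K π l = 2 * K - 1 ∧ iR π l = 0 ∧ l = 0) := by
  rcases Nat.mod_two_eq_zero_or_one π with h | h
  · have e1 : iL K π l = 2 * l := by simp [iL, h]
    have e2 : iR π l = 2 * l + 1 := by simp [iR, h]
    left; omega
  · have e2 : iR π l = 2 * l := by simp [iR, h]
    by_cases h0 : l = 0
    · have e1 : iL K π l = 2 * K - 1 := by simp [iL, h, h0]
      right; right; omega
    · have e1 : iL K π l = 2 * l - 1 := by simp [iL, h, h0]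
      right; left; omega

lemma hgt_mono_even {π i : ℕ} (h : π % 2 = 0) {y y' : ℤ} (hy : y < y') : hgt K π i y < hgt K π i y' := by
  unfold hgt; rw [if_pos h, if_pos h]; linarith
lemma hgt_mono_odd {π i : ℕ} (h : π % 2 = 1) {y y' : ℤ} (hy : y < y') : hgt K π i y' < hgt K π i y := by
  unfold hgt; rw [if_neg (by omega), if_neg (by omega)]; linarith

lemma ch_ne (hK : 2 ≤ K) {π l : ℕ} (hπ : π < 2 * K) (hl : l < K) {y : ℤ} (h0 : 0 ≤ y) (h1 : y ≤ pY K) :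
    chS K π l y ≠ chT K π l y := by
  have a := hgt_range hπ (iL_lt (π := π) hl) h0 h1
  have b := hgt_range hπ (iR_lt (π := π) hl) h0 h1
  intro h
  have := (posn_inj (by linarith) (by linarith) (by linarith) (by linarith) h).1
  rcases pair_cases π hl with h | h | h <;> omega

lemma cast_cyc {a b c d : ℤ} (h : (a < b ∧ b < c ∧ c < d) ∨ (b < c ∧ c < d ∧ d < a) ∨
    (c < d ∧ d < a ∧ a < b) ∨ (d < a ∧ a < b ∧ b < c)) : cyc4 (a:ℝ) b c d := by
  unfold cyc4; exact_mod_cast h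

lemma N1_cyc {π l : ℕ} (hπ : π < 2 * K) (hl : l < K) {y y' : ℤ} (h0 : 0 ≤ y) (hy : y < y')
    (h1 : y' ≤ pY K) : cyc4 (chS K π l y : ℝ) (chT K π l y) (chT K π l y') (chS K π l y') := by
  have a := hgt_range hπ (iL_lt (π := π) hl) h0 (by linarith : y ≤ pY K)
  have b := hgt_range hπ (iR_lt (π := π) hl) h0 (by linarith : y ≤ pY K)
  have a' := hgt_range hπ (iL_lt (π := π) hl) (by linarith : 0 ≤ y') h1
  have b' := hgt_range hπ (iR_lt (π := π) hl) (by linarith : 0 ≤ y') h1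
  apply cast_cyc
  unfold chS chT
  rcases pair_cases π hl with h | h | h
  · right; right; right
    refine ⟨posn_even h.2.1 (hgt_mono_even h.1 hy), posn_lt (by omega) (by linarith) (by linarith)
      (by linarith) (by linarith), posn_odd h.2.2.1 (hgt_mono_even h.1 hy)⟩
  · right; right; right
    refine ⟨posn_odd h.2.1 (hgt_mono_odd h.1 hy), posn_lt (by omega) (by linarith) (by linarith)
      (by linarith) (by linarith), posn_even h.2.2.1 (hgt_mono_odd h.1 hy)⟩
  · right; left
    refine ⟨posn_even h.2.2.1 (hgt_mono_odd h.1 hy), posn_lt (by omega) (by linarith) (by linarith)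
      (by linarith) (by linarith), posn_odd h.2.1 (hgt_mono_odd h.1 hy)⟩

lemma N2_cyc {π l l' : ℕ} (hπ : π < 2 * K) (hl : l < K) (hl' : l' < K) (hne : l ≠ l') {y y' : ℤ}
    (h0 : 0 ≤ y) (h1 : y ≤ pY K) (h0' : 0 ≤ y') (h1' : y' ≤ pY K) :
    cyc4 (chS K π l y : ℝ) (chT K π l y) (chS K π l' y') (chT K π l' y') := by
  have a := hgt_range hπ (iL_lt (π := π) hl) h0 h1
  have b := hgt_range hπ (iR_lt (π := π) hl) h0 h1
  have a' := hgt_range hπ (iL_lt (π := π) hl') h0' h1'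
  have b' := hgt_range hπ (iR_lt (π := π) hl') h0' h1'
  apply cast_cyc
  unfold chS chT
  have P1 : iL K π l < iR π l → _ := fun h => posn_lt h (by linarith) (by linarith) (by linarith : 0 ≤ hgt K π (iR π l) y) (by linarith)
  rcases pair_cases π hl with h | h | h <;> rcases pair_cases π hl' with h' | h' | h' <;>
  rcases lt_or_gt_of_ne hne with hlt | hlt <;> first
  | omega
  | (left; refine ⟨posn_lt ?_ ?_ ?_ ?_ ?_, posn_lt ?_ ?_ ?_ ?_ ?_, posn_lt ?_ ?_ ?_ ?_ ?_⟩ <;> first | omega | linarith)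
  | (right; left; refine ⟨posn_lt ?_ ?_ ?_ ?_ ?_, posn_lt ?_ ?_ ?_ ?_ ?_, posn_lt ?_ ?_ ?_ ?_ ?_⟩ <;> first | omega | linarith)
  | (right; right; left; refine ⟨posn_lt ?_ ?_ ?_ ?_ ?_, posn_lt ?_ ?_ ?_ ?_ ?_, posn_lt ?_ ?_ ?_ ?_ ?_⟩ <;> first | omega | linarith)
  | (right; right; right; refine ⟨posn_lt ?_ ?_ ?_ ?_ ?_, posn_lt ?_ ?_ ?_ ?_ ?_, posn_lt ?_ ?_ ?_ ?_ ?_⟩ <;> first | omega | linarith)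

lemma N1 {π l : ℕ} (hπ : π < 2 * K) (hl : l < K) {y y' : ℤ} (h0 : 0 ≤ y) (hy : y < y')
    (h1 : y' ≤ pY K) {z : E 2} (hz : nsq z ≤ 1) (h : ee K π l y z ≤ 0) : ee K π l y' z < 0 := by
  have c := N1_cyc hπ hl h0 hy h1
  have := cyc4w_pos hz c.weak h (.inr c)
  rw [ell_swap] at this
  unfold ee; linarith

lemma N2 {π l l' : ℕ} (hπ : π < 2 * K) (hl : l < K) (hl' : l' < K) (hne : l ≠ l') {y y' : ℤ}
    (h0 : 0 ≤ y) (h1 : y ≤ pY K) (h0' : 0 ≤ y') (h1' : y' ≤ pY K)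
    {z : E 2} (hz : nsq z ≤ 1) (h : ee K π l y z ≤ 0) : 0 < ee K π l' y' z := by
  have c := N2_cyc hπ hl hl' hne h0 h1 h0' h1'
  exact cyc4w_pos hz c.weak h (.inr c)

/-- sign of `ell` at a circle point, by position -/
lemma ell_pt_sign {s t τ : ℝ} (hst : s < t) :
    (s < τ ∧ τ < t → ell s t (pt τ) < 0) ∧ ((τ < s ∨ t < τ) → 0 < ell s t (pt τ)) := by
  rw [ell_pt]
  have hp : (0:ℝ) < τ ^ 2 + 1 := by positivity
  constructor
  · rintro ⟨a, b⟩
    apply div_neg_of_neg_of_pos _ hp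
    exact mul_neg_of_pos_of_neg (mul_pos (by linarith) (by linarith)) (by linarith)
  · rintro (a | a)
    · apply div_pos _ hp
      exact mul_pos_of_neg_of_neg (mul_neg_of_pos_of_neg (by linarith) (by linarith)) (by linarith)
    · apply div_pos _ hp
      exact mul_pos (mul_pos (by linarith) (by linarith)) (by linarith)

/-- signed height deviation -/
def dev (K π i : ℕ) (y n : ℤ) : ℤ := if π % 2 = 0 then n - hgt K π i y else hgt K π i y - n

lemma ell_ptS (s t : ℝ) : ell s t (pt s) = 0 := by rw [ell_pt]; simp
lemma ell_ptT (s t : ℝ) : ell s t (pt t) = 0 := by rw [ell_pt]; simp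

lemma N4_out {π l i : ℕ} (hπ : π < 2 * K) (hl : l < K) (hi : i < 2 * K) {y n : ℤ} (h0 : 0 ≤ y)
    (h1 : y ≤ pY K) (n0 : 0 ≤ n) (n1 : n ≤ pT K) (hin : ¬ inP K π l i) :
    0 < ee K π l y (pt (posn K i n)) := by
  have a := hgt_range hπ (iL_lt (π := π) hl) h0 h1
  have b := hgt_range hπ (iR_lt (π := π) hl) h0 h1
  rw [inP_iff hl hi] at hin
  push Not at hin
  unfold ee
  rcases pair_cases π hl with h | h | h
  · have hst : (chS K π l y : ℝ) < chT K π l y := by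
      exact_mod_cast posn_lt (by omega) (by linarith) (by linarith) (by linarith) (by linarith)
    apply (ell_pt_sign hst).2
    rcases lt_or_gt_of_ne hin.1 with c | c
    · left; exact_mod_cast posn_lt c (by linarith) (by linarith) (by linarith) (by linarith)
    · right; exact_mod_cast posn_lt (by omega) (by linarith) (by linarith) (by linarith) (by linarith)
  · have hst : (chS K π l y : ℝ) < chT K π l y := by
      exact_mod_cast posn_lt (by omega) (by linarith) (by linarith) (by linarith) (by linarith)
    apply (ell_pt_sign hst).2
    rcases lt_or_gt_of_ne hin.1 with c | c
    · left; exact_mod_cast posn_lt c (by linarith) (by linarith) (by linarith) (by linarith)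
    · right; exact_mod_cast posn_lt (by omega) (by linarith) (by linarith) (by linarith) (by linarith)
  · have hst : (chT K π l y : ℝ) < chS K π l y := by
      exact_mod_cast posn_lt (by omega) (by linarith) (by linarith) (by linarith) (by linarith)
    rw [ell_swap]
    have : ell (chT K π l y) (chS K π l y) (pt (posn K i n)) < 0 := by
      apply (ell_pt_sign hst).1
      constructor
      · exact_mod_cast posn_lt (by omega) (by linarith) (by linarith) (by linarith) (by linarith)
      · exact_mod_cast posn_lt (by omega) (by linarith) (by linarith) (by linarith) (by linarith)
    linarith

lemma N4_in {π l i : ℕ} (hπ : π < 2 * K) (hl : l < K) (hi : i < 2 * K) {y n : ℤ} (h0 : 0 ≤ y)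
    (h1 : y ≤ pY K) (n0 : 0 ≤ n) (n1 : n ≤ pT K) (hin : inP K π l i) :
    (0 < dev K π i y n → 0 < ee K π l y (pt (posn K i n))) ∧
    (dev K π i y n < 0 → ee K π l y (pt (posn K i n)) < 0) ∧
    (dev K π i y n = 0 → ee K π l y (pt (posn K i n)) = 0) := by
  have a := hgt_range hπ (iL_lt (π := π) hl) h0 h1
  have b := hgt_range hπ (iR_lt (π := π) hl) h0 h1
  rw [inP_iff hl hi] at hin
  refine ⟨?_, ?_, ?_⟩
  rotate_left 2
  · intro h
    have hn : n = hgt K π i y := by unfold dev at h; split_ifs at h <;> linarith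
    unfold ee
    rcases hin with e | e
    · have : posn K i n = chS K π l y := by rw [hn, e]; rfl
      rw [this]; exact ell_ptS _ _
    · have : posn K i n = chT K π l y := by rw [hn, e]; rfl
      rw [this]; exact ell_ptT _ _
  all_goals
    intro hd
    unfold dev at hd
    unfold ee
    rcases pair_cases π hl with h | h | h
  · rw [if_pos h.1] at hd
    have hst : (chS K π l y : ℝ) < chT K π l y := by
      exact_mod_cast posn_lt (by omega) (by linarith) (by linarith) (by linarith) (by linarith)
    apply (ell_pt_sign hst).2
    rcases hin with e | e <;> subst e
    · left; exact_mod_cast posn_even h.2.1 (by linarith)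
    · right; exact_mod_cast posn_odd h.2.2.1 (by linarith)
  · rw [if_neg (by omega)] at hd
    have hst : (chS K π l y : ℝ) < chT K π l y := by
      exact_mod_cast posn_lt (by omega) (by linarith) (by linarith) (by linarith) (by linarith)
    apply (ell_pt_sign hst).2
    rcases hin with e | e <;> subst e
    · left; exact_mod_cast posn_odd h.2.1 (by linarith)
    · right; exact_mod_cast posn_even h.2.2.1 (by linarith)
  · rw [if_neg (by omega)] at hd
    have hst : (chT K π l y : ℝ) < chS K π l y := by
      exact_mod_cast posn_lt (by omega) (by linarith) (by linarith) (by linarith) (by linarith)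
    rw [ell_swap, neg_pos]
    apply (ell_pt_sign hst).1
    rcases hin with e | e <;> subst e
    · constructor
      · exact_mod_cast posn_lt (by omega) (by linarith) (by linarith) (by linarith) (by linarith)
      · exact_mod_cast posn_odd h.2.1 (by linarith)
    · constructor
      · exact_mod_cast posn_even h.2.2.1 (by linarith)
      · exact_mod_cast posn_lt (by omega) (by linarith) (by linarith) (by linarith) (by linarith)
  · rw [if_pos h.1] at hd
    have hst : (chS K π l y : ℝ) < chT K π l y := by
      exact_mod_cast posn_lt (by omega) (by linarith) (by linarith) (by linarith) (by linarith)
    apply (ell_pt_sign hst).1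
    rcases hin with e | e <;> subst e
    · constructor
      · exact_mod_cast posn_even h.2.1 (by linarith)
      · exact_mod_cast posn_lt (by omega) (by linarith) (by linarith) (by linarith) (by linarith)
    · constructor
      · exact_mod_cast posn_lt (by omega) (by linarith) (by linarith) (by linarith) (by linarith)
      · exact_mod_cast posn_odd h.2.2.1 (by linarith)
  · rw [if_neg (by omega)] at hd
    have hst : (chS K π l y : ℝ) < chT K π l y := by
      exact_mod_cast posn_lt (by omega) (by linarith) (by linarith) (by linarith) (by linarith)
    apply (ell_pt_sign hst).1
    rcases hin with e | e <;> subst e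
    · constructor
      · exact_mod_cast posn_odd h.2.1 (by linarith)
      · exact_mod_cast posn_lt (by omega) (by linarith) (by linarith) (by linarith) (by linarith)
    · constructor
      · exact_mod_cast posn_lt (by omega) (by linarith) (by linarith) (by linarith) (by linarith)
      · exact_mod_cast posn_even h.2.2.1 (by linarith)
  · rw [if_neg (by omega)] at hd
    have hst : (chT K π l y : ℝ) < chS K π l y := by
      exact_mod_cast posn_lt (by omega) (by linarith) (by linarith) (by linarith) (by linarith)
    rw [ell_swap, neg_lt_zero]
    apply (ell_pt_sign hst).2
    rcases hin with e | e <;> subst e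
    · right; exact_mod_cast posn_odd h.2.1 (by linarith)
    · left; exact_mod_cast posn_even h.2.2.1 (by linarith)

end
end FatS
end

section
open Metric Set Topology
namespace FatS

/-! pages and slices of the open book -/
def th (K : ℕ) (x : ℝ) : ℂ := Complex.exp (((2 * Real.pi * x / (2 * K : ℕ) : ℝ) : ℂ) * Complex.I)
def pgE (K σ : ℕ) : ℕ := if σ % 2 = 0 then σ else (σ + 1) % (2 * K)
def pgO (σ : ℕ) : ℕ := if σ % 2 = 0 then σ + 1 else σ
def gam (K σ : ℕ) (t : ℝ) : ℂ := th K (if σ % 2 = 0 then σ + t else σ + 1 - t)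

section
variable {K : ℕ}

lemma th_norm (x : ℝ) : ‖th K x‖ = 1 := Complex.norm_exp_ofReal_mul_I _
lemma gam_norm (σ : ℕ) (x : ℝ) : ‖gam K σ x‖ = 1 := th_norm _
lemma th_cont : Continuous (th K) := by unfold th; fun_prop
lemma gam_cont (σ : ℕ) : Continuous (gam K σ) := by
  unfold gam
  split_ifs
  · exact th_cont.comp (by fun_prop)
  · exact th_cont.comp (by fun_prop)

lemma th_eq (hK : 2 ≤ K) {x y : ℝ} : th K x = th K y ↔ ∃ n : ℤ, x = y + n * (2 * K : ℕ) := by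
  have hN : ((2 * K : ℕ) : ℝ) ≠ 0 := by positivity
  have hN' : ((2 * K : ℕ) : ℂ) ≠ 0 := by exact_mod_cast hN
  have hpi := Real.pi_pos.ne'
  unfold th
  rw [Complex.exp_eq_exp_iff_exists_int]
  refine exists_congr fun n => ?_
  constructor
  · intro h
    have h2 : (((2 * Real.pi * x / (2 * K : ℕ) : ℝ) : ℂ)) = ((2 * Real.pi * y / (2 * K : ℕ) + n * (2 * Real.pi) : ℝ) : ℂ) := by
      apply mul_right_cancel₀ Complex.I_ne_zero
      rw [h]; push_cast; ring
    have h3 := Complex.ofReal_injective h2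
    field_simp at h3
    linarith
  · rintro rfl
    have hKc : (K : ℂ) ≠ 0 := by
      have : K ≠ 0 := by omega
      exact_mod_cast this
    push_cast
    field_simp

lemma th_surj (hK : 2 ≤ K) {w : ℂ} (hw : ‖w‖ = 1) : ∃ x : ℝ, 0 ≤ x ∧ x < (2 * K : ℕ) ∧ th K x = w := by
  have hN : (0:ℝ) < ((2 * K : ℕ) : ℝ) := by positivity
  have hpi := Real.pi_pos
  obtain ⟨x0, hx0⟩ : ∃ x0, th K x0 = w := by
    refine ⟨(2 * K : ℕ) * w.arg / (2 * Real.pi), ?_⟩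
    unfold th
    have : (2 * Real.pi * ((2 * K : ℕ) * w.arg / (2 * Real.pi)) / (2 * K : ℕ) : ℝ) = w.arg := by
      field_simp
    rw [this]
    have := Complex.norm_mul_exp_arg_mul_I w
    rw [hw] at this; simpa using this
  refine ⟨x0 - ⌊x0 / (2 * K : ℕ)⌋ * (2 * K : ℕ), ?_, ?_, ?_⟩
  · have := Int.floor_le (x0 / (2 * K : ℕ))
    rw [le_div_iff₀ hN] at this; linarith
  · have := Int.lt_floor_add_one (x0 / (2 * K : ℕ))
    rw [div_lt_iff₀ hN] at this; linarith
  · rw [← hx0, th_eq hK]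
    exact ⟨-⌊x0 / (2 * K : ℕ)⌋, by push_cast; ring⟩

lemma th_inj' (hK : 2 ≤ K) {x y : ℝ} (h : th K x = th K y) (h1 : |x - y| < (2 * K : ℕ)) : x = y := by
  obtain ⟨n, hn⟩ := (th_eq hK).1 h
  have hN : (0:ℝ) < ((2 * K : ℕ) : ℝ) := by positivity
  have : n = 0 := by
    by_contra h0
    have : (1:ℝ) ≤ |(n:ℝ)| := by exact_mod_cast Int.one_le_abs h0
    rw [show x - y = n * (2 * K : ℕ) by linarith, abs_mul, abs_of_pos hN] at h1
    nlinarith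
  subst this; simpa using hn

lemma pgE_lt (hK : 2 ≤ K) {σ : ℕ} (h : σ < 2 * K) : pgE K σ < 2 * K := by
  unfold pgE; split_ifs
  · exact h
  · exact Nat.mod_lt _ (by omega)
lemma pgO_lt {σ : ℕ} (h : σ < 2 * K) : pgO σ < 2 * K := by
  unfold pgO; split_ifs <;> omega
lemma pgE_eq {σ : ℕ} (h : σ < 2 * K) : pgE K σ = if σ % 2 = 0 then σ else if σ = 2 * K - 1 then 0 else σ + 1 := by
  unfold pgE
  split_ifs with h1 h2
  · rfl
  · have : σ + 1 = 2 * K := by omega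
    rw [this, Nat.mod_self]
  · exact Nat.mod_eq_of_lt (by omega)
lemma pgE_even {σ : ℕ} (h : σ < 2 * K) : pgE K σ % 2 = 0 := by
  rw [pgE_eq h]; split_ifs <;> omega
lemma pgO_odd (σ : ℕ) : pgO σ % 2 = 1 := by
  unfold pgO; split_ifs <;> omega
lemma pg_inj (hK : 2 ≤ K) {σ σ' : ℕ} (h : σ < 2 * K) (h' : σ' < 2 * K) (e : pgE K σ = pgE K σ')
    (e' : pgO σ = pgO σ') : σ = σ' := by
  rw [pgE_eq h, pgE_eq h'] at e
  unfold pgO at e'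
  split_ifs at e e' <;> omega

lemma gam_zero (hK : 2 ≤ K) {σ : ℕ} (h : σ < 2 * K) : gam K σ 0 = th K (pgE K σ) := by
  unfold gam
  rw [pgE_eq h]
  split_ifs with h1 h2
  · simp
  · rw [th_eq hK]; refine ⟨1, ?_⟩
    have : (σ : ℝ) + 1 = (2 * K : ℕ) := by
      have : σ + 1 = 2 * K := by omega
      exact_mod_cast this
    push_cast at *; linarith
  · push_cast; simp
lemma gam_one {σ : ℕ} : gam K σ 1 = th K (pgO σ) := by
  unfold gam pgO
  split_ifs with h1
  · push_cast; rfl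
  · simp

lemma nat_lt_real {a b : ℕ} (h : a < b) : (a : ℝ) + 1 ≤ b := by exact_mod_cast h

lemma th_nat_inj (hK : 2 ≤ K) {a b : ℕ} (ha : a < 2 * K) (hb : b < 2 * K) (h : th K a = th K b) : a = b := by
  have := th_inj' hK h (by
    have h1 := nat_lt_real ha; have h2 := nat_lt_real hb
    rw [abs_lt]; constructor <;> linarith [(Nat.cast_nonneg a : (0:ℝ) ≤ a), (Nat.cast_nonneg b : (0:ℝ) ≤ b)])
  exact_mod_cast this

lemma gam_inj (hK : 2 ≤ K) (σ : ℕ) : InjOn (gam K σ) (Icc 0 1) := by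
  intro x hx y hy h
  have h4 : (4:ℝ) ≤ (2 * K : ℕ) := by exact_mod_cast (by omega : 4 ≤ 2 * K)
  unfold gam at h
  split_ifs at h
  · have := th_inj' hK h (by rw [abs_lt]; constructor <;> linarith [hx.1, hx.2, hy.1, hy.2])
    linarith
  · have := th_inj' hK h (by rw [abs_lt]; constructor <;> linarith [hx.1, hx.2, hy.1, hy.2])
    linarith

/-- the parameter of an interior slice point lies in an open unit interval -/
lemma gam_open {σ : ℕ} {t : ℝ} (ht : t ∈ Ioo (0:ℝ) 1) :
    ∃ x ∈ Ioo (σ:ℝ) (σ + 1), gam K σ t = th K x ∧ x = if σ % 2 = 0 then σ + t else σ + 1 - t := by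
  refine ⟨_, ?_, rfl, rfl⟩
  split_ifs <;> constructor <;> linarith [ht.1, ht.2]

lemma gam_ne_th (hK : 2 ≤ K) {σ π : ℕ} (hσ : σ < 2 * K) (hπ : π < 2 * K) {t : ℝ} (ht : t ∈ Ioo (0:ℝ) 1) :
    gam K σ t ≠ th K π := by
  obtain ⟨x, hx, e, -⟩ := gam_open (K := K) (σ := σ) ht
  rw [e]
  intro h
  have h1 := nat_lt_real hσ; have h2 := nat_lt_real hπ
  have e := th_inj' hK h (by
    rw [abs_lt]; constructor <;> linarith [(Nat.cast_nonneg σ : (0:ℝ) ≤ σ), (Nat.cast_nonneg π : (0:ℝ) ≤ π), hx.1, hx.2])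
  rw [e] at hx
  have a1 : σ < π := by exact_mod_cast hx.1
  have a2 : π < σ + 1 := by exact_mod_cast hx.2
  omega

lemma gam_eq_th (hK : 2 ≤ K) {σ π : ℕ} (hσ : σ < 2 * K) (hπ : π < 2 * K) {t : ℝ} (ht : t ∈ Icc (0:ℝ) 1)
    (h : gam K σ t = th K π) : (t = 0 ∧ π = pgE K σ) ∨ (t = 1 ∧ π = pgO σ) := by
  rcases ht.1.eq_or_lt with h0 | h0
  · subst h0; rw [gam_zero hK hσ] at h
    exact .inl ⟨rfl, (th_nat_inj hK (pgE_lt hK hσ) hπ h).symm⟩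
  rcases ht.2.eq_or_lt with h1 | h1
  · subst h1; rw [gam_one] at h
    exact .inr ⟨rfl, (th_nat_inj hK (pgO_lt hσ) hπ h).symm⟩
  exact absurd h (gam_ne_th hK hσ hπ ⟨h0, h1⟩)

lemma gam_eq_gam (hK : 2 ≤ K) {σ σ' : ℕ} (hσ : σ < 2 * K) (hσ' : σ' < 2 * K) {t t' : ℝ}
    (ht : t ∈ Ioo (0:ℝ) 1) (ht' : t' ∈ Icc (0:ℝ) 1) (h : gam K σ t = gam K σ' t') : σ = σ' ∧ t = t' := by
  have ho : t' ∈ Ioo (0:ℝ) 1 := by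
    refine ⟨lt_of_le_of_ne ht'.1 ?_, lt_of_le_of_ne ht'.2 ?_⟩
    · rintro rfl; rw [gam_zero hK hσ'] at h; exact gam_ne_th hK hσ (pgE_lt hK hσ') ht h
    · rintro rfl; rw [gam_one] at h; exact gam_ne_th hK hσ (pgO_lt hσ') ht h
  obtain ⟨x, hx, e, -⟩ := gam_open (K := K) (σ := σ) ht
  obtain ⟨x', hx', e', -⟩ := gam_open (K := K) (σ := σ') ho
  have h0 := h
  rw [e, e'] at h
  have h1 := nat_lt_real hσ; have h2 := nat_lt_real hσ'
  have ee := th_inj' hK h (by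
    rw [abs_lt]; constructor <;> linarith [(Nat.cast_nonneg σ : (0:ℝ) ≤ σ), (Nat.cast_nonneg σ' : (0:ℝ) ≤ σ'), hx.1, hx.2, hx'.1, hx'.2])
  have a1 : σ < σ' + 1 := by
    have : (σ:ℝ) < σ' + 1 := by linarith [hx.1, hx'.2]
    exact_mod_cast this
  have a2 : σ' < σ + 1 := by
    have : (σ':ℝ) < σ + 1 := by linarith [hx.2, hx'.1]
    exact_mod_cast this
  have : σ = σ' := by omega
  subst this
  exact ⟨rfl, gam_inj hK σ ⟨ht.1.le, ht.2.le⟩ ht' h0⟩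

lemma w_cover (hK : 2 ≤ K) {w : ℂ} (hw : ‖w‖ = 1) :
    (∃ π < 2 * K, w = th K π) ∨ ∃ σ < 2 * K, ∃ t ∈ Ioo (0:ℝ) 1, w = gam K σ t := by
  obtain ⟨x, h0, h1, rfl⟩ := th_surj hK hw
  have hf := Nat.floor_le h0
  have hf' := Nat.lt_floor_add_one x
  have hlt : ⌊x⌋₊ < 2 * K := (Nat.floor_lt h0).2 h1
  rcases hf.eq_or_lt with h | h
  · exact .inl ⟨⌊x⌋₊, hlt, by rw [h]⟩
  · refine .inr ⟨⌊x⌋₊, hlt, ?_⟩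
    by_cases hp : ⌊x⌋₊ % 2 = 0
    · exact ⟨x - ⌊x⌋₊, ⟨by linarith, by linarith⟩, by unfold gam; rw [if_pos hp]; congr 1; ring⟩
    · exact ⟨⌊x⌋₊ + 1 - x, ⟨by linarith, by linarith⟩, by unfold gam; rw [if_neg hp]; congr 1; ring⟩

end
end FatS
end

section
open Metric Set Topology
namespace FatS

/-- data for one slice: two families of functions -/
structure Fam (K H : ℕ) where
  eL : Fin K → ℕ → E 2 → ℝ
  eT : Fin K → ℕ → E 2 → ℝ
  cL : ∀ l m, Continuous (eL l m)
  cT : ∀ l m, Continuous (eT l m)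
  mL : ∀ l m m' z, m < m' → m' ≤ H → nsq z ≤ 1 → eL l m z ≤ 0 → eL l m' z < 0
  mT : ∀ l m m' z, m' < m → m ≤ H → nsq z ≤ 1 → eT l m z ≤ 0 → eT l m' z < 0
  x : ∀ l l' m z, m ≤ H → nsq z < 1 → eL l m z ≤ 0 → 0 < eT l' m z
  xL : ∀ l l' m z, m ≤ H → nsq z ≤ 1 → eL l m z ≤ 0 → 0 ≤ eT l' m z
  xT : ∀ l l' m z, m ≤ H → nsq z ≤ 1 → eT l m z ≤ 0 → 0 ≤ eL l' m z

namespace Fam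
variable {K H : ℕ} (F : Fam K H)
open Finset in
def P (t : ℕ) (z : E 2) : ℝ := ∑ m ∈ Finset.Ico (t - 1) (H + 1), ∏ l, max 0 (F.eL l m z)
open Finset in
def Q (t : ℕ) (z : E 2) : ℝ := ∑ m ∈ Finset.range t, ∏ l, max 0 (F.eT l m z)
def lam (t : ℕ) (z : E 2) : ℝ := if t = 0 then 1 else if t = H + 2 then 0 else F.P t z / (F.P t z + F.Q t z)

lemma prod_nonneg (e : Fin K → ℝ) : 0 ≤ ∏ l, max 0 (e l) := Finset.prod_nonneg fun _ _ => le_max_left _ _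
lemma prod_pos_iff (e : Fin K → ℝ) : 0 < ∏ l, max 0 (e l) ↔ ∀ l, 0 < e l := by
  constructor
  · intro h l
    by_contra hl
    have : ∏ l, max 0 (e l) = 0 := Finset.prod_eq_zero (Finset.mem_univ l) (max_eq_left (not_lt.1 hl))
    linarith
  · intro h
    exact Finset.prod_pos fun l _ => lt_max_of_lt_right (h l)

lemma P_nonneg (t z) : 0 ≤ F.P t z := Finset.sum_nonneg fun _ _ => prod_nonneg _
lemma Q_nonneg (t z) : 0 ≤ F.Q t z := Finset.sum_nonneg fun _ _ => prod_nonneg _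

lemma P_pos {m : ℕ} (hm : m ≤ H) {z : E 2} (hz : nsq z ≤ 1) : 0 < F.P (m + 1) z ↔ ∀ l, 0 < F.eL l m z := by
  unfold P
  rw [Nat.add_sub_cancel]
  constructor
  · intro h l
    obtain ⟨m', hm', hp⟩ := (Finset.sum_pos_iff_of_nonneg (fun _ _ => prod_nonneg _)).1 h
    rw [Finset.mem_Ico] at hm'
    have := (prod_pos_iff _).1 hp l
    rcases hm'.1.eq_or_lt with e | e
    · rw [e]; exact this
    · by_contra hc
      linarith [F.mL l m m' z e (by omega) hz (not_lt.1 hc)]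
  · intro h
    refine (Finset.sum_pos_iff_of_nonneg (fun _ _ => prod_nonneg _)).2 ⟨m, ?_, (prod_pos_iff _).2 h⟩
    rw [Finset.mem_Ico]; omega

lemma Q_pos {m : ℕ} (hm : m ≤ H) {z : E 2} (hz : nsq z ≤ 1) : 0 < F.Q (m + 1) z ↔ ∀ l, 0 < F.eT l m z := by
  unfold Q
  constructor
  · intro h l
    obtain ⟨m', hm', hp⟩ := (Finset.sum_pos_iff_of_nonneg (fun _ _ => prod_nonneg _)).1 h
    rw [Finset.mem_range] at hm'
    have := (prod_pos_iff _).1 hp l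
    rcases (Nat.lt_succ_iff.1 hm').eq_or_lt with e | e
    · rw [← e]; exact this
    · by_contra hc
      linarith [F.mT l m m' z e (by omega) hz (not_lt.1 hc)]
  · intro h
    refine (Finset.sum_pos_iff_of_nonneg (fun _ _ => prod_nonneg _)).2 ⟨m, ?_, (prod_pos_iff _).2 h⟩
    rw [Finset.mem_range]; omega

lemma PQ_pos {m : ℕ} (hm : m ≤ H) {z : E 2} (hz : nsq z < 1) : 0 < F.P (m + 1) z + F.Q (m + 1) z := by
  by_cases h : ∀ l, 0 < F.eL l m z
  · linarith [(F.P_pos hm hz.le).2 h, F.Q_nonneg (m + 1) z]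
  · push Not at h
    obtain ⟨l, hl⟩ := h
    linarith [(F.Q_pos hm hz.le).2 (fun l' => F.x l l' m z hm hz hl), F.P_nonneg (m + 1) z]

lemma lam_zero (z) : F.lam 0 z = 1 := by simp [lam]
lemma lam_last (z) : F.lam (H + 2) z = 0 := by simp [lam]
lemma lam_succ {m : ℕ} (hm : m ≤ H) (z) :
    F.lam (m + 1) z = F.P (m + 1) z / (F.P (m + 1) z + F.Q (m + 1) z) := by
  unfold lam; rw [if_neg (by omega), if_neg (by omega)]

lemma cases3 {t : ℕ} (ht : t ≤ H + 2) : t = 0 ∨ t = H + 2 ∨ ∃ m ≤ H, t = m + 1 := by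
  rcases Nat.eq_zero_or_pos t with h | h
  · exact .inl h
  by_cases h2 : t = H + 2
  · exact .inr (.inl h2)
  · exact .inr (.inr ⟨t - 1, by omega, by omega⟩)

lemma lam_nonneg {t : ℕ} (ht : t ≤ H + 2) (z) : 0 ≤ F.lam t z := by
  rcases cases3 ht with rfl | rfl | ⟨m, hm, rfl⟩
  · rw [lam_zero]; norm_num
  · rw [lam_last]
  · rw [F.lam_succ hm]; exact div_nonneg (F.P_nonneg _ _) (add_nonneg (F.P_nonneg _ _) (F.Q_nonneg _ _))
lemma lam_le_one {t : ℕ} (ht : t ≤ H + 2) (z) : F.lam t z ≤ 1 := by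
  rcases cases3 ht with rfl | rfl | ⟨m, hm, rfl⟩
  · rw [lam_zero]
  · rw [lam_last]; norm_num
  · rw [F.lam_succ hm]
    exact div_le_one_of_le₀ (by linarith [F.Q_nonneg (m+1) z]) (add_nonneg (F.P_nonneg _ _) (F.Q_nonneg _ _))

lemma lam_cont {t : ℕ} (ht : t ≤ H + 2) {z : E 2} (hz : nsq z < 1) : ContinuousAt (F.lam t) z := by
  rcases cases3 ht with rfl | rfl | ⟨m, hm, rfl⟩
  · have : F.lam 0 = fun _ => 1 := funext F.lam_zero
    rw [this]; exact continuousAt_const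
  · have : F.lam (H + 2) = fun _ => 0 := funext F.lam_last
    rw [this]; exact continuousAt_const
  · have : F.lam (m + 1) = fun z => F.P (m + 1) z / (F.P (m + 1) z + F.Q (m + 1) z) := funext (F.lam_succ hm)
    rw [this]
    have c1 : Continuous (F.P (m + 1)) := by
      unfold P
      have := F.cL
      fun_prop
    have c2 : Continuous (F.Q (m + 1)) := by
      unfold Q
      have := F.cT
      fun_prop
    exact c1.continuousAt.div (c1.add c2).continuousAt (F.PQ_pos hm hz).ne'

lemma lam_pos {m : ℕ} (hm : m ≤ H) {z : E 2} (hz : nsq z < 1) : 0 < F.lam (m + 1) z ↔ ∀ l, 0 < F.eL l m z := by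
  rw [F.lam_succ hm, div_pos_iff_of_pos_right (F.PQ_pos hm hz), F.P_pos hm hz.le]
lemma lam_lt {m : ℕ} (hm : m ≤ H) {z : E 2} (hz : nsq z < 1) : F.lam (m + 1) z < 1 ↔ ∀ l, 0 < F.eT l m z := by
  rw [F.lam_succ hm, div_lt_one (F.PQ_pos hm hz), lt_add_iff_pos_right, F.Q_pos hm hz.le]

lemma lam_eq_zero {m : ℕ} (hm : m ≤ H) {z : E 2} (hz : nsq z < 1) : F.lam (m + 1) z = 0 ↔ ∃ l, F.eL l m z ≤ 0 := by
  have := F.lam_pos hm hz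
  have h0 := F.lam_nonneg (show m + 1 ≤ H + 2 by omega) z
  constructor
  · intro h; by_contra hc; push Not at hc; linarith [this.2 hc]
  · rintro ⟨l, hl⟩
    by_contra hc
    linarith [this.1 (lt_of_le_of_ne h0 (Ne.symm hc)) l]
lemma lam_eq_one {m : ℕ} (hm : m ≤ H) {z : E 2} (hz : nsq z < 1) : F.lam (m + 1) z = 1 ↔ ∃ l, F.eT l m z ≤ 0 := by
  have := F.lam_lt hm hz
  have h0 := F.lam_le_one (show m + 1 ≤ H + 2 by omega) z
  constructor
  · intro h; by_contra hc; push Not at hc; linarith [this.2 hc]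
  · rintro ⟨l, hl⟩
    by_contra hc
    linarith [this.1 (lt_of_le_of_ne h0 hc) l]

lemma P_anti {t t' : ℕ} (h : t ≤ t') (z) : F.P t' z ≤ F.P t z := by
  apply Finset.sum_le_sum_of_subset_of_nonneg
  · intro m; simp only [Finset.mem_Ico]; omega
  · intros; exact prod_nonneg _
lemma Q_mono {t t' : ℕ} (h : t ≤ t') (z) : F.Q t z ≤ F.Q t' z := by
  apply Finset.sum_le_sum_of_subset_of_nonneg
  · intro m; simp only [Finset.mem_range]; omega
  · intros; exact prod_nonneg _
lemma P_strict {m m' : ℕ} (h : m < m') (hm : m' ≤ H) {z : E 2} (hz : nsq z ≤ 1) (hp : 0 < F.P (m + 1) z) :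
    F.P (m' + 1) z < F.P (m + 1) z := by
  apply Finset.sum_lt_sum_of_subset (i := m)
  · intro k; simp only [Finset.mem_Ico]; omega
  · simp only [Finset.mem_Ico]; omega
  · simp only [Finset.mem_Ico]; omega
  · exact (prod_pos_iff _).2 ((F.P_pos (by omega) hz).1 hp)
  · intros; exact prod_nonneg _

lemma lam_anti {t t' : ℕ} (h : t ≤ t') (ht : t' ≤ H + 2) {z : E 2} (hz : nsq z < 1) : F.lam t' z ≤ F.lam t z := by
  rcases cases3 (h.trans ht) with rfl | rfl | ⟨m, hm, rfl⟩
  · rw [lam_zero]; exact F.lam_le_one ht z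
  · have : t' = H + 2 := by omega
    rw [this]
  · rcases cases3 ht with rfl | rfl | ⟨m', hm', rfl⟩
    · omega
    · rw [lam_last]; exact F.lam_nonneg (h.trans ht) z
    · rw [F.lam_succ hm, F.lam_succ hm', div_le_div_iff₀ (F.PQ_pos hm' hz) (F.PQ_pos hm hz)]
      have := mul_le_mul (F.P_anti h z) (F.Q_mono h z) (F.Q_nonneg _ _) (F.P_nonneg _ _)
      linarith
lemma lam_strict {t t' : ℕ} (h : t < t') (ht : t' ≤ H + 2) {z : E 2} (hz : nsq z < 1)
    (h0 : 0 < F.lam t z) (h1 : F.lam t' z < 1) : F.lam t' z < F.lam t z := by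
  rcases cases3 (h.le.trans ht) with rfl | rfl | ⟨m, hm, rfl⟩
  · rw [lam_zero]; exact h1
  · omega
  · rcases cases3 ht with rfl | rfl | ⟨m', hm', rfl⟩
    · omega
    · rw [lam_last]; exact h0
    · have p1 := (F.P_pos hm hz.le).2 ((F.lam_pos hm hz).1 h0)
      have p2 := (F.Q_pos hm' hz.le).2 ((F.lam_lt hm' hz).1 h1)
      rw [F.lam_succ hm, F.lam_succ hm', div_lt_div_iff₀ (F.PQ_pos hm' hz) (F.PQ_pos hm hz)]
      have q1 := F.P_strict (by omega : m < m') hm' hz.le p1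
      have q2 := F.Q_mono h.le z
      nlinarith [F.P_nonneg (m' + 1) z]

end Fam
end FatS
end

section
open Metric Set Topology
namespace FatS

def yE (K σ l : ℕ) (m : ℤ) : ℤ := m + ((pB K * pgO σ * l : ℕ) : ℤ)
def yO (K σ l : ℕ) (m : ℤ) : ℤ := pY K - m - ((3 * pgE K σ * l : ℕ) : ℤ)
def uu (K σ i : ℕ) : ℤ := 1 + fE K (pgE K σ) i + gO K (pgO σ) i

section
variable {K : ℕ}

lemma yE_range {σ l : ℕ} (hσ : σ < 2 * K) (hl : l < K) {m : ℤ} (h0 : 0 ≤ m) (h1 : m ≤ pH K) :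
    0 ≤ yE K σ l m ∧ yE K σ l m ≤ pY K := by
  have := pB_mul_le (pgO_lt hσ).le hl.le
  unfold yE pY; push_cast; constructor
  · positivity
  · have : ((pB K * pgO σ * l : ℕ) : ℤ) ≤ pU K := by exact_mod_cast this
    push_cast at this; linarith
lemma yO_range (hK : 2 ≤ K) {σ l : ℕ} (hσ : σ < 2 * K) (hl : l < K) {m : ℤ} (h0 : 0 ≤ m) (h1 : m ≤ pH K) :
    0 ≤ yO K σ l m ∧ yO K σ l m ≤ pY K := by
  have := p3_mul_le (pgE_lt hK hσ).le hl.le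
  have : ((3 * pgE K σ * l : ℕ) : ℤ) ≤ pU K := by exact_mod_cast this
  have h2 : 0 ≤ ((3 * pgE K σ * l : ℕ) : ℤ) := by positivity
  have h3 : (pY K : ℤ) = pH K + pU K := by unfold pY; push_cast; rfl
  unfold yO; constructor <;> linarith
lemma uu_range (hK : 2 ≤ K) {σ i : ℕ} (hσ : σ < 2 * K) (hi : i < 2 * K) :
    1 ≤ uu K σ i ∧ uu K σ i ≤ 1 + 2 * pU K := by
  have a1 := fE_nonneg (K := K) (pgE K σ) i; have a2 := gO_nonneg (K := K) (pgO σ) i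
  have b1 := fE_le (pgE_lt hK hσ) hi; have b2 := gO_le (pgO_lt hσ) hi
  unfold uu; constructor <;> linarith
lemma um_range (hK : 2 ≤ K) {σ i : ℕ} (hσ : σ < 2 * K) (hi : i < 2 * K) {m : ℤ} (h0 : 0 ≤ m) (h1 : m ≤ pH K) :
    1 ≤ uu K σ i + m ∧ uu K σ i + m + 1 ≤ pT K := by
  have := uu_range hK hσ hi
  have e2 : (pT K : ℤ) = pH K + 2 * pU K + 2 := by unfold pT; push_cast; rfl
  constructor <;> linarith

lemma inP_even {π l i : ℕ} (h : π % 2 = 0) : inP K π l i ↔ i / 2 = l := by unfold inP; rw [if_pos h]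
lemma inP_odd {π l i : ℕ} (h : π % 2 = 1) : inP K π l i ↔ hh K i = l := by unfold inP; rw [if_neg (by omega)]

lemma hgt_yE {σ l i : ℕ} (hσ : σ < 2 * K) (hi : inP K (pgE K σ) l i) (m : ℤ) :
    hgt K (pgE K σ) i (yE K σ l m) = uu K σ i + m := by
  rw [inP_even (pgE_even hσ)] at hi
  unfold hgt; rw [if_pos (pgE_even hσ)]
  unfold yE uu gO; rw [hi]; ring
lemma hgt_yO {σ l i : ℕ} (hi : inP K (pgO σ) l i) (m : ℤ) :
    hgt K (pgO σ) i (yO K σ l m) = uu K σ i + m := by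
  rw [inP_odd (pgO_odd σ)] at hi
  have := pgO_odd σ
  unfold hgt; rw [if_neg (by omega)]
  unfold yO uu fE; rw [hi]; ring

lemma inP_iL {π l : ℕ} (hl : l < K) : inP K π l (iL K π l) := (inP_iff hl (iL_lt hl)).2 (.inl rfl)
lemma inP_iR {π l : ℕ} (hl : l < K) : inP K π l (iR π l) := (inP_iff hl (iR_lt hl)).2 (.inr rfl)

lemma N3_cyc (hK : 2 ≤ K) {σ l l' : ℕ} (hσ : σ < 2 * K) (hl : l < K) (hl' : l' < K) {m : ℤ} (h0 : 0 ≤ m)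
    (h1 : m ≤ pH K) :
    cyc4w (chS K (pgE K σ) l (yE K σ l m) : ℝ) (chT K (pgE K σ) l (yE K σ l m))
      (chS K (pgO σ) l' (yO K σ l' m)) (chT K (pgO σ) l' (yO K σ l' m)) ∧
    ¬ ((chT K (pgE K σ) l (yE K σ l m) : ℝ) = (chS K (pgO σ) l' (yO K σ l' m)) ∧
      (chS K (pgE K σ) l (yE K σ l m) : ℝ) = (chT K (pgO σ) l' (yO K σ l' m))) := by
  have P : ∀ i j, i < j → j < 2 * K → posn K i (uu K σ i + m) < posn K j (uu K σ j + m) := by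
    intro i j hij hj
    have a := um_range hK hσ (hij.trans hj) h0 h1
    have b := um_range hK hσ hj h0 h1
    exact posn_lt hij (by linarith) (by linarith) (by linarith) (by linarith)
  have P' : ∀ i j, i ≤ j → j < 2 * K → posn K i (uu K σ i + m) ≤ posn K j (uu K σ j + m) := by
    intro i j hij hj
    rcases hij.eq_or_lt with e | e
    · rw [e]
    · exact (P i j e hj).le
  have Pi : ∀ i j, i < 2 * K → j < 2 * K → posn K i (uu K σ i + m) = posn K j (uu K σ j + m) → i = j := by
    intro i j hi hj h
    rcases lt_trichotomy i j with e | e | e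
    · linarith [P i j e hj]
    · exact e
    · linarith [P j i e hi]
  unfold chS chT
  rw [hgt_yE hσ (inP_iL hl), hgt_yE hσ (inP_iR hl), hgt_yO (inP_iL hl'), hgt_yO (inP_iR hl')]
  have A := pair_cases (K := K) (pgE K σ) hl
  have B := pair_cases (K := K) (pgO σ) hl'
  have hE := pgE_even hσ
  have hO := pgO_odd σ
  have l1 := iL_lt (π := pgE K σ) hl
  have l2 := iR_lt (π := pgE K σ) hl
  have l3 := iL_lt (π := pgO σ) hl'
  have l4 := iR_lt (π := pgO σ) hl'
  constructor
  · unfold cyc4w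
    norm_cast
    rcases A with A | A | A
    · rcases B with B | B | B
      · omega
      · rcases le_or_gt l' l with h | h
        · exact .inr (.inr (.inl ⟨P _ _ (by omega) l4, P' _ _ (by omega) l1, P _ _ (by omega) l2⟩))
        · exact .inl ⟨P _ _ (by omega) l2, P' _ _ (by omega) l3, P _ _ (by omega) l4⟩
      · exact .inr (.inr (.inr ⟨P' _ _ (by omega) l1, P _ _ (by omega) l2, P' _ _ (by omega) l3⟩))
    · omega
    · omega
  · norm_cast
    rintro ⟨e1, e2⟩
    have := Pi _ _ l2 l3 e1
    have := Pi _ _ l1 l4 e2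
    rcases A with A | A | A <;> rcases B with B | B | B <;> omega

lemma ee_cont (π l : ℕ) (y : ℤ) : Continuous (ee K π l y) := ell_cont _ _

/-- the function family of a slice -/
def fam (hK : 2 ≤ K) (σ : Fin (2 * K)) : Fam K (pH K) where
  eL l m := ee K (pgE K σ) l (yE K σ l m)
  eT l m := ee K (pgO σ) l (yO K σ l m)
  cL _ _ := ee_cont _ _ _
  cT _ _ := ee_cont _ _ _
  mL l m m' z h h' hz he := by
    have a := yE_range σ.2 l.2 (show (0:ℤ) ≤ m by positivity) (by exact_mod_cast (h.le.trans h'))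
    have b := yE_range σ.2 l.2 (show (0:ℤ) ≤ m' by positivity) (by exact_mod_cast h')
    exact N1 (pgE_lt hK σ.2) l.2 a.1 (by unfold yE; have : (m:ℤ) < m' := by exact_mod_cast h
                                         linarith) b.2 hz he
  mT l m m' z h h' hz he := by
    have a := yO_range hK σ.2 l.2 (show (0:ℤ) ≤ m by positivity) (by exact_mod_cast h')
    have b := yO_range hK σ.2 l.2 (show (0:ℤ) ≤ m' by positivity) (by exact_mod_cast (h.le.trans h'))
    exact N1 (pgO_lt σ.2) l.2 a.1 (by unfold yO; have : (m':ℤ) < m := by exact_mod_cast h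
                                      linarith) b.2 hz he
  x l l' m z h hz he := by
    have c := N3_cyc hK σ.2 l.2 l'.2 (show (0:ℤ) ≤ m by positivity) (by exact_mod_cast h)
    exact cyc4w_pos hz.le c.1 he (.inl ⟨hz, c.2⟩)
  xL l l' m z h hz he := by
    have c := N3_cyc hK σ.2 l.2 l'.2 (show (0:ℤ) ≤ m by positivity) (by exact_mod_cast h)
    exact cyc4w_nonneg hz c.1 he
  xT l l' m z h hz he := by
    have c := N3_cyc hK σ.2 l'.2 l.2 (show (0:ℤ) ≤ m by positivity) (by exact_mod_cast h)
    refine cyc4w_nonneg hz ?_ he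
    rcases c.1 with c | c | c | c
    · exact .inr (.inr (.inl c))
    · exact .inr (.inr (.inr c))
    · exact .inl c
    · exact .inr (.inl c)

end
end FatS
end

section
open Metric Set Topology
namespace FatS

def nxt (M q : ℕ) : ℤ := if q + 1 < M then (q : ℤ) else -1
def arcC (M q : ℕ) : Set (E 2) :=
  if q + 1 < M then pt '' Icc ((q : ℝ) - 1) q else (fun b => cp 1 b) '' Icc (-1 : ℝ) (1 / ((M : ℝ) - 2))
def arcO (M q : ℕ) : Set (E 2) :=
  if q + 1 < M then pt '' Ioo ((q : ℝ) - 1) q else (fun b => cp 1 b) '' Ioo (-1 : ℝ) (1 / ((M : ℝ) - 2))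

section
variable {M : ℕ}

lemma cp_scale {a b r : ℝ} (hr : r ≠ 0) (h : 0 < a ^ 2 + b ^ 2) : cp (r * a) (r * b) = cp a b := by
  have h' : 0 < (r * a) ^ 2 + (r * b) ^ 2 := by
    have : (r * a) ^ 2 + (r * b) ^ 2 = r ^ 2 * (a ^ 2 + b ^ 2) := by ring
    rw [this]; positivity
  apply z_ext
  · rw [cp_A h, cp_A h', div_eq_div_iff h'.ne' h.ne']; ring
  · rw [cp_B, cp_B, div_eq_div_iff h'.ne' h.ne']; ring

lemma one_pos' (b : ℝ) : 0 < (1:ℝ) ^ 2 + b ^ 2 := by positivity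

lemma cp1_inj {b b' : ℝ} (h : cp 1 b = cp 1 b') : b = b' := by
  have h1 := congrArg cC h; have h2 := congrArg cB h
  rw [cp_C (one_pos' b), cp_C (one_pos' b')] at h1
  rw [cp_B, cp_B] at h2
  have p := one_pos' b; have q := one_pos' b'
  rw [div_eq_div_iff p.ne' q.ne'] at h1 h2
  have : (1:ℝ) ^ 2 + b' ^ 2 = 1 ^ 2 + b ^ 2 := by linarith
  rw [this] at h2
  have := mul_right_cancel₀ p.ne' h2
  linarith

lemma arc_cell (hM : 4 ≤ M) (q : ℕ) : IsCell 1 (arcC M q) (arcO M q) := by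
  have hM' : (4:ℝ) ≤ M := by exact_mod_cast hM
  unfold arcC arcO
  split_ifs
  · refine (IsCell.of_Icc (show (q:ℝ) - 1 < q by linarith)).map ?_ ?_
    · apply Continuous.continuousOn
      unfold pt cp
      have : ∀ τ : ℝ, τ ^ 2 + 1 ^ 2 ≠ 0 := fun τ => (pt_pos τ).ne'
      refine (PiLp.continuous_toLp 2 _).comp (continuous_pi fun i => ?_)
      fin_cases i
      · simp; fun_prop (disch := intro x; positivity)
      · simp; fun_prop (disch := intro x; positivity)
    · intro x _ y _ h; exact pt_inj h
  · refine (IsCell.of_Icc (show (-1:ℝ) < 1 / ((M:ℝ) - 2) by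
      have : 0 < 1 / ((M:ℝ) - 2) := by apply one_div_pos.2; linarith
      linarith)).map ?_ ?_
    · apply Continuous.continuousOn
      unfold cp
      refine (PiLp.continuous_toLp 2 _).comp (continuous_pi fun i => ?_)
      fin_cases i
      · simp; fun_prop (disch := intro x; positivity)
      · simp; fun_prop (disch := intro x; positivity)
    · intro x _ y _ h; exact cp1_inj h

lemma arc_circle {q : ℕ} {z : E 2} (h : z ∈ arcC M q) : nsq z = 1 := by
  unfold arcC at h
  split_ifs at h <;> obtain ⟨x, -, rfl⟩ := h
  · exact cp_nsq (pt_pos x)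
  · exact cp_nsq (one_pos' x)

lemma arc_left (hM : 4 ≤ M) {q : ℕ} (hq : q < M) : pt ((q:ℝ) - 1) ∈ arcC M q := by
  unfold arcC
  have hM' : (4:ℝ) ≤ M := by exact_mod_cast hM
  split_ifs
  · exact ⟨_, ⟨le_rfl, by linarith⟩, rfl⟩
  · have : (q:ℝ) - 1 = M - 2 := by
      have : q + 1 = M := by omega
      rw [← this]; push_cast; ring
    have h2 : 0 < (M:ℝ) - 2 := by linarith
    refine ⟨1 / (M - 2), ⟨by linarith [one_div_pos.2 h2], le_rfl⟩, ?_⟩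
    rw [this]
    have := cp_scale (a := (M:ℝ) - 2) (b := 1) (one_div_pos.2 h2).ne' (pt_pos _)
    rw [mul_one, one_div_mul_cancel h2.ne'] at this
    exact this
lemma arc_right (hM : 4 ≤ M) {q : ℕ} : pt (nxt M q : ℝ) ∈ arcC M q := by
  unfold arcC nxt
  have hM' : (4:ℝ) ≤ M := by exact_mod_cast hM
  split_ifs
  · exact ⟨_, ⟨by push_cast; linarith, by push_cast; rfl⟩, rfl⟩
  · have h2 : 0 < (M:ℝ) - 2 := by linarith
    refine ⟨-1, ⟨le_rfl, by linarith [one_div_pos.2 h2]⟩, ?_⟩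
    have := cp_scale (a := (-1:ℝ)) (b := 1) (r := -1) (by norm_num) (pt_pos _)
    norm_num at this
    push_cast; exact this

lemma int_side (s : ℤ) (q : ℕ) : ((s:ℝ) ≤ (q:ℝ) - 1) ∨ ((q:ℝ) ≤ s) := by
  rcases le_or_gt (q:ℤ) s with h | h
  · right; exact_mod_cast h
  · left
    have : s ≤ (q:ℤ) - 1 := by omega
    exact_mod_cast this

/-- sign of a chord form on an arc -/
lemma arc_sign (hM : 4 ≤ M) (q : ℕ) {s t : ℤ} (hs : -1 ≤ s ∧ s ≤ M - 2) (ht : -1 ≤ t ∧ t ≤ M - 2) (hst : s ≠ t) :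
    ((∀ z ∈ arcO M q, 0 < ell s t z) ∧ ∀ z ∈ arcC M q, 0 ≤ ell s t z) ∨
    ((∀ z ∈ arcO M q, ell s t z < 0) ∧ ∀ z ∈ arcC M q, ell s t z ≤ 0) := by
  wlog h : s < t generalizing s t
  · have := this ht hs hst.symm (by omega)
    rcases this with ⟨a, b⟩ | ⟨a, b⟩
    · right; exact ⟨fun z hz => by rw [ell_swap]; linarith [a z hz], fun z hz => by rw [ell_swap]; linarith [b z hz]⟩
    · left; exact ⟨fun z hz => by rw [ell_swap]; linarith [a z hz], fun z hz => by rw [ell_swap]; linarith [b z hz]⟩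
  have h' : (0:ℝ) < (t:ℝ) - s := by have : (s:ℝ) < t := by exact_mod_cast h
                                    linarith
  have hM' : (4:ℝ) ≤ M := by exact_mod_cast hM
  unfold arcC arcO
  split_ifs
  · rcases int_side s q with h1 | h1
    · rcases int_side t q with h2 | h2
      · left; constructor
        · rintro _ ⟨x, hx, rfl⟩; rw [ell_pt]
          exact div_pos (mul_pos (mul_pos h' (by linarith [hx.1])) (by linarith [hx.1])) (by positivity)
        · rintro _ ⟨x, hx, rfl⟩; rw [ell_pt]
          exact div_nonneg (mul_nonneg (mul_nonneg h'.le (by linarith [hx.1])) (by linarith [hx.1])) (by positivity)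
      · right; constructor
        · rintro _ ⟨x, hx, rfl⟩; rw [ell_pt]
          exact div_neg_of_neg_of_pos (mul_neg_of_pos_of_neg (mul_pos h' (by linarith [hx.1])) (by linarith [hx.2])) (by positivity)
        · rintro _ ⟨x, hx, rfl⟩; rw [ell_pt]
          exact div_nonpos_of_nonpos_of_nonneg (mul_nonpos_of_nonneg_of_nonpos (mul_nonneg h'.le (by linarith [hx.1])) (by linarith [hx.2])) (by positivity)
    · have h2 : (q:ℝ) ≤ t := by linarith
      left; constructor
      · rintro _ ⟨x, hx, rfl⟩; rw [ell_pt]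
        exact div_pos (mul_pos_of_neg_of_neg (mul_neg_of_pos_of_neg h' (by linarith [hx.2])) (by linarith [hx.2])) (by positivity)
      · rintro _ ⟨x, hx, rfl⟩; rw [ell_pt]
        exact div_nonneg (mul_nonneg_of_nonpos_of_nonpos (mul_nonpos_of_nonneg_of_nonpos h'.le (by linarith [hx.2])) (by linarith [hx.2])) (by positivity)
  · have h2 : 0 < (M:ℝ) - 2 := by linarith
    have key : ∀ r : ℤ, (-1 ≤ r ∧ r ≤ M - 2) → ∀ b ∈ Icc (-1:ℝ) (1 / ((M:ℝ) - 2)), 0 ≤ 1 - r * b := by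
      intro r hr b hb
      have r1 : (-1:ℝ) ≤ r := by exact_mod_cast hr.1
      have r2 : (r:ℝ) ≤ M - 2 := by exact_mod_cast hr.2
      have := (le_div_iff₀ h2).1 hb.2
      rcases le_or_gt 0 b with hb0 | hb0 <;> nlinarith [hb.1]
    have key' : ∀ r : ℤ, (-1 ≤ r ∧ r ≤ M - 2) → ∀ b ∈ Ioo (-1:ℝ) (1 / ((M:ℝ) - 2)), 0 < 1 - r * b := by
      intro r hr b hb
      have r1 : (-1:ℝ) ≤ r := by exact_mod_cast hr.1
      have r2 : (r:ℝ) ≤ M - 2 := by exact_mod_cast hr.2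
      have := (lt_div_iff₀ h2).1 hb.2
      rcases le_or_gt 0 b with hb0 | hb0 <;> nlinarith [hb.1]
    left; constructor
    · rintro _ ⟨b, hb, rfl⟩
      show 0 < ell s t (cp 1 b)
      rw [ell_cp (one_pos' b)]
      exact div_pos (mul_pos (mul_pos h' (key' s hs b hb)) (key' t ht b hb)) (one_pos' b)
    · rintro _ ⟨b, hb, rfl⟩
      show 0 ≤ ell s t (cp 1 b)
      rw [ell_cp (one_pos' b)]
      exact div_nonneg (mul_nonneg (mul_nonneg h'.le (key s hs b hb)) (key t ht b hb)) (one_pos' b).le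

lemma nxt_range (hM : 4 ≤ M) {q : ℕ} : -1 ≤ nxt M q ∧ nxt M q ≤ M - 2 := by
  unfold nxt; split_ifs <;> omega
lemma nxt_ne (hM : 4 ≤ M) {q : ℕ} (hq : q < M) : (q : ℤ) - 1 ≠ nxt M q := by
  unfold nxt; split_ifs <;> omega

lemma own_node (hM : 4 ≤ M) {q : ℕ} (hq : q < M) {p : ℤ} (hp : -1 ≤ p ∧ p ≤ M - 2) :
    0 ≤ ell ((q:ℤ) - 1 : ℤ) (nxt M q) (pt p) := by
  rw [ell_pt]
  apply div_nonneg _ (by positivity)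
  unfold nxt
  split_ifs with h
  · have e : (((q:ℤ):ℝ) - (((q:ℤ) - 1 : ℤ):ℝ)) = 1 := by push_cast; ring
    rw [e, one_mul]
    rcases le_or_gt (q:ℤ) p with h | h
    · apply mul_nonneg
      · have : (((q:ℤ) - 1 : ℤ):ℝ) ≤ p := by exact_mod_cast (by omega : (q:ℤ) - 1 ≤ p)
        linarith
      · have : ((q:ℤ):ℝ) ≤ p := by exact_mod_cast h
        linarith
    · apply mul_nonneg_of_nonpos_of_nonpos
      · have : (p:ℝ) ≤ (((q:ℤ) - 1 : ℤ):ℝ) := by exact_mod_cast (by omega : p ≤ (q:ℤ) - 1)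
        linarith
      · have : (p:ℝ) ≤ ((q:ℤ):ℝ) := by exact_mod_cast h.le
        linarith
  · have hq' : (q:ℤ) - 1 = M - 2 := by omega
    rw [hq']
    have h4 : (4:ℤ) ≤ M := by exact_mod_cast hM
    have : (0:ℤ) ≤ (-1 - ((M:ℤ) - 2)) * (p - (M - 2)) * (p - -1) := by
      apply mul_nonneg (mul_nonneg_of_nonpos_of_nonpos (by linarith) (by linarith [hp.2])) (by linarith [hp.1])
    exact_mod_cast this

lemma arcO_sub {q : ℕ} : arcO M q ⊆ arcC M q := by
  unfold arcO arcC; split_ifs <;> exact image_mono Ioo_subset_Icc_self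

lemma own_arc (hM : 4 ≤ M) {q : ℕ} (hq : q < M) :
    ∀ z ∈ arcO M q, ell ((q:ℤ) - 1 : ℤ) (nxt M q) z < 0 := by
  rcases arc_sign hM q (s := (q:ℤ) - 1) (t := nxt M q) (by omega) (nxt_range hM) (nxt_ne hM hq) with h | h
  · exfalso
    unfold arcO nxt at h
    split_ifs at h with h1
    · have := h.1 _ ⟨(q:ℝ) - 1/2, ⟨by linarith, by linarith⟩, rfl⟩
      have hs : ell (((q:ℤ) - 1 : ℤ):ℝ) ((q:ℤ):ℝ) (pt ((q:ℝ) - 1/2)) < 0 :=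
        (ell_pt_sign (by push_cast; linarith)).1 ⟨by push_cast; linarith, by push_cast; linarith⟩
      linarith
    · have hM' : (4:ℝ) ≤ M := by exact_mod_cast hM
      have h2 : 0 < (M:ℝ) - 2 := by linarith
      have := h.1 _ ⟨0, ⟨by linarith, one_div_pos.2 h2⟩, rfl⟩
      simp only at this
      rw [ell_cp (one_pos' 0)] at this
      have hq' : (q:ℤ) - 1 = M - 2 := by omega
      rw [hq'] at this
      push_cast at this
      norm_num at this
      linarith
  · exact h.1

lemma own_arc' (hM : 4 ≤ M) {q q' : ℕ} (hq : q < M) (hq' : q' < M) (hne : q ≠ q') :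
    ∀ z ∈ arcC M q', 0 ≤ ell ((q:ℤ) - 1 : ℤ) (nxt M q) z := by
  rcases arc_sign hM q' (s := (q:ℤ) - 1) (t := nxt M q) (by omega) (nxt_range hM) (nxt_ne hM hq) with h | h
  · exact h.2
  · exfalso
    have h1 := h.2 _ (arc_left hM hq')
    have h2 := h.2 _ (arc_right hM)
    have c1 : pt ((q':ℝ) - 1) = pt (((q':ℤ) - 1 : ℤ):ℝ) := by push_cast; rfl
    rw [c1] at h1
    have a1 := le_antisymm h1 (own_node hM hq (by omega))
    have a2 := le_antisymm h2 (own_node hM hq (nxt_range hM))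
    have hne' : (((q:ℤ) - 1 : ℤ):ℝ) ≠ (nxt M q : ℝ) := by exact_mod_cast nxt_ne hM hq
    have b1 : (q':ℤ) - 1 = (q:ℤ) - 1 ∨ (q':ℤ) - 1 = nxt M q := by
      rcases ell_zero_circle hne' (cp_nsq (pt_pos _)) a1 with e | e
      · left; exact_mod_cast pt_inj e
      · right; exact_mod_cast pt_inj e
    have b2 : nxt M q' = (q:ℤ) - 1 ∨ nxt M q' = nxt M q := by
      rcases ell_zero_circle hne' (cp_nsq (pt_pos _)) a2 with e | e
      · left; exact_mod_cast pt_inj e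
      · right; exact_mod_cast pt_inj e
    unfold nxt at b1 b2
    by_cases c1 : q + 1 < M <;> by_cases c2 : q' + 1 < M <;>
      simp only [c1, c2, if_true, if_false] at b1 b2 <;> omega

lemma arc_disj (hM : 4 ≤ M) {q q' : ℕ} (hq : q < M) (hq' : q' < M) {z : E 2} (h : z ∈ arcO M q) (h' : z ∈ arcC M q') :
    q = q' := by
  by_contra hne
  linarith [own_arc hM hq z h, own_arc' hM hq hq' hne z h']

lemma arc_node (hM : 4 ≤ M) {q : ℕ} (hq : q < M) {p : ℤ} (hp : -1 ≤ p ∧ p ≤ M - 2) (h : pt (p:ℝ) ∈ arcC M q) :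
    p = (q:ℤ) - 1 ∨ p = nxt M q := by
  rcases arc_sign hM q (s := (q:ℤ) - 1) (t := nxt M q) (by omega) (nxt_range hM) (nxt_ne hM hq) with g | g
  · obtain ⟨z, hz⟩ := (arc_cell hM q).ne
    linarith [own_arc hM hq z hz, g.1 z hz]
  · have a1 := le_antisymm (g.2 _ h) (own_node hM hq hp)
    have hne' : (((q:ℤ) - 1 : ℤ):ℝ) ≠ (nxt M q : ℝ) := by exact_mod_cast nxt_ne hM hq
    rcases ell_zero_circle hne' (cp_nsq (pt_pos _)) a1 with e | e
    · left; exact_mod_cast pt_inj e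
    · right; exact_mod_cast pt_inj e

lemma arcO_node (hM : 4 ≤ M) {q : ℕ} (hq : q < M) {p : ℤ} (hp : -1 ≤ p ∧ p ≤ M - 2) : pt (p:ℝ) ∉ arcO M q := by
  intro h
  linarith [own_arc hM hq _ h, own_node hM hq hp]

lemma circle_cover (hM : 4 ≤ M) {z : E 2} (hz : nsq z = 1) : ∃ q < M, z = pt ((q:ℝ) - 1) ∨ z ∈ arcO M q := by
  have hM' : (4:ℝ) ≤ M := by exact_mod_cast hM
  have h2 : 0 < (M:ℝ) - 2 := by linarith
  have hd := cdet z
  rw [hz] at hd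
  have hAC := cAC z
  have wrap : ∀ b ∈ Ioo (-1:ℝ) (1 / ((M:ℝ) - 2)), z = cp 1 b → ∃ q < M, z = pt ((q:ℝ) - 1) ∨ z ∈ arcO M q := by
    intro b hb e
    refine ⟨M - 1, by omega, .inr ?_⟩
    unfold arcO
    rw [if_neg (by omega)]
    exact ⟨b, hb, e.symm⟩
  rcases (cA_nonneg hz.le).eq_or_lt with hA | hA
  · have hC : cC z = 1 := by linarith
    have hB : cB z = 0 := by rw [← hA] at hd; nlinarith
    apply wrap 0 ⟨by norm_num, one_div_pos.2 h2⟩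
    have := circle_pt' hz (by rw [hC]; norm_num)
    rwa [hB, zero_div] at this
  · have e := circle_pt hz hA
    set τ := cB z / cA z with hτ
    have wrap' : τ ≠ 0 → 1 / τ ∈ Ioo (-1:ℝ) (1 / ((M:ℝ) - 2)) → ∃ q < M, z = pt ((q:ℝ) - 1) ∨ z ∈ arcO M q := by
      intro h0 hb
      apply wrap _ hb
      rw [e]
      have := cp_scale (a := τ) (b := 1) (r := 1 / τ) (one_div_ne_zero h0) (pt_pos _)
      rw [mul_one, one_div_mul_cancel h0] at this
      exact this.symm
    rcases lt_or_ge τ (-1) with h1 | h1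
    · apply wrap' (by linarith)
      constructor
      · rw [lt_div_iff_of_neg (by linarith)]; linarith
      · have : 1 / τ < 0 := one_div_neg.2 (by linarith)
        linarith [one_div_pos.2 h2]
    rcases lt_or_ge ((M:ℝ) - 2) τ with h3 | h3
    · apply wrap' (by linarith)
      constructor
      · have : 0 < 1 / τ := one_div_pos.2 (by linarith)
        linarith
      · exact one_div_lt_one_div_of_lt h2 h3
    have hf := Nat.floor_le (show 0 ≤ τ + 1 by linarith)
    have hf' := Nat.lt_floor_add_one (τ + 1)
    have hlt : ⌊τ + 1⌋₊ < M := by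
      rw [Nat.floor_lt (by linarith)]; linarith
    refine ⟨⌊τ + 1⌋₊, hlt, ?_⟩
    rcases hf.eq_or_lt with g | g
    · left; rw [e]; congr 1; linarith
    · right
      have : ⌊τ + 1⌋₊ + 1 < M := by
        have : ((⌊τ + 1⌋₊ : ℕ) : ℝ) < (M - 1 : ℕ) := by
          rw [Nat.cast_sub (by omega)]; push_cast; linarith
        have : ⌊τ + 1⌋₊ < M - 1 := by exact_mod_cast this
        omega
      unfold arcO; rw [if_pos this]
      exact ⟨τ, ⟨by linarith, by linarith⟩, e.symm⟩

/-- if both ends satisfy a non-adjacent chord inequality then so does the arc -/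
lemma arc_ends (hM : 4 ≤ M) {q : ℕ} (hq : q < M) {s t : ℤ} (hs : -1 ≤ s ∧ s ≤ M - 2) (ht : -1 ≤ t ∧ t ≤ M - 2) (hst : s ≠ t)
    (hadj : ¬ ((s = (q:ℤ) - 1 ∧ t = nxt M q) ∨ (t = (q:ℤ) - 1 ∧ s = nxt M q)))
    (h1 : 0 ≤ ell s t (pt (((q:ℤ) - 1 : ℤ) : ℝ))) (h2 : 0 ≤ ell s t (pt (nxt M q : ℝ))) : ∀ z ∈ arcC M q, 0 ≤ ell s t z := by
  rcases arc_sign hM q hs ht hst with g | g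
  · exact g.2
  · exfalso
    have l := arc_left hM hq
    rw [show ((q:ℝ) - 1) = (((q:ℤ) - 1 : ℤ) : ℝ) by push_cast; rfl] at l
    have a1 := le_antisymm (g.2 _ l) h1
    have a2 := le_antisymm (g.2 _ (arc_right hM)) h2
    have hne' : (s:ℝ) ≠ t := by exact_mod_cast hst
    have b1 : (q:ℤ) - 1 = s ∨ (q:ℤ) - 1 = t := by
      rcases ell_zero_circle hne' (cp_nsq (pt_pos _)) a1 with e | e
      · left; exact_mod_cast pt_inj e
      · right; exact_mod_cast pt_inj e
    have b2 : nxt M q = s ∨ nxt M q = t := by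
      rcases ell_zero_circle hne' (cp_nsq (pt_pos _)) a2 with e | e
      · left; exact_mod_cast pt_inj e
      · right; exact_mod_cast pt_inj e
    have := nxt_ne hM hq
    omega

end
end FatS
end

section
open Metric Set Topology
namespace FatS

abbrev Code (K : ℕ) : Type := Option (Fin K × Fin (2 * pY K + 2))
def sg {K : ℕ} (a : Code K) (l' : Fin K) (y' : ℕ) : ℤ :=
  match a with
  | none => 1
  | some (l, r) => if l' = l then (r : ℕ) - (2 * (y' : ℤ) + 1) else 1
def pdim {K : ℕ} (a : Code K) : ℕ :=
  match a with
  | none => 2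
  | some (_, r) => 2 - (r : ℕ) % 2
def pZ (K : ℕ) (π : ℕ) (a : Code K) : Set (E 2) :=
  {z | nsq z ≤ 1 ∧ ∀ (l' : Fin K) (y' : ℕ), y' ≤ pY K →
    (0 ≤ sg a l' y' → 0 ≤ ee K π l' y' z) ∧ (sg a l' y' ≤ 0 → ee K π l' y' z ≤ 0)}
def pZo (K : ℕ) (π : ℕ) (a : Code K) : Set (E 2) :=
  {z | nsq z < 1 ∧ ∀ (l' : Fin K) (y' : ℕ), y' ≤ pY K →
    (0 < sg a l' y' → 0 < ee K π l' y' z) ∧ (sg a l' y' < 0 → ee K π l' y' z < 0) ∧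
    (sg a l' y' = 0 → ee K π l' y' z = 0)}
def yo (K π i : ℕ) (n : ℤ) : ℤ := dev K π i 0 n

section
variable {K : ℕ}

lemma pM_ge (hK : 2 ≤ K) : 4 ≤ pM K := by
  unfold pM pT
  nlinarith [Nat.zero_le (pH K + 2 * pU K)]

lemma dev_yo (π i : ℕ) (y n : ℤ) : dev K π i y n = yo K π i n - y := by
  unfold yo dev hgt; split_ifs <;> ring
lemma yo_hgt (π i : ℕ) (y : ℤ) : yo K π i (hgt K π i y) = y := by
  unfold yo dev hgt; split_ifs <;> ring
lemma hgt_yo (π i : ℕ) (n : ℤ) : hgt K π i (yo K π i n) = n := by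
  unfold yo dev hgt; split_ifs <;> ring

lemma y_rng {y : ℕ} (h : y ≤ pY K) : (0:ℤ) ≤ y ∧ (y:ℤ) ≤ pY K := ⟨by positivity, by exact_mod_cast h⟩

/-- sign lemma at nodes -/
lemma node_sign {π i : ℕ} {l : Fin K} (hπ : π < 2 * K) (hi : i < 2 * K) {y : ℕ} (hy : y ≤ pY K) {n : ℤ}
    (n0 : 0 ≤ n) (n1 : n ≤ pT K) (hin : inP K π l i) :
    (0 ≤ ee K π l y (pt (posn K i n)) ↔ (y:ℤ) ≤ yo K π i n) ∧
    (ee K π l y (pt (posn K i n)) ≤ 0 ↔ yo K π i n ≤ y) := by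
  have h := N4_in hπ l.2 hi (y_rng hy).1 (y_rng hy).2 n0 n1 hin
  rw [dev_yo] at h
  rcases lt_trichotomy (yo K π i n) y with c | c | c
  · have := h.2.1 (by linarith)
    constructor <;> constructor <;> intro <;> linarith
  · have := h.2.2 (by linarith)
    constructor <;> constructor <;> intro <;> linarith
  · have := h.1 (by linarith)
    constructor <;> constructor <;> intro <;> linarith

lemma inP_uniq {π i l l' : ℕ} (h : inP K π l i) (h' : inP K π l' i) : l = l' := by
  unfold inP at h h'; split_ifs at h h' <;> omega

lemma inP_exists (π : ℕ) {i : ℕ} (hi : i < 2 * K) : ∃ l : Fin K, inP K π l i := by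
  unfold inP
  split_ifs
  · exact ⟨⟨i / 2, by omega⟩, rfl⟩
  · exact ⟨⟨hh K i, hh_lt hi⟩, rfl⟩

lemma r_half (r : Fin (2 * pY K + 2)) : (r:ℕ) / 2 ≤ pY K := by have := r.2; omega
lemma r_half' (r : Fin (2 * pY K + 2)) : ((r:ℕ) - 1) / 2 ≤ pY K := by have := r.2; omega

/-- vertices of page cells -/
lemma page_V {π i : ℕ} (hπ : π < 2 * K) (hi : i < 2 * K) {l : Fin K} {r : Fin (2 * pY K + 2)} {n : ℤ}
    (n0 : 0 ≤ n) (n1 : n ≤ pT K) :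
    pt (posn K i n) ∈ pZ K π (some (l, r)) ↔
      inP K π l i ∧ ((0 < (r:ℕ)) → ((((r:ℕ) - 1) / 2 : ℕ) : ℤ) ≤ yo K π i n) ∧ yo K π i n ≤ (((r:ℕ) / 2 : ℕ) : ℤ) := by
  constructor
  · rintro ⟨-, h⟩
    have e1 : ee K π l ((r:ℕ) / 2 : ℕ) (pt (posn K i n)) ≤ 0 := (h l ((r:ℕ)/2) (r_half r)).2 (by simp [sg]; omega)
    have hin : inP K π l i := by
      by_contra hc
      have := N4_out hπ l.2 hi (y_rng (r_half r)).1 (y_rng (r_half r)).2 n0 n1 hc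
      linarith
    refine ⟨hin, ?_, (node_sign hπ hi (r_half r) n0 n1 hin).2.1 e1⟩
    intro hr
    exact (node_sign hπ hi (r_half' r) n0 n1 hin).1.1 ((h l (((r:ℕ) - 1)/2) (r_half' r)).1 (by simp [sg]; omega))
  · rintro ⟨hin, h1, h2⟩
    refine ⟨(cp_nsq (pt_pos _)).le, fun l' y' hy' => ?_⟩
    by_cases hl : l' = l
    · subst hl
      have s := node_sign hπ hi hy' n0 n1 hin
      simp only [sg, if_true]
      rw [s.1, s.2]
      constructor
      · intro h
        have := h1 (by omega)
        omega
      · intro h; omega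
    · have hc : ¬ inP K π l' i := fun h => hl (Fin.ext (inP_uniq h hin))
      have := N4_out hπ l'.2 hi (y_rng hy').1 (y_rng hy').2 n0 n1 hc
      simp only [sg, hl, if_false]
      exact ⟨fun _ => this.le, fun h => absurd h (by norm_num)⟩

lemma none_V {π i : ℕ} (hπ : π < 2 * K) (hi : i < 2 * K) {n : ℤ}
    (n0 : 0 ≤ n) (n1 : n ≤ pT K) (h : (pY K : ℤ) ≤ yo K π i n) :
    pt (posn K i n) ∈ pZ K π none := by
  refine ⟨(cp_nsq (pt_pos _)).le, fun l' y' hy' => ?_⟩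
  refine ⟨fun _ => ?_, fun h => absurd h (by simp [sg])⟩
  by_cases hin : inP K π l' i
  · rw [(node_sign hπ hi hy' n0 n1 hin).1]; linarith [(y_rng hy').2]
  · exact (N4_out hπ l'.2 hi (y_rng hy').1 (y_rng hy').2 n0 n1 hin).le

lemma pZo_sign {π : ℕ} {a : Code K} {z : E 2} (h : z ∈ pZo K π a) {l : Fin K} {y : ℕ} (hy : y ≤ pY K) :
    (0 ≤ ee K π l y z ↔ 0 ≤ sg a l y) ∧ (ee K π l y z ≤ 0 ↔ sg a l y ≤ 0) := by
  have := h.2 l y hy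
  rcases lt_trichotomy (sg a l y) 0 with c | c | c
  · have := this.2.1 c; constructor <;> constructor <;> intro <;> first | linarith | omega
  · have := this.2.2 c; constructor <;> constructor <;> intro <;> first | linarith | omega
  · have := this.1 c; constructor <;> constructor <;> intro <;> first | linarith | omega

def compat (a b : Code K) : Prop := ∀ (l : Fin K) (y : ℕ), y ≤ pY K → (0 ≤ sg b l y → 0 ≤ sg a l y) ∧ (sg b l y ≤ 0 → sg a l y ≤ 0)

lemma compat_sub {π : ℕ} {a b : Code K} (h : compat a b) : pZ K π a ⊆ pZ K π b := fun z hz =>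
  ⟨hz.1, fun l y hy => ⟨fun s => (hz.2 l y hy).1 ((h l y hy).1 s), fun s => (hz.2 l y hy).2 ((h l y hy).2 s)⟩⟩

lemma page_compat {π : ℕ} {a b : Code K} {z : E 2} (ha : z ∈ pZo K π a) (hb : z ∈ pZ K π b) : compat a b :=
  fun l y hy => ⟨fun s => (pZo_sign ha hy).1.1 ((hb.2 l y hy).1 s), fun s => (pZo_sign ha hy).2.1 ((hb.2 l y hy).2 s)⟩

lemma sg_zero {a : Code K} {l : Fin K} {y : ℕ} (h : sg a l y = 0) : ∃ r : Fin (2 * pY K + 2), a = some (l, r) ∧ (r:ℕ) = 2 * y + 1 := by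
  match a, h with
  | some (l', r), h =>
    simp only [sg] at h
    split_ifs at h with e
    · subst e; exact ⟨r, rfl, by omega⟩
    · omega

lemma sg_neg {a : Code K} {l : Fin K} {y : ℕ} (h : sg a l y ≤ 0) : ∃ r : Fin (2 * pY K + 2), a = some (l, r) ∧ (r:ℕ) ≤ 2 * y + 1 := by
  match a, h with
  | some (l', r), h =>
    simp only [sg] at h
    split_ifs at h with e
    · subst e; exact ⟨r, rfl, by omega⟩
    · omega

lemma compat_dim {a b : Code K} (h : compat a b) (hne : a ≠ b) : pdim a < pdim b := by
  match a, b, h, hne with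
  | none, none, h, hne => exact absurd rfl hne
  | none, some (l, r), h, hne =>
    have := (h l ((r:ℕ)/2) (r_half r)).2 (by simp [sg]; omega)
    simp [sg] at this
  | some (l, r), none, h, hne =>
    have := (h l ((r:ℕ)/2) (r_half r)).1 (by simp [sg])
    simp only [pdim]
    simp [sg] at this; omega
  | some (l, r), some (l', r'), h, hne =>
    have h1 := (h l' ((r':ℕ)/2) (r_half r')).2 (by simp [sg]; omega)
    obtain ⟨r2, e, h2⟩ := sg_neg h1
    simp only [Option.some.injEq, Prod.mk.injEq] at e
    obtain ⟨rfl, rfl⟩ := e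
    have hrne : (r:ℕ) ≠ r' := fun e => hne (by rw [Fin.ext e])
    have h3 := (h l (((r':ℕ)-1)/2) (r_half' r')).1
    have h4 := (h l ((r':ℕ)/2) (r_half r'))
    simp only [pdim]
    simp only [sg, if_true] at h3 h4
    omega

lemma pdim_le {a : Code K} : pdim a ≤ 2 ∧ 1 ≤ pdim a := by
  match a with
  | none => simp [pdim]
  | some (l, r) => simp only [pdim]; omega

lemma page_cover {π : ℕ} (hπ : π < 2 * K) {z : E 2} (hz : nsq z < 1) : ∃ a : Code K, z ∈ pZo K π a := by
  by_cases h : ∃ y, y ≤ pY K ∧ ∃ l : Fin K, ee K π l y z ≤ 0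
  · classical
    obtain ⟨hy, l, hl⟩ := Nat.find_spec h
    have hmin := fun m => Nat.find_min (m := m) h
    set y := Nat.find h with hyd
    have hout : ∀ l' : Fin K, l' ≠ l → ∀ y', y' ≤ pY K → 0 < ee K π l' y' z := fun l' hne y' hy' =>
      N2 hπ l.2 l'.2 (fun e => hne (Fin.ext e.symm)) (y_rng hy).1 (y_rng hy).2 (y_rng hy').1 (y_rng hy').2 hz.le hl
    have hbig : ∀ y', y < y' → y' ≤ pY K → ee K π l y' z < 0 := fun y' h1 h2 =>
      N1 hπ l.2 (y_rng hy).1 (by exact_mod_cast h1) (y_rng h2).2 hz.le hl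
    have hsm : ∀ y', y' < y → 0 < ee K π l y' z := fun y' h1 => by
      by_contra hc
      exact hmin y' h1 ⟨by omega, l, not_lt.1 hc⟩
    rcases hl.eq_or_lt with e | e
    · refine ⟨some (l, ⟨2 * y + 1, by omega⟩), hz, fun l' y' hy' => ?_⟩
      by_cases hll : l' = l
      · subst hll
        simp only [sg, if_true]
        push_cast
        refine ⟨fun h => hsm y' (by omega), fun h => hbig y' (by omega) hy', fun h => ?_⟩
        have : y' = y := by omega
        rw [this]; exact e
      · simp only [sg, hll, if_false]
        exact ⟨fun _ => hout l' hll y' hy', fun h => absurd h (by norm_num), fun h => absurd h (by norm_num)⟩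
    · refine ⟨some (l, ⟨2 * y, by omega⟩), hz, fun l' y' hy' => ?_⟩
      by_cases hll : l' = l
      · subst hll
        simp only [sg, if_true]
        push_cast
        refine ⟨fun h => hsm y' (by omega), fun h => ?_, fun h => absurd h (by omega)⟩
        rcases Nat.lt_or_ge y y' with g | g
        · exact hbig y' g hy'
        · have : y' = y := by omega
          rw [this]; exact e
      · simp only [sg, hll, if_false]
        exact ⟨fun _ => hout l' hll y' hy', fun h => absurd h (by norm_num), fun h => absurd h (by norm_num)⟩
  · push Not at h
    exact ⟨none, hz, fun l y hy => ⟨fun _ => h y hy l, fun h => absurd h (by simp [sg]), fun h => absurd h (by simp [sg])⟩⟩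

lemma hgt_range' {π i : ℕ} (hπ : π < 2 * K) (hi : i < 2 * K) {y : ℤ} (h0 : -1 ≤ y) (h1 : y ≤ pY K) :
    0 ≤ hgt K π i y ∧ hgt K π i y ≤ pT K := by
  have a1 := fE_nonneg (K := K) π i; have a2 := gO_nonneg (K := K) π i
  have b1 := fE_le hπ hi; have b2 := gO_le hπ hi
  have e1 : (pY K : ℤ) = pH K + pU K := by unfold pY; push_cast; rfl
  have e2 : (pT K : ℤ) = pH K + 2 * pU K + 2 := by unfold pT; push_cast; rfl
  unfold hgt
  split_ifs <;> constructor <;> linarith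

lemma pt_posn_ne {i j : ℕ} {n n' : ℤ} (h0 : 0 ≤ n) (h1 : n ≤ pT K) (h0' : 0 ≤ n')
    (h1' : n' ≤ pT K) (h : i ≠ j ∨ n ≠ n') : pt (posn K i n) ≠ pt (posn K j n') := by
  intro e
  have e' : posn K i n = posn K j n' := by exact_mod_cast pt_inj e
  have := posn_inj h0 h1 h0' h1' e'
  tauto

lemma iL_ne_iR (hK : 2 ≤ K) {π l : ℕ} (hl : l < K) : iL K π l ≠ iR π l := by
  rcases pair_cases (K := K) π hl with h | h | h <;> omega

lemma page_region_cell (hK : 2 ≤ K) {π : ℕ} (hπ : π < 2 * K) {a : Code K} (hs : ∀ l y, sg a l y ≠ 0)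
    {p₁ p₂ p₃ : E 2} (h1 : p₁ ∈ pZ K π a) (h2 : p₂ ∈ pZ K π a) (h3 : p₃ ∈ pZ K π a)
    (n1 : nsq p₁ = 1) (n2 : nsq p₂ = 1) (n3 : nsq p₃ = 1)
    (h12 : p₁ ≠ p₂) (h13 : p₁ ≠ p₃) (h23 : p₂ ≠ p₃) : IsCell 2 (pZ K π a) (pZo K π a) := by
  let f : Fin K × Fin (pY K + 1) → ℝ × ℝ := fun p =>
    if 0 < sg a p.1 p.2 then ((chS K π p.1 (p.2:ℕ) : ℝ), (chT K π p.1 (p.2:ℕ) : ℝ))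
    else ((chT K π p.1 (p.2:ℕ) : ℝ), (chS K π p.1 (p.2:ℕ) : ℝ))
  have e1 : pZ K π a = Rg (range f) := by
    ext z
    simp only [pZ, Rg, mem_setOf_eq, forall_mem_range]
    refine and_congr_right fun _ => ⟨fun h p => ?_, fun h l y hy => ?_⟩
    · have := h p.1 p.2 (Nat.lt_succ_iff.1 p.2.2)
      simp only [f]; split_ifs with c
      · exact this.1 c.le
      · rw [ell_swap]; have := this.2 (not_lt.1 c); unfold ee at this; linarith
    · have := h (l, ⟨y, Nat.lt_succ_of_le hy⟩)
      simp only [f] at this; split_ifs at this with c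
      · exact ⟨fun _ => this, fun h => absurd c (by omega)⟩
      · rw [ell_swap] at this
        have hne := hs l y
        refine ⟨fun h => absurd c (by omega), fun _ => ?_⟩
        unfold ee; linarith
  have e2 : pZo K π a = Rgo (range f) := by
    ext z
    simp only [pZo, Rgo, mem_setOf_eq, forall_mem_range]
    refine and_congr_right fun _ => ⟨fun h p => ?_, fun h l y hy => ?_⟩
    · have := h p.1 p.2 (Nat.lt_succ_iff.1 p.2.2)
      simp only [f]; split_ifs with c
      · exact this.1 c
      · rw [ell_swap]; have := this.2.1 (lt_of_le_of_ne (not_lt.1 c) (hs _ _)); unfold ee at this; linarith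
    · have := h (l, ⟨y, Nat.lt_succ_of_le hy⟩)
      simp only [f] at this; split_ifs at this with c
      · exact ⟨fun _ => this, fun h => absurd c (by omega), fun h => absurd h (hs l y)⟩
      · rw [ell_swap] at this
        refine ⟨fun h => absurd c (by omega), fun _ => ?_, fun h => absurd h (hs l y)⟩
        unfold ee; linarith
  rw [e1] at h1 h2 h3 ⊢
  rw [e2]
  refine rg_cell (finite_range f) ?_ h1 h2 h3 n1 n2 n3 h12 h13 h23
  rintro _ ⟨p, rfl⟩
  have hy := y_rng (Nat.lt_succ_iff.1 p.2.2)
  have := ch_ne hK hπ p.1.2 hy.1 hy.2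
  simp only [f]; split_ifs
  · show ((_ : ℤ) : ℝ) ≠ ((_ : ℤ) : ℝ)
    exact_mod_cast this
  · show ((_ : ℤ) : ℝ) ≠ ((_ : ℤ) : ℝ)
    exact_mod_cast this.symm

lemma page_cell (hK : 2 ≤ K) {π : ℕ} (hπ : π < 2 * K) (a : Code K) : IsCell (pdim a) (pZ K π a) (pZo K π a) := by
  match a with
  | none =>
    have R : ∀ i, i < 2 * K → _ := fun i hi => hgt_range' hπ hi (y := pY K) (by omega) le_rfl
    have V : ∀ i, (hi : i < 2 * K) → _ := fun i hi => none_V (n := hgt K π i (pY K)) hπ hi (R i hi).1 (R i hi).2 (by rw [yo_hgt])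
    exact page_region_cell hK hπ (by simp [sg]) (V 0 (by omega)) (V 1 (by omega)) (V 2 (by omega))
      (cp_nsq (pt_pos _)) (cp_nsq (pt_pos _)) (cp_nsq (pt_pos _))
      (pt_posn_ne (R 0 (by omega)).1 (R 0 (by omega)).2 (R 1 (by omega)).1 (R 1 (by omega)).2 (by simp))
      (pt_posn_ne (R 0 (by omega)).1 (R 0 (by omega)).2 (R 2 (by omega)).1 (R 2 (by omega)).2 (by simp))
      (pt_posn_ne (R 1 (by omega)).1 (R 1 (by omega)).2 (R 2 (by omega)).1 (R 2 (by omega)).2 (by simp))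
  | some (l, r) =>
    rcases Nat.mod_two_eq_zero_or_one (r:ℕ) with hr | hr
    · have hd : pdim (some (l, r) : Code K) = 2 := by simp [pdim, hr]
      rw [hd]
      have hr2 := r_half r
      set y : ℤ := (((r:ℕ) / 2 : ℕ) : ℤ) with hy
      have hyr := y_rng hr2
      have hL := iL_lt (π := π) l.2
      have hR := iR_lt (π := π) l.2
      have R1 := hgt_range' hπ hL (y := y) (by linarith) hyr.2
      have R2 := hgt_range' hπ hR (y := y) (by linarith) hyr.2
      have R3 := hgt_range' hπ hL (y := y - 1) (by linarith) (by linarith)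
      have hne := iL_ne_iR hK (π := π) l.2
      refine page_region_cell hK hπ (p₁ := pt (posn K (iL K π l) (hgt K π (iL K π l) y)))
        (p₂ := pt (posn K (iR π l) (hgt K π (iR π l) y)))
        (p₃ := pt (posn K (iL K π l) (hgt K π (iL K π l) (y - 1)))) ?_ ?_ ?_ ?_
        (cp_nsq (pt_pos _)) (cp_nsq (pt_pos _)) (cp_nsq (pt_pos _)) ?_ ?_ ?_
      · intro l' y'; simp only [sg]; split_ifs <;> omega
      · rw [page_V hπ hL R1.1 R1.2, yo_hgt]
        exact ⟨inP_iL l.2, fun _ => by omega, le_rfl⟩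
      · rw [page_V hπ hR R2.1 R2.2, yo_hgt]
        exact ⟨inP_iR l.2, fun _ => by omega, le_rfl⟩
      · rw [page_V hπ hL R3.1 R3.2, yo_hgt]
        exact ⟨inP_iL l.2, fun _ => by omega, by omega⟩
      · exact pt_posn_ne R1.1 R1.2 R2.1 R2.2 (.inl hne)
      · refine pt_posn_ne R1.1 R1.2 R3.1 R3.2 (.inr ?_)
        unfold hgt; split_ifs <;> omega
      · exact pt_posn_ne R2.1 R2.2 R3.1 R3.2 (.inl hne.symm)
    · have hd : pdim (some (l, r) : Code K) = 1 := by simp [pdim, hr]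
      rw [hd]
      have hr2 := r_half r
      set y : ℕ := (r:ℕ) / 2 with hy
      have hyr := y_rng hr2
      have hne : (chS K π l y : ℝ) ≠ chT K π l y := by exact_mod_cast ch_ne hK hπ l.2 hyr.1 hyr.2
      have key : ∀ z, nsq z ≤ 1 → ee K π l y z = 0 → ∀ (l' : Fin K) (y' : ℕ), y' ≤ pY K →
          (0 < sg (some (l, r)) l' y' → 0 < ee K π l' y' z) ∧ (sg (some (l, r)) l' y' < 0 → ee K π l' y' z < 0) ∧
          (sg (some (l, r)) l' y' = 0 → ee K π l' y' z = 0) := by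
        intro z hz he l' y' hy'
        have hyr' := y_rng hy'
        by_cases hll : l' = l
        · subst hll
          simp only [sg, if_true]
          refine ⟨fun h => ?_, fun h => ?_, fun h => ?_⟩
          · by_contra hc
            have := N1 hπ l'.2 hyr'.1 (show (y':ℤ) < y by omega) hyr.2 hz (not_lt.1 hc)
            linarith
          · exact N1 hπ l'.2 hyr.1 (by omega) hyr'.2 hz he.le
          · have : y' = y := by omega
            rw [this]; exact he
        · simp only [sg, hll, if_false]
          exact ⟨fun _ => N2 hπ l.2 l'.2 (fun e => hll (Fin.ext e.symm)) hyr.1 hyr.2 hyr'.1 hyr'.2 hz he.le,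
            fun h => absurd h (by norm_num), fun h => absurd h (by norm_num)⟩
      have hsg : sg (some (l, r)) l y = 0 := by simp only [sg, if_true]; omega
      have e1 : pZ K π (some (l, r)) = {z | nsq z ≤ 1 ∧ ell (chS K π l y) (chT K π l y) z = 0} := by
        ext z
        constructor
        · rintro ⟨h1, h2⟩
          have := h2 l y hr2
          exact ⟨h1, le_antisymm (this.2 hsg.le) (this.1 hsg.ge)⟩
        · rintro ⟨h1, h2⟩
          refine ⟨h1, fun l' y' hy' => ?_⟩
          have := key z h1 h2 l' y' hy'
          constructor
          · intro h; rcases h.eq_or_lt with c | c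
            · exact (this.2.2 c.symm).ge
            · exact (this.1 c).le
          · intro h; rcases h.eq_or_lt with c | c
            · exact (this.2.2 c).le
            · exact (this.2.1 c).le
      have e2 : pZo K π (some (l, r)) = {z | nsq z < 1 ∧ ell (chS K π l y) (chT K π l y) z = 0} := by
        ext z
        constructor
        · rintro ⟨h1, h2⟩
          exact ⟨h1, (h2 l y hr2).2.2 hsg⟩
        · rintro ⟨h1, h2⟩
          exact ⟨h1, fun l' y' hy' => key z h1.le h2 l' y' hy'⟩
      rw [e1, e2]
      exact chord_cell hne

end
end FatS
end

section
open Metric Set Topology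
namespace FatS

namespace Fam
variable {K H : ℕ} (F : Fam K H)

def SZ (r : ℕ) : Set (E 2) := {z | nsq z ≤ 1 ∧ (∀ m, m < (r + 1) / 2 → m ≤ H → ∀ l, 0 ≤ F.eL l m z) ∧
  (∀ m, r / 2 ≤ m → m ≤ H → ∀ l, 0 ≤ F.eT l m z)}
def SZo (r : ℕ) : Set (E 2) := {z | nsq z < 1 ∧ (∀ m, m < (r + 1) / 2 → m ≤ H → ∀ l, 0 < F.eL l m z) ∧
  (∀ m, r / 2 ≤ m → m ≤ H → ∀ l, 0 < F.eT l m z)}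
/-- closed fibre and open fibre -/
def SI (r : ℕ) (z : E 2) : Set ℝ := Icc (F.lam (r / 2 + 1) z) (F.lam ((r + 1) / 2) z)
def SIo (r : ℕ) (z : E 2) : Set ℝ := {τ | τ ∈ F.SI r z ∧ (r % 2 = 0 → F.lam (r / 2 + 1) z < τ ∧ τ < F.lam ((r + 1) / 2) z)}

lemma SZo_sub (r : ℕ) : F.SZo r ⊆ F.SZ r := fun _ h =>
  ⟨h.1.le, fun m a b l => (h.2.1 m a b l).le, fun m a b l => (h.2.2 m a b l).le⟩

lemma SZ_mono {r r' : ℕ} (hA : (r' + 1) / 2 ≤ (r + 1) / 2) (hB : r / 2 ≤ r' / 2) : F.SZ r ⊆ F.SZ r' := fun _ h =>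
  ⟨h.1, fun m a b l => h.2.1 m (by omega) b l, fun m a b l => h.2.2 m (by omega) b l⟩

lemma A_cases {r : ℕ} (hr : r < 2 * H + 3) : (r + 1) / 2 = 0 ∨ ∃ m ≤ H, (r + 1) / 2 = m + 1 := by
  rcases Nat.eq_zero_or_pos ((r + 1) / 2) with h | h
  · exact .inl h
  · exact .inr ⟨(r + 1) / 2 - 1, by omega, by omega⟩
lemma B_cases {r : ℕ} (hr : r < 2 * H + 3) : r / 2 + 1 = H + 2 ∨ r / 2 ≤ H := by omega

lemma SZo_iff {r : ℕ} (hr : r < 2 * H + 3) {z : E 2} (hz : nsq z < 1) :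
    z ∈ F.SZo r ↔ 0 < F.lam ((r + 1) / 2) z ∧ F.lam (r / 2 + 1) z < 1 := by
  constructor
  · rintro ⟨-, h1, h2⟩
    constructor
    · rcases A_cases hr with h | ⟨m, hm, h⟩
      · rw [h, lam_zero]; norm_num
      · rw [h, F.lam_pos hm hz]; exact h1 m (by omega) hm
    · rcases B_cases hr with h | h
      · rw [h, lam_last]; norm_num
      · rw [F.lam_lt h hz]; exact h2 _ le_rfl h
  · rintro ⟨h1, h2⟩
    refine ⟨hz, fun m a b => ?_, fun m a b => ?_⟩
    · rw [← F.lam_pos b hz]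
      exact h1.trans_le (F.lam_anti (by omega) (by omega) hz)
    · rw [← F.lam_lt b hz]
      exact (F.lam_anti (by omega) (by omega) hz).trans_lt h2

lemma SZ_edge {r : ℕ} (hr : r < 2 * H + 3) {z : E 2} (h : z ∉ F.SZo r) (hz : nsq z < 1) :
    F.lam (r / 2 + 1) z = F.lam ((r + 1) / 2) z := by
  have h0 := F.lam_nonneg (t := r / 2 + 1) (by omega) z
  have h1 := F.lam_le_one (t := (r + 1) / 2) (by omega) z
  have h2 := F.lam_anti (t := (r + 1) / 2) (t' := r / 2 + 1) (by omega) (by omega) hz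
  rw [F.SZo_iff hr hz, not_and_or, not_lt, not_lt] at h
  rcases h with h | h <;> linarith

lemma SI_unit {r : ℕ} (hr : r < 2 * H + 3) {z : E 2} {τ : ℝ} (h : τ ∈ F.SI r z) : τ ∈ Icc (0:ℝ) 1 :=
  ⟨(F.lam_nonneg (by omega) z).trans h.1, h.2.trans (F.lam_le_one (by omega) z)⟩

lemma SIo_unit {r : ℕ} (hr : r < 2 * H + 3) {z : E 2} (hz : z ∈ F.SZo r) {τ : ℝ} (h : τ ∈ F.SIo r z) : τ ∈ Ioo (0:ℝ) 1 := by
  have h1 := (F.SZo_iff hr hz.1).1 hz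
  have hu := F.SI_unit hr h.1
  rcases Nat.mod_two_eq_zero_or_one r with e | e
  · have := h.2 e
    exact ⟨(F.lam_nonneg (by omega) z).trans_lt this.1, this.2.trans_le (F.lam_le_one (by omega) z)⟩
  · have e2 : r / 2 + 1 = (r + 1) / 2 := by omega
    have h2 := h.1
    unfold SI at h2
    rw [e2] at h2 h1
    exact ⟨h1.1.trans_le h2.1, h2.2.trans_lt h1.2⟩

lemma SI_mono {r r' : ℕ} (hr : r < 2 * H + 3) (hr' : r' < 2 * H + 3)
    (hA : (r' + 1) / 2 ≤ (r + 1) / 2) (hB : r / 2 ≤ r' / 2) {z : E 2} (hz : nsq z < 1) : F.SI r z ⊆ F.SI r' z :=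
  Icc_subset_Icc (F.lam_anti (by omega) (by omega) hz) (F.lam_anti (by omega) (by omega) hz)

/-- slab in slab -/
lemma slab_slab {r r' : ℕ} (hr : r < 2 * H + 3) (hr' : r' < 2 * H + 3) {z : E 2} (hz : z ∈ F.SZo r)
    {τ : ℝ} (hτ : τ ∈ F.SIo r z) (hτ' : τ ∈ F.SI r' z) :
    (r' + 1) / 2 ≤ (r + 1) / 2 ∧ r / 2 ≤ r' / 2 := by
  have hu := F.SIo_unit hr hz hτ
  have h1 := (F.SZo_iff hr hz.1).1 hz
  rcases Nat.mod_two_eq_zero_or_one r with e | e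
  · have h2 := hτ.2 e
    constructor
    · by_contra hc
      have := F.lam_anti (t := r / 2 + 1) (t' := (r' + 1) / 2) (by omega) (by omega) hz.1
      linarith [hτ'.2]
    · by_contra hc
      have := F.lam_anti (t := r' / 2 + 1) (t' := (r + 1) / 2) (by omega) (by omega) hz.1
      linarith [hτ'.1]
  · have e2 : r / 2 + 1 = (r + 1) / 2 := by omega
    have h2 := hτ.1
    unfold SI at h2
    rw [e2] at h2 h1
    have e3 : τ = F.lam ((r + 1) / 2) z := le_antisymm h2.2 h2.1
    constructor
    · by_contra hc
      have g := F.lam_anti (t := (r + 1) / 2) (t' := (r' + 1) / 2) (by omega) (by omega) hz.1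
      have := F.lam_strict (t := (r + 1) / 2) (t' := (r' + 1) / 2) (by omega) (by omega) hz.1 h1.1 (by linarith)
      linarith [hτ'.2]
    · by_contra hc
      have g := F.lam_anti (t := r' / 2 + 1) (t' := (r + 1) / 2) (by omega) (by omega) hz.1
      have := F.lam_strict (t := r' / 2 + 1) (t' := (r + 1) / 2) (by omega) (by omega) hz.1 (by linarith) h1.2
      linarith [hτ'.1]

lemma slab_cover {z : E 2} (hz : nsq z < 1) {τ : ℝ} (hτ : τ ∈ Ioo (0:ℝ) 1) :
    ∃ r, r < 2 * H + 3 ∧ z ∈ F.SZo r ∧ τ ∈ F.SIo r z := by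
  classical
  have hex : ∃ t, F.lam t z ≤ τ := ⟨H + 2, by rw [lam_last]; exact hτ.1.le⟩
  have h1 := Nat.find_spec hex
  have h2 : Nat.find hex ≤ H + 2 := Nat.find_min' hex (by rw [lam_last]; exact hτ.1.le)
  have h3 := fun m => Nat.find_min (m := m) hex
  have h0 : Nat.find hex ≠ 0 := by
    intro h; rw [h, lam_zero] at h1; linarith [hτ.2]
  obtain ⟨t, ht⟩ := Nat.exists_eq_succ_of_ne_zero h0
  rw [ht] at h1 h2 h3
  have h4 := not_le.1 (h3 t (Nat.lt_succ_self t))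
  rw [Nat.succ_eq_add_one] at *
  rcases h1.eq_or_lt with e | e
  · have ht1 : t ≤ H := by
      by_contra hc
      have : t + 1 = H + 2 := by omega
      rw [this, lam_last] at e; linarith [hτ.1]
    have a1 : (2 * t + 1 + 1) / 2 = t + 1 := by omega
    have a2 : (2 * t + 1) / 2 + 1 = t + 1 := by omega
    refine ⟨2 * t + 1, by omega, ?_, ?_⟩
    · rw [F.SZo_iff (by omega) hz, a1, a2, e]; exact hτ
    · refine ⟨?_, fun h => by omega⟩
      unfold SI; rw [a1, a2, e]; exact ⟨le_rfl, le_rfl⟩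
  · have a1 : (2 * t + 1) / 2 = t := by omega
    have a2 : (2 * t) / 2 + 1 = t + 1 := by omega
    refine ⟨2 * t, by omega, ?_, ?_⟩
    · rw [F.SZo_iff (by omega) hz, a1, a2]; exact ⟨hτ.1.trans h4, e.trans hτ.2⟩
    · refine ⟨?_, fun _ => ?_⟩
      · unfold SI; rw [a1, a2]; exact ⟨e.le, h4.le⟩
      · rw [a1, a2]; exact ⟨e, h4⟩

/-- criterion for the `lam = 0` end -/
lemma end_zero {r : ℕ} {z : E 2} (hz : nsq z ≤ 1) (h1 : ∀ m, m < (r + 1) / 2 → m ≤ H → ∀ l, 0 ≤ F.eL l m z)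
    (h2 : r / 2 ≤ H → ∃ l, F.eL l (r / 2) z ≤ 0) : z ∈ F.SZ r := by
  refine ⟨hz, h1, fun m a b l' => ?_⟩
  obtain ⟨l, hl⟩ := h2 (by omega)
  rcases a.eq_or_lt with e | e
  · exact F.xL l l' m z b hz (e ▸ hl)
  · exact F.xL l l' m z b hz (F.mL l _ m z e b hz hl).le
lemma end_one {r : ℕ} (hr : r < 2 * H + 3) {z : E 2} (hz : nsq z ≤ 1) (h1 : ∀ m, r / 2 ≤ m → m ≤ H → ∀ l, 0 ≤ F.eT l m z)
    (h2 : ∀ m, m + 1 = (r + 1) / 2 → ∃ l, F.eT l m z ≤ 0) : z ∈ F.SZ r := by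
  refine ⟨hz, fun m a b l' => ?_, h1⟩
  obtain ⟨l, hl⟩ := h2 ((r + 1) / 2 - 1) (by omega)
  rcases (show m ≤ (r + 1) / 2 - 1 by omega).eq_or_lt with e | e
  · exact F.xT l l' m z b hz (e ▸ hl)
  · exact F.xT l l' m z b hz (F.mT l _ m z e (by omega) hz hl).le
lemma zero_mem {r : ℕ} (hr : r < 2 * H + 3) {z : E 2} (hz : nsq z < 1) :
    (0:ℝ) ∈ F.SI r z ↔ (r / 2 ≤ H → ∃ l, F.eL l (r / 2) z ≤ 0) := by
  have h0 := F.lam_nonneg (t := r / 2 + 1) (by omega) z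
  have h1 := F.lam_nonneg (t := (r + 1) / 2) (by omega) z
  constructor
  · intro h hB
    rw [← F.lam_eq_zero hB hz]
    exact le_antisymm h.1 h0
  · intro h
    refine ⟨?_, h1⟩
    rcases B_cases hr with e | e
    · rw [e, lam_last]
    · exact ((F.lam_eq_zero e hz).2 (h e)).le
lemma one_mem {r : ℕ} (hr : r < 2 * H + 3) {z : E 2} (hz : nsq z < 1) :
    (1:ℝ) ∈ F.SI r z ↔ (∀ m, m + 1 = (r + 1) / 2 → ∃ l, F.eT l m z ≤ 0) := by
  have h0 := F.lam_le_one (t := r / 2 + 1) (by omega) z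
  have h1 := F.lam_le_one (t := (r + 1) / 2) (by omega) z
  constructor
  · intro h m e
    rw [← F.lam_eq_one (by omega) hz, e]
    exact le_antisymm h1 h.2
  · intro h
    refine ⟨h0, ?_⟩
    rcases A_cases hr with e | ⟨m, hm, e⟩
    · rw [e, lam_zero]
    · rw [e]; exact ((F.lam_eq_one hm hz).2 (h m e.symm)).ge
end Fam

section
variable {K : ℕ}

lemma posn_gap {i j : ℕ} {n n' : ℤ} (h : i < j) (h0 : 1 ≤ n) (h1 : n + 1 ≤ pT K) (h0' : 1 ≤ n')
    (h1' : n' + 1 ≤ pT K) : posn K i n + 2 ≤ posn K j n' := by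
  have := block (K := K) h
  have : ((i * (pT K + 1) : ℕ) : ℤ) + (pT K + 1) ≤ ((j * (pT K + 1) : ℕ) : ℤ) := by exact_mod_cast this
  unfold posn
  split_ifs <;> linarith
lemma posn_inner {i : ℕ} {n : ℤ} (hi : i < 2 * K) (h0 : 1 ≤ n) (h1 : n + 1 ≤ pT K) :
    0 ≤ posn K i n ∧ posn K i n ≤ pM K - 3 := by
  have := block (K := K) hi
  have : ((i * (pT K + 1) : ℕ) : ℤ) + (pT K + 1) ≤ pM K := by unfold pM; exact_mod_cast this
  have : (0 : ℤ) ≤ ((i * (pT K + 1) : ℕ) : ℤ) := by positivity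
  unfold posn
  split_ifs <;> constructor <;> linarith

lemma ee_arc_sign (hK : 2 ≤ K) {π : ℕ} (hπ : π < 2 * K) {l : Fin K} {y : ℤ} (h0 : 0 ≤ y) (h1 : y ≤ pY K) (q : ℕ) :
    ((∀ z ∈ arcO (pM K) q, 0 < ee K π l y z) ∧ ∀ z ∈ arcC (pM K) q, 0 ≤ ee K π l y z) ∨
    ((∀ z ∈ arcO (pM K) q, ee K π l y z < 0) ∧ ∀ z ∈ arcC (pM K) q, ee K π l y z ≤ 0) := by
  have r := ch_range hπ l.2 h0 h1
  exact arc_sign (pM_ge hK) q r.1 r.2 (ch_ne hK hπ l.2 h0 h1)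

lemma ee_arc_ends (hK : 2 ≤ K) {π : ℕ} (hπ : π < 2 * K) {l : Fin K} {y : ℤ} (h0 : 0 ≤ y) (h1 : y ≤ pY K)
    {q : ℕ} (hq : q < pM K) :
    (0 ≤ ee K π l y (pt (((q:ℤ) - 1 : ℤ) : ℝ)) → 0 ≤ ee K π l y (pt (nxt (pM K) q : ℝ)) → ∀ z ∈ arcC (pM K) q, 0 ≤ ee K π l y z) ∧
    (ee K π l y (pt (((q:ℤ) - 1 : ℤ) : ℝ)) ≤ 0 → ee K π l y (pt (nxt (pM K) q : ℝ)) ≤ 0 → ∀ z ∈ arcC (pM K) q, ee K π l y z ≤ 0) := by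
  have r := ch_range hπ l.2 h0 h1
  have hne := ch_ne hK hπ l.2 h0 h1
  have a := hgt_range hπ (iL_lt (π := π) l.2) h0 h1
  have b := hgt_range hπ (iR_lt (π := π) l.2) h0 h1
  have a1 := posn_inner (iL_lt (π := π) l.2) a.1 a.2
  have b1 := posn_inner (iR_lt (π := π) l.2) b.1 b.2
  have hg : chS K π l y + 2 ≤ chT K π l y ∨ chT K π l y + 2 ≤ chS K π l y := by
    rcases lt_or_gt_of_ne (iL_ne_iR hK (π := π) l.2) with h | h
    · exact .inl (posn_gap h a.1 a.2 b.1 b.2)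
    · exact .inr (posn_gap h b.1 b.2 a.1 a.2)
  change 0 ≤ chS K π l y ∧ chS K π l y ≤ _ at a1
  change 0 ≤ chT K π l y ∧ chT K π l y ≤ _ at b1
  have hadj : ¬ ((chS K π l y = (q:ℤ) - 1 ∧ chT K π l y = nxt (pM K) q) ∨ (chT K π l y = (q:ℤ) - 1 ∧ chS K π l y = nxt (pM K) q)) := by
    unfold nxt; split_ifs <;> omega
  refine ⟨fun g1 g2 => arc_ends (pM_ge hK) hq r.1 r.2 hne hadj g1 g2, fun g1 g2 z hz => ?_⟩
  have := arc_ends (pM_ge hK) hq r.2 r.1 hne.symm (by tauto) (by rw [ell_swap]; unfold ee at g1; linarith)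
    (by rw [ell_swap]; unfold ee at g2; linarith) z hz
  rw [ell_swap] at this
  unfold ee; linarith

/-- arcs versus pages -/
lemma page_arc (hK : 2 ≤ K) {π : ℕ} (hπ : π < 2 * K) {a : Code K} {q : ℕ} {z : E 2} (hz : z ∈ arcO (pM K) q)
    (h : z ∈ pZ K π a) : arcC (pM K) q ⊆ pZ K π a ∧ pdim a = 2 := by
  have S := fun (l : Fin K) (y : ℕ) (hy : y ≤ pY K) => ee_arc_sign hK hπ (l := l) (y_rng hy).1 (y_rng hy).2 q
  constructor
  · refine fun z' hz' => ⟨(arc_circle hz').le, fun l y hy => ⟨fun s => ?_, fun s => ?_⟩⟩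
    · rcases S l y hy with g | g
      · exact g.2 z' hz'
      · have := (h.2 l y hy).1 s
        linarith [g.1 z hz]
    · rcases S l y hy with g | g
      · have := (h.2 l y hy).2 s
        linarith [g.1 z hz]
      · exact g.2 z' hz'
  · match a, h with
    | none, h => rfl
    | some (l, r), h =>
      simp only [pdim]
      by_contra hc
      have hy := r_half r
      have e : sg (some (l, r)) l ((r:ℕ)/2) = 0 := by simp only [sg, if_true]; omega
      have := h.2 l ((r:ℕ)/2) hy
      have g1 := this.1 e.ge
      have g2 := this.2 e.le
      rcases S l _ hy with g | g <;> linarith [g.1 z hz]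

lemma page_arc_ends (hK : 2 ≤ K) {π : ℕ} (hπ : π < 2 * K) {a : Code K} {q : ℕ} (hq : q < pM K)
    (h1 : pt (((q:ℤ) - 1 : ℤ) : ℝ) ∈ pZ K π a) (h2 : pt (nxt (pM K) q : ℝ) ∈ pZ K π a) : arcC (pM K) q ⊆ pZ K π a := by
  refine fun z' hz' => ⟨(arc_circle hz').le, fun l y hy => ?_⟩
  have S := ee_arc_ends hK hπ (l := l) (y_rng hy).1 (y_rng hy).2 hq
  exact ⟨fun s => S.1 ((h1.2 l y hy).1 s) ((h2.2 l y hy).1 s) z' hz', fun s => S.2 ((h1.2 l y hy).2 s) ((h2.2 l y hy).2 s) z' hz'⟩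

lemma eL_rng {σ : Fin (2 * K)} {l : Fin K} {m : ℕ} (hm : m ≤ pH K) : 0 ≤ yE K σ l m ∧ yE K σ l m ≤ pY K :=
  yE_range σ.2 l.2 (by positivity) (by exact_mod_cast hm)
lemma eT_rng (hK : 2 ≤ K) {σ : Fin (2 * K)} {l : Fin K} {m : ℕ} (hm : m ≤ pH K) : 0 ≤ yO K σ l m ∧ yO K σ l m ≤ pY K :=
  yO_range hK σ.2 l.2 (by positivity) (by exact_mod_cast hm)

/-- arcs versus slabs -/
lemma slab_arc (hK : 2 ≤ K) {σ : Fin (2 * K)} {r q : ℕ} {z : E 2} (hz : z ∈ arcO (pM K) q)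
    (h : z ∈ (fam hK σ).SZ r) : arcC (pM K) q ⊆ (fam hK σ).SZ r := by
  refine fun z' hz' => ⟨(arc_circle hz').le, fun m a b l => ?_, fun m a b l => ?_⟩
  · rcases ee_arc_sign hK (pgE_lt hK σ.2) (l := l) (eL_rng b).1 (eL_rng b).2 q with g | g
    · exact g.2 z' hz'
    · have g1 := g.1 z hz
      have g2 : 0 ≤ ee K (pgE K σ) l (yE K σ l m) z := h.2.1 m a b l
      linarith
  · rcases ee_arc_sign hK (pgO_lt σ.2) (l := l) (eT_rng hK b).1 (eT_rng hK b).2 q with g | g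
    · exact g.2 z' hz'
    · have g1 := g.1 z hz
      have g2 : 0 ≤ ee K (pgO σ) l (yO K σ l m) z := h.2.2 m a b l
      linarith
lemma slab_arc_ends (hK : 2 ≤ K) {σ : Fin (2 * K)} {r q : ℕ} (hq : q < pM K)
    (h1 : pt (((q:ℤ) - 1 : ℤ) : ℝ) ∈ (fam hK σ).SZ r) (h2 : pt (nxt (pM K) q : ℝ) ∈ (fam hK σ).SZ r) :
    arcC (pM K) q ⊆ (fam hK σ).SZ r := by
  refine fun z' hz' => ⟨(arc_circle hz').le, fun m a b l => ?_, fun m a b l => ?_⟩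
  · exact (ee_arc_ends hK (pgE_lt hK σ.2) (eL_rng b).1 (eL_rng b).2 hq).1 (h1.2.1 m a b l) (h2.2.1 m a b l) z' hz'
  · exact (ee_arc_ends hK (pgO_lt σ.2) (eT_rng hK b).1 (eT_rng hK b).2 hq).1 (h1.2.2 m a b l) (h2.2.2 m a b l) z' hz'

lemma yo_yE {σ l i : ℕ} (hσ : σ < 2 * K) (hi : inP K (pgE K σ) l i) (m n : ℤ) :
    yo K (pgE K σ) i n - yE K σ l m = n - (uu K σ i + m) := by
  rw [← dev_yo, ← hgt_yE hσ hi]; unfold dev; rw [if_pos (pgE_even hσ)]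
lemma yo_yO {σ l i : ℕ} (hi : inP K (pgO σ) l i) (m n : ℤ) :
    yo K (pgO σ) i n - yO K σ l m = (uu K σ i + m) - n := by
  have := pgO_odd σ
  rw [← dev_yo, ← hgt_yO hi]; unfold dev; rw [if_neg (by omega)]

lemma slab_V (hK : 2 ≤ K) {σ : Fin (2 * K)} {r : ℕ} {i : ℕ} (hi : i < 2 * K) {n : ℤ}
    (n0 : 0 ≤ n) (n1 : n ≤ pT K) :
    pt (posn K i n) ∈ (fam hK σ).SZ r ↔
      (∀ m : ℕ, m < (r + 1) / 2 → m ≤ pH K → uu K σ i + m ≤ n) ∧ (∀ m : ℕ, r / 2 ≤ m → m ≤ pH K → n ≤ uu K σ i + m) := by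
  have hE := pgE_lt hK σ.2
  have hO := pgO_lt σ.2
  have keyE : ∀ m : ℕ, m ≤ pH K → ((∀ l, 0 ≤ (fam hK σ).eL l m (pt (posn K i n))) ↔ uu K σ i + m ≤ n) := by
    intro m hm
    have key : ∀ l : Fin K, inP K (pgE K σ) l i → (0 ≤ ee K (pgE K σ) l (yE K σ l m) (pt (posn K i n)) ↔ uu K σ i + m ≤ n) := by
      intro l hl
      obtain ⟨y, hy⟩ := Int.eq_ofNat_of_zero_le (eL_rng (σ := σ) (l := l) hm).1
      have h2 := (eL_rng (σ := σ) (l := l) hm).2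
      have h3 := yo_yE σ.2 hl m n
      rw [hy] at h2 h3 ⊢
      have h2' : y ≤ pY K := by exact_mod_cast h2
      have := (node_sign hE hi h2' n0 n1 hl).1
      rw [this]; constructor <;> intro <;> linarith
    obtain ⟨l, hl⟩ := inP_exists (pgE K σ) hi
    constructor
    · intro h; exact (key l hl).1 (h l)
    · intro h l'
      by_cases hc : inP K (pgE K σ) l' i
      · exact (key l' hc).2 h
      · exact (N4_out hE l'.2 hi (eL_rng hm).1 (eL_rng hm).2 n0 n1 hc).le
  have keyO : ∀ m : ℕ, m ≤ pH K → ((∀ l, 0 ≤ (fam hK σ).eT l m (pt (posn K i n))) ↔ n ≤ uu K σ i + m) := by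
    intro m hm
    have key : ∀ l : Fin K, inP K (pgO σ) l i → (0 ≤ ee K (pgO σ) l (yO K σ l m) (pt (posn K i n)) ↔ n ≤ uu K σ i + m) := by
      intro l hl
      obtain ⟨y, hy⟩ := Int.eq_ofNat_of_zero_le (eT_rng hK (σ := σ) (l := l) hm).1
      have h2 := (eT_rng hK (σ := σ) (l := l) hm).2
      have h3 := yo_yO hl m n
      rw [hy] at h2 h3 ⊢
      have h2' : y ≤ pY K := by exact_mod_cast h2
      have := (node_sign hO hi h2' n0 n1 hl).1
      rw [this]; constructor <;> intro <;> linarith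
    obtain ⟨l, hl⟩ := inP_exists (pgO σ) hi
    constructor
    · intro h; exact (key l hl).1 (h l)
    · intro h l'
      by_cases hc : inP K (pgO σ) l' i
      · exact (key l' hc).2 h
      · exact (N4_out hO l'.2 hi (eT_rng hK hm).1 (eT_rng hK hm).2 n0 n1 hc).le
  constructor
  · rintro ⟨-, h1, h2⟩
    exact ⟨fun m a b => (keyE m b).1 (h1 m a b), fun m a b => (keyO m b).1 (h2 m a b)⟩
  · rintro ⟨h1, h2⟩
    exact ⟨(cp_nsq (pt_pos _)).le, fun m a b => (keyE m b).2 (h1 m a b), fun m a b => (keyO m b).2 (h2 m a b)⟩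

lemma slab_region_cell (hK : 2 ≤ K) (σ : Fin (2 * K)) {r : ℕ} (hr : r < 2 * pH K + 3) :
    IsCell 2 ((fam hK σ).SZ r) ((fam hK σ).SZo r) := by
  let S : Set (ℝ × ℝ) := {p | (∃ m, m < (r + 1) / 2 ∧ m ≤ pH K ∧ ∃ l : Fin K,
      p = ((chS K (pgE K σ) l (yE K σ l m) : ℝ), (chT K (pgE K σ) l (yE K σ l m) : ℝ))) ∨
      (∃ m, r / 2 ≤ m ∧ m ≤ pH K ∧ ∃ l : Fin K,
      p = ((chS K (pgO σ) l (yO K σ l m) : ℝ), (chT K (pgO σ) l (yO K σ l m) : ℝ)))}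
  have hS : S.Finite := by
    let f : Fin (pH K + 1) × Fin K → ℝ × ℝ := fun p =>
      ((chS K (pgE K σ) p.2 (yE K σ p.2 (p.1:ℕ)) : ℝ), (chT K (pgE K σ) p.2 (yE K σ p.2 (p.1:ℕ)) : ℝ))
    let g : Fin (pH K + 1) × Fin K → ℝ × ℝ := fun p =>
      ((chS K (pgO σ) p.2 (yO K σ p.2 (p.1:ℕ)) : ℝ), (chT K (pgO σ) p.2 (yO K σ p.2 (p.1:ℕ)) : ℝ))
    apply ((finite_range f).union (finite_range g)).subset
    rintro p (⟨m, a, b, l, rfl⟩ | ⟨m, a, b, l, rfl⟩)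
    · exact .inl ⟨(⟨m, by omega⟩, l), rfl⟩
    · exact .inr ⟨(⟨m, by omega⟩, l), rfl⟩
  have e1 : (fam hK σ).SZ r = Rg S := by
    ext z
    simp only [Fam.SZ, Rg, mem_setOf_eq]
    refine and_congr_right fun _ => ⟨?_, fun h => ⟨fun m a b l => h _ (.inl ⟨m, a, b, l, rfl⟩), fun m a b l => h _ (.inr ⟨m, a, b, l, rfl⟩)⟩⟩
    rintro ⟨h1, h2⟩ p (⟨m, a, b, l, rfl⟩ | ⟨m, a, b, l, rfl⟩)
    · exact h1 m a b l
    · exact h2 m a b l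
  have e2 : (fam hK σ).SZo r = Rgo S := by
    ext z
    simp only [Fam.SZo, Rgo, mem_setOf_eq]
    refine and_congr_right fun _ => ⟨?_, fun h => ⟨fun m a b l => h _ (.inl ⟨m, a, b, l, rfl⟩), fun m a b l => h _ (.inr ⟨m, a, b, l, rfl⟩)⟩⟩
    rintro ⟨h1, h2⟩ p (⟨m, a, b, l, rfl⟩ | ⟨m, a, b, l, rfl⟩)
    · exact h1 m a b l
    · exact h2 m a b l
  let m0 : ℕ := (r + 1) / 2 - 1
  have hm0 : m0 ≤ pH K := by omega
  have R : ∀ i, i < 2 * K → _ := fun i hi => um_range hK σ.2 hi (m := (m0:ℤ)) (by positivity) (by exact_mod_cast hm0)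
  have V : ∀ i, i < 2 * K → pt (posn K i (uu K σ i + m0)) ∈ Rg S := fun i hi => by
    have hR := R i hi
    rw [← e1, slab_V hK hi (by linarith) (by linarith)]
    exact ⟨fun m a b => by omega, fun m a b => by omega⟩
  have D : ∀ i j, i < 2 * K → j < 2 * K → i ≠ j → pt (posn K i (uu K σ i + m0)) ≠ pt (posn K j (uu K σ j + m0)) := by
    intro i j hi hj hne
    have h1 := R i hi; have h2 := R j hj
    exact pt_posn_ne (by linarith) (by linarith) (by linarith) (by linarith) (.inl hne)
  rw [e1, e2]
  refine rg_cell hS ?_ (V 0 (by omega)) (V 1 (by omega)) (V 2 (by omega)) (cp_nsq (pt_pos _)) (cp_nsq (pt_pos _)) (cp_nsq (pt_pos _))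
    (D 0 1 (by omega) (by omega) (by omega)) (D 0 2 (by omega) (by omega) (by omega)) (D 1 2 (by omega) (by omega) (by omega))
  rintro p (⟨m, a, b, l, rfl⟩ | ⟨m, a, b, l, rfl⟩)
  · have := ch_ne hK (pgE_lt hK σ.2) l.2 (eL_rng (σ := σ) (l := l) b).1 (eL_rng b).2
    show ((_ : ℤ) : ℝ) ≠ ((_ : ℤ) : ℝ)
    exact_mod_cast this
  · have := ch_ne hK (pgO_lt σ.2) l.2 (eT_rng hK (σ := σ) (l := l) b).1 (eT_rng hK b).2
    show ((_ : ℤ) : ℝ) ≠ ((_ : ℤ) : ℝ)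
    exact_mod_cast this

end
end FatS
end

section
open Metric Set Topology
namespace FatS

inductive Ix (K : ℕ) : Type
  | node (q : Fin (pM K)) : Ix K
  | arc (q : Fin (pM K)) : Ix K
  | page (π : Fin (2 * K)) (a : Code K) : Ix K
  | slab (σ : Fin (2 * K)) (r : Fin (2 * pH K + 3)) : Ix K

def Ix.toSum {K : ℕ} : Ix K → (Fin (pM K) ⊕ Fin (pM K)) ⊕ (Fin (2 * K) × Code K) ⊕ (Fin (2 * K) × Fin (2 * pH K + 3))
  | .node q => .inl (.inl q)
  | .arc q => .inl (.inr q)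
  | .page π a => .inr (.inl (π, a))
  | .slab σ r => .inr (.inr (σ, r))

instance {K : ℕ} : Finite (Ix K) := by
  refine Finite.of_injective (Ix.toSum (K := K)) ?_
  intro i j h
  cases i <;> cases j <;> simp_all [Ix.toSum]

section
variable {K : ℕ}

def dd : Ix K → ℕ
  | .node _ => 0
  | .arc _ => 1
  | .page _ a => pdim a
  | .slab _ r => 3 - (r:ℕ) % 2
def Zc (hK : 2 ≤ K) : Ix K → Set (E 2)
  | .node q => {pt ((q:ℝ) - 1)}
  | .arc q => arcC (pM K) q
  | .page π a => pZ K π a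
  | .slab σ r => (fam hK σ).SZ r
def Zo (hK : 2 ≤ K) : Ix K → Set (E 2)
  | .node q => {pt ((q:ℝ) - 1)}
  | .arc q => arcO (pM K) q
  | .page π a => pZo K π a
  | .slab σ r => (fam hK σ).SZo r
def Wc (hK : 2 ≤ K) : Ix K → E 2 → Set ℂ
  | .node _, _ => univ
  | .arc _, _ => univ
  | .page π _, _ => {th K π}
  | .slab σ r, z => gam K σ '' (fam hK σ).SI r z
def Wo (hK : 2 ≤ K) : Ix K → E 2 → Set ℂ
  | .node _, _ => univ
  | .arc _, _ => univ
  | .page π _, _ => {th K π}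
  | .slab σ r, z => gam K σ '' (fam hK σ).SIo r z
def cc (hK : 2 ≤ K) (i : Ix K) : Set (E 4) :=
  {x | ∃ z w, nsq z ≤ 1 ∧ ‖w‖ = 1 ∧ Phi z w = x ∧ z ∈ Zc hK i ∧ (nsq z < 1 → w ∈ Wc hK i z)}
def co (hK : 2 ≤ K) (i : Ix K) : Set (E 4) :=
  {x | ∃ z w, nsq z ≤ 1 ∧ ‖w‖ = 1 ∧ Phi z w = x ∧ z ∈ Zo hK i ∧ (nsq z < 1 → w ∈ Wo hK i z)}

lemma mem_cc (hK : 2 ≤ K) {i : Ix K} {z : E 2} {w : ℂ} (hz : nsq z ≤ 1) (hw : ‖w‖ = 1) :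
    Phi z w ∈ cc hK i ↔ z ∈ Zc hK i ∧ (nsq z < 1 → w ∈ Wc hK i z) := by
  constructor
  · rintro ⟨z', w', h1, h2, h3, h4, h5⟩
    obtain ⟨rfl, h6⟩ := Phi_inj h3
    exact ⟨h4, fun h => h6 h ▸ h5 h⟩
  · rintro ⟨h1, h2⟩
    exact ⟨z, w, hz, hw, rfl, h1, h2⟩
lemma mem_co (hK : 2 ≤ K) {i : Ix K} {z : E 2} {w : ℂ} (hz : nsq z ≤ 1) (hw : ‖w‖ = 1) :
    Phi z w ∈ co hK i ↔ z ∈ Zo hK i ∧ (nsq z < 1 → w ∈ Wo hK i z) := by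
  constructor
  · rintro ⟨z', w', h1, h2, h3, h4, h5⟩
    obtain ⟨rfl, h6⟩ := Phi_inj h3
    exact ⟨h4, fun h => h6 h ▸ h5 h⟩
  · rintro ⟨h1, h2⟩
    exact ⟨z, w, hz, hw, rfl, h1, h2⟩

def yEn (K σ l m : ℕ) : ℕ := (yE K σ l m).toNat
def yOn (K σ l m : ℕ) : ℕ := (yO K σ l m).toNat
lemma yEn_cast {σ : Fin (2 * K)} {l : Fin K} {m : ℕ} (hm : m ≤ pH K) : ((yEn K σ l m : ℕ) : ℤ) = yE K σ l m :=
  Int.toNat_of_nonneg (eL_rng hm).1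
lemma yOn_cast (hK : 2 ≤ K) {σ : Fin (2 * K)} {l : Fin K} {m : ℕ} (hm : m ≤ pH K) : ((yOn K σ l m : ℕ) : ℤ) = yO K σ l m :=
  Int.toNat_of_nonneg (eT_rng hK hm).1
lemma yEn_le {σ : Fin (2 * K)} {l : Fin K} {m : ℕ} (hm : m ≤ pH K) : yEn K σ l m ≤ pY K := by
  have := (eL_rng (σ := σ) (l := l) hm).2
  rw [← yEn_cast hm] at this; exact_mod_cast this
lemma yOn_le (hK : 2 ≤ K) {σ : Fin (2 * K)} {l : Fin K} {m : ℕ} (hm : m ≤ pH K) : yOn K σ l m ≤ pY K := by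
  have := (eT_rng hK (σ := σ) (l := l) hm).2
  rw [← yOn_cast hK hm] at this; exact_mod_cast this
lemma eL_eq (hK : 2 ≤ K) {σ : Fin (2 * K)} {l : Fin K} {m : ℕ} (hm : m ≤ pH K) (z : E 2) :
    (fam hK σ).eL l m z = ee K (pgE K σ) l (yEn K σ l m : ℕ) z := by rw [yEn_cast hm]; rfl
lemma eT_eq (hK : 2 ≤ K) {σ : Fin (2 * K)} {l : Fin K} {m : ℕ} (hm : m ≤ pH K) (z : E 2) :
    (fam hK σ).eT l m z = ee K (pgO σ) l (yOn K σ l m : ℕ) z := by rw [yOn_cast hK hm]; rfl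

/-- combinatorial conditions for a page cell to lie in a slab -/
def CE (σ : Fin (2 * K)) (r : ℕ) (a : Code K) : Prop :=
  (∀ m, m < (r + 1) / 2 → m ≤ pH K → ∀ l, 0 ≤ sg a l (yEn K σ l m)) ∧ (r / 2 ≤ pH K → ∃ l, sg a l (yEn K σ l (r / 2)) ≤ 0)
def CO (σ : Fin (2 * K)) (r : ℕ) (a : Code K) : Prop :=
  (∀ m, r / 2 ≤ m → m ≤ pH K → ∀ l, 0 ≤ sg a l (yOn K σ l m)) ∧
  (∀ m, m + 1 = (r + 1) / 2 → ∃ l, sg a l (yOn K σ l m) ≤ 0)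

lemma CE_sub (hK : 2 ≤ K) {σ : Fin (2 * K)} {r : ℕ} (hr : r < 2 * pH K + 3) {a : Code K} (h : CE σ r a) {z : E 2}
    (hz : z ∈ pZ K (pgE K σ) a) : z ∈ (fam hK σ).SZ r ∧ (nsq z < 1 → (0:ℝ) ∈ (fam hK σ).SI r z) := by
  have e2 : r / 2 ≤ pH K → ∃ l, (fam hK σ).eL l (r / 2) z ≤ 0 := fun hB => by
    obtain ⟨l, hl⟩ := h.2 hB
    exact ⟨l, by rw [eL_eq hK hB]; exact (hz.2 l _ (yEn_le hB)).2 hl⟩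
  refine ⟨(fam hK σ).end_zero hz.1 (fun m a b l => ?_) e2, fun hn => ((fam hK σ).zero_mem hr hn).2 e2⟩
  rw [eL_eq hK b]
  exact (hz.2 l _ (yEn_le b)).1 (h.1 m a b l)
lemma CO_sub (hK : 2 ≤ K) {σ : Fin (2 * K)} {r : ℕ} (hr : r < 2 * pH K + 3) {a : Code K} (h : CO σ r a) {z : E 2}
    (hz : z ∈ pZ K (pgO σ) a) : z ∈ (fam hK σ).SZ r ∧ (nsq z < 1 → (1:ℝ) ∈ (fam hK σ).SI r z) := by
  have e2 : ∀ m, m + 1 = (r + 1) / 2 → ∃ l, (fam hK σ).eT l m z ≤ 0 := fun m hB => by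
    obtain ⟨l, hl⟩ := h.2 m hB
    have hm : m ≤ pH K := by omega
    exact ⟨l, by rw [eT_eq hK hm]; exact (hz.2 l _ (yOn_le hK hm)).2 hl⟩
  refine ⟨(fam hK σ).end_one hr hz.1 (fun m a b l => ?_) e2, fun hn => ((fam hK σ).one_mem hr hn).2 e2⟩
  rw [eT_eq hK b]
  exact (hz.2 l _ (yOn_le hK b)).1 (h.1 m a b l)
lemma CE_of (hK : 2 ≤ K) {σ : Fin (2 * K)} {r : ℕ} (hr : r < 2 * pH K + 3) {a : Code K} {z : E 2}
    (hz : z ∈ pZo K (pgE K σ) a) (h1 : z ∈ (fam hK σ).SZ r) (h2 : (0:ℝ) ∈ (fam hK σ).SI r z) : CE σ r a := by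
  refine ⟨fun m a b l => ?_, fun hB => ?_⟩
  · have := h1.2.1 m a b l
    rw [eL_eq hK b] at this
    exact (pZo_sign hz (yEn_le b)).1.1 this
  · obtain ⟨l, hl⟩ := ((fam hK σ).zero_mem hr hz.1).1 h2 hB
    rw [eL_eq hK hB] at hl
    exact ⟨l, (pZo_sign hz (yEn_le hB)).2.1 hl⟩
lemma CO_of (hK : 2 ≤ K) {σ : Fin (2 * K)} {r : ℕ} (hr : r < 2 * pH K + 3) {a : Code K} {z : E 2}
    (hz : z ∈ pZo K (pgO σ) a) (h1 : z ∈ (fam hK σ).SZ r) (h2 : (1:ℝ) ∈ (fam hK σ).SI r z) : CO σ r a := by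
  refine ⟨fun m a b l => ?_, fun m hB => ?_⟩
  · have := h1.2.2 m a b l
    rw [eT_eq hK b] at this
    exact (pZo_sign hz (yOn_le hK b)).1.1 this
  · obtain ⟨l, hl⟩ := ((fam hK σ).one_mem hr hz.1).1 h2 m hB
    have hm : m ≤ pH K := by omega
    rw [eT_eq hK hm] at hl
    exact ⟨l, (pZo_sign hz (yOn_le hK hm)).2.1 hl⟩
lemma sg_zero_dim {a : Code K} {l : Fin K} {y : ℕ} (h : sg a l y = 0) : pdim a = 1 := by
  obtain ⟨r, rfl, hr⟩ := sg_zero h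
  simp only [pdim]; omega
lemma CE_dim {σ : Fin (2 * K)} {r : ℕ} (hr : r < 2 * pH K + 3) {a : Code K} (h : CE σ r a) : pdim a < 3 - r % 2 := by
  have := pdim_le (a := a)
  rcases Nat.mod_two_eq_zero_or_one r with e | e
  · omega
  · obtain ⟨l, hl⟩ := h.2 (by omega)
    have := h.1 (r / 2) (by omega) (by omega) l
    rw [sg_zero_dim (le_antisymm hl this)]; omega
lemma CO_dim {σ : Fin (2 * K)} {r : ℕ} (hr : r < 2 * pH K + 3) {a : Code K} (h : CO σ r a) : pdim a < 3 - r % 2 := by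
  have := pdim_le (a := a)
  rcases Nat.mod_two_eq_zero_or_one r with e | e
  · omega
  · obtain ⟨l, hl⟩ := h.2 (r / 2) (by omega)
    have := h.1 (r / 2) (by omega) (by omega) l
    rw [sg_zero_dim (le_antisymm hl this)]; omega

lemma cc_sub (hK : 2 ≤ K) {i j : Ix K} (h : ∀ z ∈ Zc hK j, z ∈ Zc hK i ∧ (nsq z < 1 → Wc hK j z ⊆ Wc hK i z)) :
    cc hK j ⊆ cc hK i := by
  rintro _ ⟨z, w, h1, h2, rfl, h3, h4⟩
  exact ⟨z, w, h1, h2, rfl, (h z h3).1, fun g => (h z h3).2 g (h4 g)⟩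

lemma node_circle (q : ℝ) : nsq (pt q) = 1 := cp_nsq (pt_pos _)

lemma pageE_sub (hK : 2 ≤ K) {σ : Fin (2 * K)} {r : Fin (2 * pH K + 3)} {π : Fin (2 * K)} {a : Code K}
    (hp : (π:ℕ) = pgE K σ) (h : CE σ r a) : cc hK (.page π a) ⊆ cc hK (.slab σ r) := by
  apply cc_sub
  intro z hz
  change z ∈ pZ K π a at hz
  rw [hp] at hz
  refine ⟨(CE_sub hK r.2 h hz).1, fun hn => ?_⟩
  rintro _ rfl
  exact ⟨0, (CE_sub hK r.2 h hz).2 hn, by rw [gam_zero hK σ.2, hp]⟩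
lemma pageO_sub (hK : 2 ≤ K) {σ : Fin (2 * K)} {r : Fin (2 * pH K + 3)} {π : Fin (2 * K)} {a : Code K}
    (hp : (π:ℕ) = pgO σ) (h : CO σ r a) : cc hK (.page π a) ⊆ cc hK (.slab σ r) := by
  apply cc_sub
  intro z hz
  change z ∈ pZ K π a at hz
  rw [hp] at hz
  refine ⟨(CO_sub hK r.2 h hz).1, fun hn => ?_⟩
  rintro _ rfl
  exact ⟨1, (CO_sub hK r.2 h hz).2 hn, by rw [gam_one, hp]⟩
lemma slab_sub (hK : 2 ≤ K) {σ : Fin (2 * K)} {r r' : Fin (2 * pH K + 3)}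
    (h1 : ((r':ℕ) + 1) / 2 ≤ ((r:ℕ) + 1) / 2) (h2 : (r:ℕ) / 2 ≤ (r':ℕ) / 2) :
    cc hK (.slab σ r) ⊆ cc hK (.slab σ r') := by
  apply cc_sub
  intro z hz
  exact ⟨(fam hK σ).SZ_mono h1 h2 hz, fun hn => image_mono ((fam hK σ).SI_mono r.2 r'.2 h1 h2 hn)⟩
lemma page_sub (hK : 2 ≤ K) {π : Fin (2 * K)} {a b : Code K} (h : compat a b) :
    cc hK (.page π a) ⊆ cc hK (.page π b) :=
  cc_sub hK fun _ hz => ⟨compat_sub h hz, fun _ => subset_rfl⟩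
lemma circ_sub (hK : 2 ≤ K) {i j : Ix K} (hj : ∀ z ∈ Zc hK j, nsq z = 1) (h : Zc hK j ⊆ Zc hK i) : cc hK j ⊆ cc hK i :=
  cc_sub hK fun z hz => ⟨h hz, fun hn => absurd (hj z hz) hn.ne⟩

lemma fin_nat_cast {M : ℕ} (q : Fin M) : (((q:ℕ):ℝ) - 1) = (((q:ℕ):ℤ) - 1 : ℤ) := by push_cast; rfl
lemma q_range {M : ℕ} (q : Fin M) : -1 ≤ ((q:ℕ):ℤ) - 1 ∧ ((q:ℕ):ℤ) - 1 ≤ M - 2 := by have := q.2; omega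

theorem Tlem (hK : 2 ≤ K) {i j : Ix K} (h : (co hK j ∩ cc hK i).Nonempty) : j = i ∨ (dd j < dd i ∧ cc hK j ⊆ cc hK i) := by
  obtain ⟨_, ⟨z, w, hz, hw, rfl, hj, hwj⟩, hi⟩ := h
  rw [mem_cc hK hz hw] at hi
  obtain ⟨hi, hwi⟩ := hi
  match j, i with
  | .node q, .node q' =>
    left
    have := pt_inj ((show z = pt ((q:ℝ) - 1) from hj).symm.trans (show z = pt ((q':ℝ) - 1) from hi))
    congr 1; ext
    have : (q:ℝ) = q' := by linarith
    exact_mod_cast this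
  | .node q, .arc q' =>
    right; exact ⟨by simp [dd], circ_sub hK (by rintro _ rfl; exact node_circle _) (by rintro _ rfl; exact (show z = pt ((q:ℝ) - 1) from hj) ▸ hi)⟩
  | .node q, .page π a =>
    have := pdim_le (a := a)
    right; exact ⟨by simp only [dd]; omega, circ_sub hK (by rintro _ rfl; exact node_circle _) (by rintro _ rfl; exact (show z = pt ((q:ℝ) - 1) from hj) ▸ hi)⟩
  | .node q, .slab σ r =>
    right; exact ⟨by simp only [dd]; omega, circ_sub hK (by rintro _ rfl; exact node_circle _) (by rintro _ rfl; exact (show z = pt ((q:ℝ) - 1) from hj) ▸ hi)⟩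
  | .arc q, .node q' =>
    exfalso
    have e : z = pt ((q':ℝ) - 1) := hi
    have hj : z ∈ arcO (pM K) q := hj
    rw [e, fin_nat_cast] at hj
    exact arcO_node (pM_ge hK) q.2 (q_range q') hj
  | .arc q, .arc q' =>
    left; congr 1; ext; exact arc_disj (pM_ge hK) q.2 q'.2 hj hi
  | .arc q, .page π a =>
    have := page_arc hK π.2 hj hi
    right; exact ⟨by simp only [dd]; omega, circ_sub hK (fun z hz => arc_circle hz) this.1⟩
  | .arc q, .slab σ r =>
    have := slab_arc hK hj hi
    right; exact ⟨by simp only [dd]; omega, circ_sub hK (fun z hz => arc_circle hz) this⟩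
  | .page π a, .node q' =>
    have hj : z ∈ pZo K π a := hj
    have e : z = pt ((q':ℝ) - 1) := hi
    exact absurd (e ▸ node_circle _) hj.1.ne
  | .page π a, .arc q' =>
    have hj : z ∈ pZo K π a := hj
    exact absurd (arc_circle hi) hj.1.ne
  | .page π a, .page π' b =>
    have hj : z ∈ pZo K π a := hj
    have e1 : w = th K π := hwj hj.1
    have e2 : w = th K π' := hwi hj.1
    have e3 : π = π' := Fin.ext (th_nat_inj hK π.2 π'.2 (e1 ▸ e2))
    subst e3
    have hc := page_compat hj hi
    by_cases hab : a = b
    · left; rw [hab]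
    · right; exact ⟨compat_dim hc hab, page_sub hK hc⟩
  | .page π a, .slab σ r =>
    have hj : z ∈ pZo K π a := hj
    have e1 : w = th K π := hwj hj.1
    obtain ⟨τ, hτ, e2⟩ := hwi hj.1
    right
    rcases gam_eq_th hK σ.2 π.2 ((fam hK σ).SI_unit r.2 hτ) (e2.trans e1) with ⟨rfl, hp⟩ | ⟨rfl, hp⟩
    · rw [hp] at hj
      have := CE_of hK r.2 hj hi hτ
      exact ⟨CE_dim r.2 this, pageE_sub hK hp this⟩
    · rw [hp] at hj
      have := CO_of hK r.2 hj hi hτ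
      exact ⟨CO_dim r.2 this, pageO_sub hK hp this⟩
  | .slab σ r, .node q' =>
    have hj : z ∈ (fam hK σ).SZo r := hj
    have e : z = pt ((q':ℝ) - 1) := hi
    exact absurd (e ▸ node_circle _) hj.1.ne
  | .slab σ r, .arc q' =>
    have hj : z ∈ (fam hK σ).SZo r := hj
    exact absurd (arc_circle hi) hj.1.ne
  | .slab σ r, .page π a =>
    have hj : z ∈ (fam hK σ).SZo r := hj
    obtain ⟨τ, hτ, e2⟩ := hwj hj.1
    have e1 : w = th K π := hwi hj.1
    exact absurd (e2.trans e1) (gam_ne_th hK σ.2 π.2 ((fam hK σ).SIo_unit r.2 hj hτ))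
  | .slab σ r, .slab σ' r' =>
    have hj : z ∈ (fam hK σ).SZo r := hj
    obtain ⟨τ, hτ, e1⟩ := hwj hj.1
    obtain ⟨τ', hτ', e2⟩ := hwi hj.1
    have := gam_eq_gam hK σ.2 σ'.2 ((fam hK σ).SIo_unit r.2 hj hτ) ((fam hK σ').SI_unit r'.2 hτ') (e1.trans e2.symm)
    have e3 : σ = σ' := Fin.ext this.1
    subst e3
    rw [← this.2] at hτ'
    have hs := (fam hK σ).slab_slab r.2 r'.2 hj hτ hτ'
    by_cases hrr : (r:ℕ) = r'
    · left; congr 1; exact Fin.ext hrr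
    · right; exact ⟨by simp only [dd]; omega, slab_sub hK hs.1 hs.2⟩

theorem cover (hK : 2 ≤ K) : (⋃ i : Ix K, co hK i) = sphere (0 : E 4) 1 := by
  apply Subset.antisymm
  · apply iUnion_subset
    rintro i _ ⟨z, w, h1, h2, rfl, -⟩
    exact Phi_sphere h1 h2
  · intro x hx
    obtain ⟨z, w, hz, hw, rfl⟩ := Phi_surj hx
    rw [mem_iUnion]
    simp only [mem_co hK hz hw]
    rcases hz.eq_or_lt with hn | hn
    · obtain ⟨q, hq, h | h⟩ := circle_cover (pM_ge hK) hn
      · exact ⟨.node ⟨q, hq⟩, h, fun h => absurd hn h.ne⟩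
      · exact ⟨.arc ⟨q, hq⟩, h, fun h => absurd hn h.ne⟩
    · rcases w_cover hK hw with ⟨π, hπ, rfl⟩ | ⟨σ, hσ, t, ht, rfl⟩
      · obtain ⟨a, ha⟩ := page_cover hπ hn
        exact ⟨.page ⟨π, hπ⟩ a, ha, fun _ => rfl⟩
      · obtain ⟨r, hr, h1, h2⟩ := (fam hK ⟨σ, hσ⟩).slab_cover hn ht
        exact ⟨.slab ⟨σ, hσ⟩ ⟨r, hr⟩, h1, fun _ => ⟨t, h2, rfl⟩⟩

lemma graph_eq {Z : Set (E 2)} {W : E 2 → Set ℂ} (w : E 2 → ℂ) (hw : ∀ z, ‖w z‖ = 1) (hZ : ∀ z ∈ Z, nsq z ≤ 1)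
    (h1 : ∀ z ∈ Z, nsq z < 1 → W z = {w z}) :
    {x | ∃ z w, nsq z ≤ 1 ∧ ‖w‖ = 1 ∧ Phi z w = x ∧ z ∈ Z ∧ (nsq z < 1 → w ∈ W z)} = (fun z => Phi z (w z)) '' Z := by
  ext x
  constructor
  · rintro ⟨z, w', a, b, rfl, c, d⟩
    refine ⟨z, c, ?_⟩
    rcases a.eq_or_lt with e | e
    · exact Phi_circle e.ge
    · have := d e
      rw [h1 z c e] at this
      rw [show w' = w z from this]
  · rintro ⟨z, hz, rfl⟩
    exact ⟨z, w z, hZ z hz, hw z, rfl, hz, fun h => by rw [h1 z hz h]; rfl⟩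

theorem cell (hK : 2 ≤ K) (i : Ix K) : IsCell (dd i) (cc hK i) (co hK i) := by
  have one : ∀ _ : E 2, ‖(1:ℂ)‖ = 1 := fun _ => by simp
  match i with
  | .node q =>
    have hc : ∀ z ∈ ({pt ((q:ℝ) - 1)} : Set (E 2)), nsq z = 1 := by rintro _ rfl; exact node_circle _
    have e1 : cc hK (.node q) = _ := graph_eq (fun _ => 1) one (fun z hz => (hc z hz).le) (fun z hz h => absurd (hc z hz) h.ne)
    have e2 : co hK (.node q) = _ := graph_eq (fun _ => 1) one (fun z hz => (hc z hz).le) (fun z hz h => absurd (hc z hz) h.ne)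
    rw [e1, e2]
    exact graph_cell (IsCell.point _) (fun z hz => (hc z hz).le) _ one (fun z hz h => absurd (hc z hz) h.ne)
  | .arc q =>
    have hc : ∀ z ∈ arcC (pM K) q, nsq z = 1 := fun z hz => arc_circle hz
    have hc' : ∀ z ∈ arcO (pM K) q, nsq z = 1 := fun z hz => arc_circle (arcO_sub hz)
    have e1 : cc hK (.arc q) = _ := graph_eq (fun _ => 1) one (fun z hz => (hc z hz).le) (fun z hz h => absurd (hc z hz) h.ne)
    have e2 : co hK (.arc q) = _ := graph_eq (fun _ => 1) one (fun z hz => (hc' z hz).le) (fun z hz h => absurd (hc' z hz) h.ne)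
    rw [e1, e2]
    exact graph_cell (arc_cell (pM_ge hK) q) (fun z hz => (hc z hz).le) _ one (fun z hz h => absurd (hc z hz) h.ne)
  | .page π a =>
    have e1 : cc hK (.page π a) = _ := graph_eq (fun _ => th K π) (fun _ => th_norm _) (fun z hz => hz.1) (fun z hz h => rfl)
    have e2 : co hK (.page π a) = _ := graph_eq (fun _ => th K π) (fun _ => th_norm _) (fun z hz => hz.1.le) (fun z hz h => rfl)
    rw [e1, e2]
    exact graph_cell (page_cell hK π.2 a) (fun z hz => hz.1) _ (fun _ => th_norm _) (fun z hz h => continuousAt_const)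
  | .slab σ r =>
    have hr := r.2
    have R := slab_region_cell hK σ r.2
    rcases Nat.mod_two_eq_zero_or_one r with e | e
    · have hd : dd (.slab σ r : Ix K) = 3 := by simp only [dd]; omega
      rw [hd]
      set F := fam hK σ with hF
      have L := lens_cell R (fun z hz => hz.1) (fun z hz => hz.1) (f := F.lam ((r:ℕ) / 2 + 1)) (g := F.lam (((r:ℕ) + 1) / 2))
        (fun z _ h => F.lam_cont (by omega) h) (fun z _ h => F.lam_cont (by omega) h)
        (fun z hz => F.lam_strict (by omega) (by omega) hz.1 ((F.SZo_iff r.2 hz.1).1 hz).1 ((F.SZo_iff r.2 hz.1).1 hz).2)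
        (fun z _ h1 h2 => F.SZ_edge r.2 h1 h2)
        (fun z _ _ => F.lam_nonneg (by omega) z) (fun z _ _ => F.lam_le_one (by omega) z)
        (gam_cont (K := K) σ) (gam_norm σ) (gam_inj hK σ)
      convert L using 1
      · ext x
        constructor
        · rintro ⟨z, w, h1, h2, rfl, h3, h4⟩
          have h3 : z ∈ F.SZ r := h3
          rcases h1.eq_or_lt with g | g
          · exact ⟨z, h3, 0, ⟨le_rfl, zero_le_one⟩, Phi_circle g.ge⟩
          · obtain ⟨τ, hτ, rfl⟩ := h4 g
            have hτ : F.lam ((r:ℕ) / 2 + 1) z ≤ τ ∧ τ ≤ F.lam (((r:ℕ) + 1) / 2) z := hτ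
            rcases (hτ.1.trans hτ.2).eq_or_lt with e | e
            · refine ⟨z, h3, 0, ⟨le_rfl, zero_le_one⟩, ?_⟩
              rw [zero_mul, add_zero]; congr 2; linarith
            · have hp : 0 < F.lam (((r:ℕ) + 1) / 2) z - F.lam ((r:ℕ) / 2 + 1) z := by linarith
              refine ⟨z, h3, (τ - F.lam ((r:ℕ) / 2 + 1) z) / (F.lam (((r:ℕ) + 1) / 2) z - F.lam ((r:ℕ) / 2 + 1) z), ⟨?_, ?_⟩, ?_⟩
              · exact div_nonneg (by linarith) hp.le
              · rw [div_le_one hp]; linarith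
              · rw [div_mul_cancel₀ _ hp.ne']; congr 2; ring
        · rintro ⟨z, hz, s, hs, rfl⟩
          refine ⟨z, _, hz.1, gam_norm _ _, rfl, hz, fun hn => ⟨_, ?_, rfl⟩⟩
          have := F.lam_anti (t := ((r:ℕ) + 1) / 2) (t' := (r:ℕ) / 2 + 1) (by omega) (by omega) hn
          constructor
          · linarith [mul_nonneg hs.1 (sub_nonneg.2 this)]
          · linarith [mul_le_mul_of_nonneg_right hs.2 (sub_nonneg.2 this)]
      · ext x
        constructor
        · rintro ⟨z, w, h1, h2, rfl, h3, h4⟩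
          have h3 : z ∈ F.SZo r := h3
          obtain ⟨τ, hτ, rfl⟩ := h4 h3.1
          have hτ := hτ.2 e
          have hp : 0 < F.lam (((r:ℕ) + 1) / 2) z - F.lam ((r:ℕ) / 2 + 1) z := by linarith
          refine ⟨z, h3, (τ - F.lam ((r:ℕ) / 2 + 1) z) / (F.lam (((r:ℕ) + 1) / 2) z - F.lam ((r:ℕ) / 2 + 1) z), ⟨?_, ?_⟩, ?_⟩
          · exact div_pos (by linarith) hp
          · rw [div_lt_one hp]; linarith
          · rw [div_mul_cancel₀ _ hp.ne']; congr 2; ring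
        · rintro ⟨z, hz, s, hs, rfl⟩
          refine ⟨z, _, hz.1.le, gam_norm _ _, rfl, hz, fun hn => ⟨_, ?_, rfl⟩⟩
          have := F.lam_strict (t := ((r:ℕ) + 1) / 2) (t' := (r:ℕ) / 2 + 1) (by omega) (by omega) hn ((F.SZo_iff r.2 hz.1).1 hz).1 ((F.SZo_iff r.2 hz.1).1 hz).2
          have a1 : 0 < s * (F.lam (((r:ℕ) + 1) / 2) z - F.lam ((r:ℕ) / 2 + 1) z) := mul_pos hs.1 (sub_pos.2 this)
          have a2 := mul_lt_mul_of_pos_right hs.2 (sub_pos.2 this)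
          exact ⟨⟨by linarith, by linarith⟩, fun _ => ⟨by linarith, by linarith⟩⟩
    · have hd : dd (.slab σ r : Ix K) = 2 := by simp only [dd]; omega
      rw [hd]
      set F := fam hK σ with hF
      have e2 : (r:ℕ) / 2 + 1 = ((r:ℕ) + 1) / 2 := by omega
      have f1 : cc hK (.slab σ r) = _ := graph_eq (Z := F.SZ r) (fun z => gam K σ (F.lam (((r:ℕ) + 1) / 2) z)) (fun _ => gam_norm _ _) (fun z hz => hz.1)
        (fun z hz h => by
          show gam K σ '' F.SI r z = _
          unfold Fam.SI; rw [e2, Icc_self, image_singleton])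
      have f2 : co hK (.slab σ r) = _ := graph_eq (Z := F.SZo r) (fun z => gam K σ (F.lam (((r:ℕ) + 1) / 2) z)) (fun _ => gam_norm _ _) (fun z hz => hz.1.le)
        (fun z hz h => by
          show gam K σ '' F.SIo r z = _
          have : F.SIo r z = {F.lam (((r:ℕ) + 1) / 2) z} := by
            ext τ
            simp only [Fam.SIo, Fam.SI, e2, Icc_self, mem_setOf_eq, mem_singleton_iff]
            exact ⟨fun h => h.1, fun h => ⟨h, fun h => by omega⟩⟩
          rw [this, image_singleton])
      rw [f1, f2]
      exact graph_cell R (fun z hz => hz.1) _ (fun _ => gam_norm _ _)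
        (fun z _ h => (gam_cont σ).continuousAt.comp (F.lam_cont (by omega) h))

end
end FatS
end

section
open Metric Set Topology
namespace FatS
section
variable {K : ℕ}

/-- unmarked cells -/
def um : Ix K → Prop
  | .node _ => True
  | .arc _ => True
  | .page _ none => False
  | .page _ (some (_, r)) => 0 < (r:ℕ)
  | .slab _ r => 0 < (r:ℕ) ∧ (r:ℕ) < 2 * pH K + 2

def VV (hK : 2 ≤ K) (x : Ix K) (i : ℕ) (n : ℤ) : Prop :=
  (i < 2 * K ∧ 0 ≤ n ∧ n ≤ pT K) ∧ pt (posn K i n) ∈ Zc hK x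

lemma slab_VV (hK : 2 ≤ K) {σ : Fin (2 * K)} {r : Fin (2 * pH K + 3)} (hr : um (.slab σ r)) {i : ℕ} {n : ℤ} :
    VV hK (.slab σ r) i n ↔ i < 2 * K ∧ uu K σ i + ((((r:ℕ) - 1) / 2 : ℕ) : ℤ) ≤ n ∧ n ≤ uu K σ i + (((r:ℕ) / 2 : ℕ) : ℤ) := by
  obtain ⟨h0, h1⟩ : 0 < (r:ℕ) ∧ (r:ℕ) < 2 * pH K + 2 := hr
  have key : i < 2 * K → 0 ≤ n → n ≤ pT K → (pt (posn K i n) ∈ (fam hK σ).SZ r ↔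
     uu K σ i + ((((r:ℕ) - 1) / 2 : ℕ) : ℤ) ≤ n ∧ n ≤ uu K σ i + (((r:ℕ) / 2 : ℕ) : ℤ)) := by
    intro hi n0 n1
    rw [slab_V hK hi n0 n1]
    constructor
    · rintro ⟨a, b⟩
      exact ⟨a _ (by omega) (by omega), b _ le_rfl (by omega)⟩
    · rintro ⟨a, b⟩
      refine ⟨fun m h h' => ?_, fun m h h' => ?_⟩
      · have : (m:ℤ) ≤ ((((r:ℕ) - 1) / 2 : ℕ) : ℤ) := by omega
        linarith
      · have : (((r:ℕ) / 2 : ℕ) : ℤ) ≤ m := by omega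
        linarith
  constructor
  · rintro ⟨⟨a, b, c⟩, d⟩
    exact ⟨a, (key a b c).1 d⟩
  · rintro ⟨a, b, c⟩
    have A := um_range hK σ.2 a (m := ((((r:ℕ) - 1) / 2 : ℕ) : ℤ)) (by omega) (by omega)
    have B := um_range hK σ.2 a (m := (((r:ℕ) / 2 : ℕ) : ℤ)) (by omega) (by omega)
    exact ⟨⟨a, by linarith, by linarith⟩, (key a (by linarith) (by linarith)).2 ⟨b, c⟩⟩

lemma yo_cases (π i : ℕ) (n : ℤ) :
    (π % 2 = 0 ∧ yo K π i n = n - (1 + fE K π i)) ∨ (π % 2 = 1 ∧ yo K π i n = 1 + gO K π i + pY K - n) := by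
  unfold yo dev hgt
  rcases Nat.mod_two_eq_zero_or_one π with h | h <;> simp [h]

lemma page_VV (hK : 2 ≤ K) {π : Fin (2 * K)} {l : Fin K} {r : Fin (2 * pY K + 2)} (hr : um (.page π (some (l, r)))) {i : ℕ} {n : ℤ} :
    VV hK (.page π (some (l, r))) i n ↔ i < 2 * K ∧ inP K π l i ∧ ((((r:ℕ) - 1) / 2 : ℕ) : ℤ) ≤ yo K π i n ∧
      yo K π i n ≤ (((r:ℕ) / 2 : ℕ) : ℤ) := by
  have h0 : 0 < (r:ℕ) := hr
  constructor
  · rintro ⟨⟨a, b, c⟩, d⟩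
    have := (page_V π.2 a b c).1 d
    exact ⟨a, this.1, this.2.1 h0, this.2.2⟩
  · rintro ⟨a, b, c, d⟩
    have := r_half r
    have R := hgt_range π.2 a (y := yo K π i n) (by omega) (by omega)
    rw [hgt_yo] at R
    exact ⟨⟨a, by omega, by omega⟩, (page_V π.2 a (by omega) (by omega)).2 ⟨b, fun _ => c, d⟩⟩

def adj (σ π : Fin (2 * K)) : Prop := (π:ℕ) = pgE K σ ∨ (π:ℕ) = pgO σ

lemma adj_self (π : Fin (2 * K)) : adj π π := by
  unfold adj pgE pgO
  rcases Nat.mod_two_eq_zero_or_one π with h | h <;> simp [h]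

lemma slab_PR (hK : 2 ≤ K) {σ : Fin (2 * K)} {r : Fin (2 * pH K + 3)} (hr : um (.slab σ r)) {π : Fin (2 * K)} (h : adj σ π)
    (l : Fin K) : ∃ a b : ℕ, a ≤ b ∧ b ≤ a + 1 ∧ b ≤ pY K ∧
      (∀ i n, inP K π l i → (VV hK (.slab σ r) i n ↔ i < 2 * K ∧ (a:ℤ) ≤ yo K π i n ∧ yo K π i n ≤ b)) ∧
      (((π:ℕ) = pgE K σ ∧ (∀ m, m ≤ ((r:ℕ) - 1) / 2 → yEn K σ l m ≤ a) ∧ yEn K σ l ((r:ℕ) / 2) = b) ∨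
       ((π:ℕ) = pgO σ ∧ (∀ m, (r:ℕ) / 2 ≤ m → m ≤ pH K → yOn K σ l m ≤ a) ∧ yOn K σ l (((r:ℕ) - 1) / 2) = b)) := by
  obtain ⟨h0, h1⟩ : 0 < (r:ℕ) ∧ (r:ℕ) < 2 * pH K + 2 := hr
  have m0 : ((r:ℕ) - 1) / 2 ≤ pH K := by omega
  have m1 : (r:ℕ) / 2 ≤ pH K := by omega
  rcases h with h | h
  · refine ⟨yEn K σ l (((r:ℕ) - 1) / 2), yEn K σ l ((r:ℕ) / 2), ?_, ?_, yEn_le m1, ?_, .inl ⟨h, ?_, rfl⟩⟩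
    · zify; rw [yEn_cast m0, yEn_cast m1]; unfold yE; omega
    · zify; rw [yEn_cast m0, yEn_cast m1]; unfold yE; omega
    · intro i n hi
      rw [slab_VV hK ⟨h0, h1⟩, yEn_cast m0, yEn_cast m1]
      rw [h] at hi ⊢
      have A := yo_yE σ.2 hi ((((r:ℕ) - 1) / 2 : ℕ) : ℤ) n
      have B := yo_yE σ.2 hi (((r:ℕ) / 2 : ℕ) : ℤ) n
      refine and_congr_right fun _ => and_congr ?_ ?_ <;> constructor <;> intro <;> linarith
    · intro m hm
      zify; rw [yEn_cast m0, yEn_cast (hm.trans m0)]; unfold yE; omega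
  · refine ⟨yOn K σ l ((r:ℕ) / 2), yOn K σ l (((r:ℕ) - 1) / 2), ?_, ?_, yOn_le hK m0, ?_, .inr ⟨h, ?_, rfl⟩⟩
    · zify; rw [yOn_cast hK m0, yOn_cast hK m1]; unfold yO; omega
    · zify; rw [yOn_cast hK m0, yOn_cast hK m1]; unfold yO; omega
    · intro i n hi
      rw [slab_VV hK ⟨h0, h1⟩, yOn_cast hK m0, yOn_cast hK m1]
      rw [h] at hi ⊢
      have A := yo_yO hi ((((r:ℕ) - 1) / 2 : ℕ) : ℤ) n
      have B := yo_yO hi (((r:ℕ) / 2 : ℕ) : ℤ) n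
      refine and_congr_right fun _ => ?_
      constructor
      · rintro ⟨a, b⟩; exact ⟨by linarith, by linarith⟩
      · rintro ⟨a, b⟩; exact ⟨by linarith, by linarith⟩
    · intro m hm hm'
      zify; rw [yOn_cast hK m1, yOn_cast hK hm']; unfold yO; omega

/-- height window in a slice -/
def WR (hK : 2 ≤ K) (x : Ix K) (σ : Fin (2 * K)) : Prop :=
  ∃ a : ℤ, ∀ i n, VV hK x i n → uu K σ i + a ≤ n ∧ n ≤ uu K σ i + a + 1

lemma slab_WR (hK : 2 ≤ K) {σ : Fin (2 * K)} {r : Fin (2 * pH K + 3)} (hr : um (.slab σ r)) : WR hK (.slab σ r) σ := by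
  refine ⟨((((r:ℕ) - 1) / 2 : ℕ) : ℤ), fun i n h => ?_⟩
  have := (slab_VV hK hr).1 h
  have : (0:ℕ) < r := hr.1
  omega
lemma page_WR (hK : 2 ≤ K) {π : Fin (2 * K)} {l : Fin K} {r : Fin (2 * pY K + 2)} (hr : um (.page π (some (l, r)))) :
    WR hK (.page π (some (l, r))) π := by
  have r0 : (0:ℕ) < r := hr
  rcases adj_self π with e | e
  · refine ⟨((((r:ℕ) - 1) / 2 : ℕ) : ℤ) - yE K π l 0, fun i n h => ?_⟩
    obtain ⟨h1, h2, h3, h4⟩ := (page_VV hK hr).1 h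
    rw [e] at h2 h3 h4
    have := yo_yE π.2 h2 0 n
    omega
  · refine ⟨yO K π l 0 - (((r:ℕ) / 2 : ℕ) : ℤ), fun i n h => ?_⟩
    obtain ⟨h1, h2, h3, h4⟩ := (page_VV hK hr).1 h
    rw [e] at h2 h3 h4
    have := yo_yO h2 0 n
    omega

lemma int_mul_big {a b : ℤ} {c : ℤ} (h : a * b ≠ 0) (hc : 0 ≤ c) : c ≤ |c * (a * b)| := by
  rw [abs_mul, abs_of_nonneg hc]
  have := Int.one_le_abs h
  nlinarith

lemma K3_arith {e e' o o' p p' q q' k : ℤ} (hk : 2 ≤ k) (he : 0 ≤ e ∧ e ≤ 2 * k - 2) (he' : 0 ≤ e' ∧ e' ≤ 2 * k - 2)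
    (hp : 0 ≤ p ∧ p ≤ k - 1) (hp' : 0 ≤ p' ∧ p' ≤ k - 1)
    (h : |(3 * e * p + 6 * k ^ 2 * o * q - (3 * e' * p + 6 * k ^ 2 * o' * q)) -
      (3 * e * p' + 6 * k ^ 2 * o * q' - (3 * e' * p' + 6 * k ^ 2 * o' * q'))| ≤ 2) :
    (o = o' ∨ q = q') ∧ (e = e' ∨ p = p') := by
  have h' : |3 * ((e - e') * (p - p')) + 6 * k ^ 2 * ((o - o') * (q - q'))| ≤ 2 := by
    convert h using 2; ring
  have b1 : |(e - e') * (p - p')| ≤ (2 * k - 2) * (k - 1) := by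
    rw [abs_mul]
    apply mul_le_mul _ _ (abs_nonneg _) (by linarith)
    · rw [abs_le]; constructor <;> linarith [he.1, he.2, he'.1, he'.2]
    · rw [abs_le]; constructor <;> linarith [hp.1, hp.2, hp'.1, hp'.2]
  have c1 : (o - o') * (q - q') = 0 := by
    by_contra hne
    have := int_mul_big hne (c := 6 * k ^ 2) (by positivity)
    have b2 := abs_sub_abs_le_abs_sub (6 * k ^ 2 * ((o - o') * (q - q'))) (-(3 * ((e - e') * (p - p'))))
    rw [abs_neg, abs_mul 3, show |(3:ℤ)| = 3 by norm_num] at b2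
    rw [show 6 * k ^ 2 * ((o - o') * (q - q')) - -(3 * ((e - e') * (p - p'))) = 3 * ((e - e') * (p - p')) + 6 * k ^ 2 * ((o - o') * (q - q')) by ring] at b2
    nlinarith
  have c2 : (e - e') * (p - p') = 0 := by
    by_contra hne
    have := int_mul_big hne (c := 3) (by norm_num)
    rw [c1, mul_zero, add_zero] at h'
    linarith
  rcases mul_eq_zero.1 c1 with x | x <;> rcases mul_eq_zero.1 c2 with y | y <;> omega

lemma half_hh {i j : ℕ} (hK : 2 ≤ K) (hi : i < 2 * K) (hj : j < 2 * K) (h : i / 2 = j / 2) (h' : hh K i = hh K j) : i = j := by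
  rw [hh_eq hi, hh_eq hj] at h'
  split_ifs at h' <;> omega

lemma K3 (hK : 2 ≤ K) {x y : Ix K} {σ σ' : Fin (2 * K)} (hx : WR hK x σ) (hy : WR hK y σ') (hσ : σ ≠ σ') {i i' : ℕ} {n n' : ℤ} (hi : i ≠ i')
    (h1 : VV hK x i n) (h2 : VV hK y i n) (h3 : VV hK x i' n') (h4 : VV hK y i' n') :
    (pgE K σ = pgE K σ' ∧ i / 2 = i' / 2) ∨ (pgO σ = pgO σ' ∧ hh K i = hh K i') := by
  obtain ⟨a, ha⟩ := hx
  obtain ⟨b, hb⟩ := hy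
  have A := ha _ _ h1
  have B := hb _ _ h2
  have C := ha _ _ h3
  have D := hb _ _ h4
  have hi1 := h1.1.1
  have hi2 := h3.1.1
  have ev : ∀ s : Fin (2 * K), 0 ≤ (pgE K s : ℤ) ∧ (pgE K s : ℤ) ≤ 2 * K - 2 := fun s => by
    have := pgE_lt hK s.2; have := pgE_even s.2; omega
  have hr : ∀ j, j < 2 * K → 0 ≤ (hh K j : ℤ) ∧ (hh K j : ℤ) ≤ K - 1 := fun j hj => by
    have := hh_lt hj; omega
  have key : |(3 * (pgE K σ:ℤ) * hh K i + 6 * (K:ℤ) ^ 2 * pgO σ * (i / 2 : ℕ) - (3 * (pgE K σ':ℤ) * hh K i + 6 * (K:ℤ) ^ 2 * pgO σ' * (i / 2 : ℕ))) -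
      (3 * (pgE K σ:ℤ) * hh K i' + 6 * (K:ℤ) ^ 2 * pgO σ * (i' / 2 : ℕ) - (3 * (pgE K σ':ℤ) * hh K i' + 6 * (K:ℤ) ^ 2 * pgO σ' * (i' / 2 : ℕ)))| ≤ 2 := by
    have e : ∀ (s : Fin (2 * K)) j, uu K s j = 1 + (3 * (pgE K s:ℤ) * hh K j + 6 * (K:ℤ) ^ 2 * pgO s * (j / 2 : ℕ)) := by
      intro s j
      unfold uu fE gO pB; push_cast; ring
    rw [e] at A B C D
    rw [abs_le]
    constructor <;> linarith [A.1, A.2, B.1, B.2, C.1, C.2, D.1, D.2]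
  obtain ⟨c1, c2⟩ := K3_arith (by exact_mod_cast hK) (ev σ) (ev σ') (hr i hi1) (hr i' hi2) key
  have n1 : ¬ (pgE K σ = pgE K σ' ∧ pgO σ = pgO σ') := fun h => hσ (Fin.ext (pg_inj hK σ.2 σ'.2 h.1 h.2))
  have n2 : ¬ (i / 2 = i' / 2 ∧ hh K i = hh K i') := fun h => hi (half_hh hK hi1 hi2 h.1 h.2)
  norm_cast at c1 c2
  tauto

end
end FatS
end

section
open Metric Set Topology
namespace FatS
section
variable {K : ℕ}

lemma inP_same {π π' l l' i i' : ℕ} (hK : 2 ≤ K) (hi : i < 2 * K) (hi' : i' < 2 * K) (hne : i ≠ i')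
    (h1 : inP K π l i) (h2 : inP K π l i') (h3 : inP K π' l' i) (h4 : inP K π' l' i') : π % 2 = π' % 2 := by
  rcases Nat.mod_two_eq_zero_or_one π with e | e <;> rcases Nat.mod_two_eq_zero_or_one π' with e' | e'
  · omega
  · rw [inP_even e] at h1 h2; rw [inP_odd e'] at h3 h4
    exact absurd (half_hh hK hi hi' (h1.trans h2.symm) (h3.trans h4.symm)) hne
  · rw [inP_odd e] at h1 h2; rw [inP_even e'] at h3 h4
    exact absurd (half_hh hK hi hi' (h3.trans h4.symm) (h1.trans h2.symm)) hne
  · omega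

lemma pgE_self {π : ℕ} (h : π % 2 = 0) : pgE K π = π := by simp [pgE, h]
lemma pgO_self {π : ℕ} (h : π % 2 = 1) : pgO π = π := by simp [pgO, h]

lemma two_ps (hK : 2 ≤ K) {π : Fin (2 * K)} {l : Fin K} {r : Fin (2 * pY K + 2)} (hr : um (.page π (some (l, r))))
    {y : Ix K} {σ : Fin (2 * K)} (hy : WR hK y σ) {i i' : ℕ} {n n' : ℤ} (hi : i ≠ i')
    (h1 : VV hK (.page π (some (l, r))) i n) (h2 : VV hK y i n) (h3 : VV hK (.page π (some (l, r))) i' n') (h4 : VV hK y i' n') :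
    adj σ π := by
  by_cases hσ : π = σ
  · subst hσ; exact adj_self _
  have A := ((page_VV hK hr).1 h1)
  have B := ((page_VV hK hr).1 h3)
  rcases K3 hK (page_WR hK hr) hy hσ hi h1 h2 h3 h4 with ⟨a, b⟩ | ⟨a, b⟩
  · left
    rcases Nat.mod_two_eq_zero_or_one π with e | e
    · rw [← a, pgE_self e]
    · have c := A.2.1; have d := B.2.1
      rw [inP_odd e] at c d
      exact absurd (half_hh hK A.1 B.1 b (c.trans d.symm)) hi
  · right
    rcases Nat.mod_two_eq_zero_or_one π with e | e
    · have c := A.2.1; have d := B.2.1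
      rw [inP_even e] at c d
      exact absurd (half_hh hK A.1 B.1 (c.trans d.symm) b) hi
    · rw [← a, pgO_self e]

lemma two_pp (hK : 2 ≤ K) {π : Fin (2 * K)} {l : Fin K} {r : Fin (2 * pY K + 2)} (hr : um (.page π (some (l, r))))
    {π' : Fin (2 * K)} {l' : Fin K} {r' : Fin (2 * pY K + 2)} (hr' : um (.page π' (some (l', r'))))
    {i i' : ℕ} {n n' : ℤ} (hi : i ≠ i')
    (h1 : VV hK (.page π (some (l, r))) i n) (h2 : VV hK (.page π' (some (l', r'))) i n)
    (h3 : VV hK (.page π (some (l, r))) i' n') (h4 : VV hK (.page π' (some (l', r'))) i' n') :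
    π = π' ∧ l = l' := by
  have ad := two_ps hK hr (page_WR hK hr') hi h1 h2 h3 h4
  have A := ((page_VV hK hr).1 h1)
  have B := ((page_VV hK hr).1 h3)
  have C := ((page_VV hK hr').1 h2)
  have D := ((page_VV hK hr').1 h4)
  have par := inP_same hK A.1 B.1 hi A.2.1 B.2.1 C.2.1 D.2.1
  have hπ : π = π' := by
    apply Fin.ext
    rcases ad with e | e
    · have := pgE_even π'.2
      rw [e, pgE_self (by omega)]
    · have := pgO_odd π'
      rw [e, pgO_self (by omega)]
  subst hπ
  exact ⟨rfl, Fin.ext (inP_uniq A.2.1 C.2.1)⟩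

lemma two_ss (hK : 2 ≤ K) {x y : Ix K} {σ σ' : Fin (2 * K)} (hx : WR hK x σ) (hy : WR hK y σ') (hσ : σ ≠ σ') {i i' : ℕ} {n n' : ℤ} (hi : i ≠ i')
    (h1 : VV hK x i n) (h2 : VV hK y i n) (h3 : VV hK x i' n') (h4 : VV hK y i' n') :
    ∃ (π : Fin (2 * K)) (l : Fin K), adj σ π ∧ adj σ' π ∧ inP K π l i ∧ inP K π l i' ∧
      ∀ j m, VV hK x j m → VV hK y j m → inP K π l j := by
  have n1 : ¬ (pgE K σ = pgE K σ' ∧ pgO σ = pgO σ') := fun h => hσ (Fin.ext (pg_inj hK σ.2 σ'.2 h.1 h.2))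
  rcases K3 hK hx hy hσ hi h1 h2 h3 h4 with ⟨a, b⟩ | ⟨a, b⟩
  · have e := pgE_even σ.2
    have key : ∀ j, inP K (pgE K σ) (i / 2) j ↔ j / 2 = i / 2 := fun j => inP_even e
    refine ⟨⟨pgE K σ, pgE_lt hK σ.2⟩, ⟨i / 2, by have := h1.1.1; omega⟩, .inl rfl, .inl a, (key _).2 rfl, (key _).2 b.symm, ?_⟩
    intro j m hj hj'
    refine (key _).2 ?_
    by_cases hji : j = i
    · rw [hji]
    · rcases K3 hK hx hy hσ hji hj hj' h1 h2 with ⟨c, d⟩ | ⟨c, d⟩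
      · exact d
      · exact absurd ⟨a, c⟩ n1
  · have e := pgO_odd σ
    have key : ∀ j, inP K (pgO σ) (hh K i) j ↔ hh K j = hh K i := fun j => inP_odd e
    refine ⟨⟨pgO σ, pgO_lt σ.2⟩, ⟨hh K i, hh_lt h1.1.1⟩, .inr rfl, .inr a, (key _).2 rfl, (key _).2 b.symm, ?_⟩
    intro j m hj hj'
    refine (key _).2 ?_
    by_cases hji : j = i
    · rw [hji]
    · rcases K3 hK hx hy hσ hji hj hj' h1 h2 with ⟨c, d⟩ | ⟨c, d⟩
      · exact absurd ⟨c, a⟩ n1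
      · exact d

/-- vertex set by position -/
def VP (hK : 2 ≤ K) (x : Ix K) : Set ℤ := {p | (-1 ≤ p ∧ p ≤ pM K - 2) ∧ pt (p:ℝ) ∈ Zc hK x}

lemma VV_iff (hK : 2 ≤ K) {x : Ix K} {i : ℕ} {n : ℤ} (hi : i < 2 * K) (h0 : 0 ≤ n) (h1 : n ≤ pT K) : VV hK x i n ↔ posn K i n ∈ VP hK x :=
  ⟨fun h => ⟨posn_range hi h0 h1, h.2⟩, fun h => ⟨⟨hi, h0, h1⟩, h.2⟩⟩

lemma VP_node (hK : 2 ≤ K) (q : Fin (pM K)) : VP hK (.node q) = {((q:ℕ):ℤ) - 1} := by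
  ext p
  simp only [VP, Zc, mem_setOf_eq, mem_singleton_iff]
  rw [fin_nat_cast]
  constructor
  · rintro ⟨-, h⟩
    have := pt_inj h
    exact_mod_cast this
  · rintro rfl
    exact ⟨q_range q, rfl⟩
lemma VP_arc (hK : 2 ≤ K) (q : Fin (pM K)) : VP hK (.arc q) = {((q:ℕ):ℤ) - 1, nxt (pM K) q} := by
  ext p
  simp only [VP, Zc, mem_setOf_eq, mem_singleton_iff, mem_insert_iff]
  constructor
  · rintro ⟨hp, h⟩
    exact arc_node (pM_ge hK) q.2 hp h
  · rintro (rfl | rfl)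
    · refine ⟨q_range q, ?_⟩
      rw [← fin_nat_cast]
      exact arc_left (pM_ge hK) q.2
    · exact ⟨nxt_range (pM_ge hK), arc_right (pM_ge hK)⟩

lemma small (hK : 2 ≤ K) (q : Fin (pM K)) {S : Set ℤ} (h : S ⊆ {((q:ℕ):ℤ) - 1, nxt (pM K) q}) :
    S = ∅ ∨ ∃ k : Ix K, um k ∧ VP hK k = S := by
  have hn := nxt_range (pM_ge hK) (q := q)
  have hq : ∃ q' : Fin (pM K), ((q':ℕ):ℤ) - 1 = nxt (pM K) q := by
    refine ⟨⟨(nxt (pM K) q + 1).toNat, by omega⟩, ?_⟩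
    simp only; omega
  obtain ⟨q', hq'⟩ := hq
  by_cases h1 : ((q:ℕ):ℤ) - 1 ∈ S <;> by_cases h2 : nxt (pM K) q ∈ S
  · right
    refine ⟨.arc q, trivial, ?_⟩
    rw [VP_arc]
    apply Subset.antisymm _ h
    rintro _ (rfl | rfl) <;> assumption
  · right
    refine ⟨.node q, trivial, ?_⟩
    rw [VP_node]
    apply Subset.antisymm
    · rintro _ rfl; exact h1
    · intro p hp
      rcases h hp with e | e
      · exact e
      · rw [mem_singleton_iff] at e; rw [e] at hp; exact absurd hp h2
  · right
    refine ⟨.node q', trivial, ?_⟩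
    rw [VP_node, hq']
    apply Subset.antisymm
    · rintro _ rfl; exact h2
    · intro p hp
      rcases h hp with e | e
      · rw [e] at hp; exact absurd hp h1
      · exact e
  · left
    rw [eq_empty_iff_forall_notMem]
    intro p hp
    rcases h hp with e | e
    · rw [e] at hp; exact h1 hp
    · rw [mem_singleton_iff] at e; rw [e] at hp; exact h2 hp

lemma arc_of (hK : 2 ≤ K) {i : ℕ} {n n' : ℤ} (hi : i < 2 * K) (h0 : 0 ≤ n) (h1 : n ≤ pT K) (h0' : 0 ≤ n') (h1' : n' ≤ pT K)
    (h : n' = n + 1) : ∃ q : Fin (pM K), ({posn K i n, posn K i n'} : Set ℤ) = {((q:ℕ):ℤ) - 1, nxt (pM K) q} := by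
  have a := posn_range hi h0 h1
  have b := posn_range hi h0' h1'
  rcases Nat.mod_two_eq_zero_or_one i with e | e
  · have c : posn K i n = posn K i n' + 1 := by simp only [posn, e]; simp; omega
    refine ⟨⟨(posn K i n' + 1).toNat, by omega⟩, ?_⟩
    have d : ((posn K i n' + 1).toNat : ℤ) = posn K i n' + 1 := by omega
    simp only [nxt]
    rw [if_pos (by omega), d, c, pair_comm]; simp
  · have c : posn K i n' = posn K i n + 1 := by simp only [posn, e]; simp; omega
    refine ⟨⟨(posn K i n + 1).toNat, by omega⟩, ?_⟩
    have d : ((posn K i n + 1).toNat : ℤ) = posn K i n + 1 := by omega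
    simp only [nxt]
    rw [if_pos (by omega), d, c]; simp

/-- one column -/
lemma one_col (hK : 2 ≤ K) {x y : Ix K} {σ : Fin (2 * K)} (hx : WR hK x σ)
    (h : ∀ i n i' n', VV hK x i n → VV hK y i n → VV hK x i' n' → VV hK y i' n' → i = i') :
    VP hK x ∩ VP hK y = ∅ ∨ ∃ k : Ix K, um k ∧ VP hK k = VP hK x ∩ VP hK y := by
  have dec : ∀ p ∈ VP hK x ∩ VP hK y, ∃ (i : ℕ) (n : ℤ), (i < 2 * K ∧ 0 ≤ n ∧ n ≤ pT K) ∧ posn K i n = p ∧ VV hK x i n ∧ VV hK y i n := by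
    rintro p ⟨hp, hp'⟩
    obtain ⟨i, n, a, b, c, rfl⟩ := posn_surj hp.1.1 hp.1.2
    exact ⟨i, n, ⟨a, b, c⟩, rfl, (VV_iff hK a b c).2 hp, (VV_iff hK a b c).2 hp'⟩
  rcases eq_empty_or_nonempty (VP hK x ∩ VP hK y) with h0 | ⟨p, hp⟩
  · exact .inl h0
  obtain ⟨i, n, hin, rfl, v1, v2⟩ := dec p hp
  obtain ⟨a, ha⟩ := hx
  have win := ha i n v1
  -- S is contained in the two positions
  have bnd : ∀ p ∈ VP hK x ∩ VP hK y, ∃ n' : ℤ, (0 ≤ n' ∧ n' ≤ pT K) ∧ p = posn K i n' ∧ (n' = uu K σ i + a ∨ n' = uu K σ i + a + 1) := by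
    intro p hp
    obtain ⟨i', n', hin', rfl, v1', v2'⟩ := dec p hp
    obtain rfl := h i n i' n' v1 v2 v1' v2'
    have := ha _ _ v1'
    exact ⟨n', hin'.2, rfl, by omega⟩
  by_cases hb : 0 ≤ uu K σ i + a ∧ uu K σ i + a + 1 ≤ pT K
  · obtain ⟨q, hq⟩ := arc_of hK hin.1 hb.1 (by omega) (by omega) hb.2 rfl
    apply small hK q
    rw [← hq]
    intro p hp
    obtain ⟨n', -, rfl, e | e⟩ := bnd p hp
    · left; rw [e]
    · right; rw [e]; rfl
  · have pr := posn_range hin.1 hin.2.1 hin.2.2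
    have hq : (((posn K i n + 1).toNat : ℕ) : ℤ) - 1 = posn K i n := by omega
    apply small hK ⟨(posn K i n + 1).toNat, by omega⟩
    intro p hp
    obtain ⟨n', hn', rfl, e⟩ := bnd p hp
    left
    simp only [hq]
    congr 1
    omega

end
end FatS
end

section
open Metric Set Topology
namespace FatS
section
variable {K : ℕ}

lemma page_make (hK : 2 ≤ K) {x y : Ix K} {π : Fin (2 * K)} {l : Fin K} {a b a' b' : ℕ}
    (ab : b ≤ a + 1) (hb : b ≤ pY K)
    (hx : ∀ i n, inP K π l i → (VV hK x i n ↔ i < 2 * K ∧ (a:ℤ) ≤ yo K π i n ∧ yo K π i n ≤ b))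
    (hy : ∀ i n, inP K π l i → (VV hK y i n ↔ i < 2 * K ∧ (a':ℤ) ≤ yo K π i n ∧ yo K π i n ≤ b'))
    (h : ∀ i n, VV hK x i n → VV hK y i n → inP K π l i) {i : ℕ} {n : ℤ} (v1 : VV hK x i n) (v2 : VV hK y i n) :
    ∃ k : Ix K, um k ∧ ∀ i n, VV hK k i n ↔ VV hK x i n ∧ VV hK y i n := by
  have A := (hx i n (h i n v1 v2)).1 v1
  have B := (hy i n (h i n v1 v2)).1 v2
  have hlt : max a a' + min b b' + 1 < 2 * pY K + 2 := by omega
  have hu : um (Ix.page π (some (l, ⟨max a a' + min b b' + 1, hlt⟩))) := by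
    show 0 < max a a' + min b b' + 1
    omega
  refine ⟨.page π (some (l, ⟨max a a' + min b b' + 1, hlt⟩)), hu, fun j m => ?_⟩
  rw [page_VV hK hu]
  have e1 : (max a a' + min b b' + 1 - 1) / 2 = max a a' := by omega
  have e2 : (max a a' + min b b' + 1) / 2 = min b b' := by omega
  simp only [e1, e2]
  constructor
  · rintro ⟨c1, c2, c3, c4⟩
    exact ⟨(hx j m c2).2 ⟨c1, by omega, by omega⟩, (hy j m c2).2 ⟨c1, by omega, by omega⟩⟩
  · rintro ⟨c1, c2⟩
    have c3 := h j m c1 c2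
    have A' := (hx j m c3).1 c1
    have B' := (hy j m c3).1 c2
    exact ⟨A'.1, c3, by omega, by omega⟩

lemma VP_of_VV (hK : 2 ≤ K) {x y k : Ix K} (h : ∀ i n, VV hK k i n ↔ VV hK x i n ∧ VV hK y i n) : VP hK k = VP hK x ∩ VP hK y := by
  ext p
  constructor
  · intro hp
    obtain ⟨i, n, a, b, c, rfl⟩ := posn_surj hp.1.1 hp.1.2
    have := (h i n).1 ((VV_iff hK a b c).2 hp)
    exact ⟨(VV_iff hK a b c).1 this.1, (VV_iff hK a b c).1 this.2⟩
  · intro hp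
    obtain ⟨i, n, a, b, c, rfl⟩ := posn_surj hp.1.1.1 hp.1.1.2
    exact (VV_iff hK a b c).1 ((h i n).2 ⟨(VV_iff hK a b c).2 hp.1, (VV_iff hK a b c).2 hp.2⟩)

lemma page_PR (hK : 2 ≤ K) {π : Fin (2 * K)} {l : Fin K} {r : Fin (2 * pY K + 2)} (hr : um (.page π (some (l, r)))) :
    ∀ i n, inP K π l i → (VV hK (.page π (some (l, r))) i n ↔ i < 2 * K ∧ ((((r:ℕ) - 1) / 2 : ℕ) : ℤ) ≤ yo K π i n ∧
      yo K π i n ≤ (((r:ℕ) / 2 : ℕ) : ℤ)) := by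
  intro i n hi
  rw [page_VV hK hr]; tauto

lemma slab_make (hK : 2 ≤ K) {σ : Fin (2 * K)} {r r' : Fin (2 * pH K + 3)} (hr : um (.slab σ r)) (hr' : um (.slab σ r')) {i : ℕ} {n : ℤ}
    (v1 : VV hK (.slab σ r) i n) (v2 : VV hK (.slab σ r') i n) :
    ∃ k : Ix K, um k ∧ ∀ i n, VV hK k i n ↔ VV hK (.slab σ r) i n ∧ VV hK (.slab σ r') i n := by
  have A := (slab_VV hK hr).1 v1
  have B := (slab_VV hK hr').1 v2
  have a1 : 0 < (r:ℕ) ∧ (r:ℕ) < 2 * pH K + 2 := hr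
  have a2 : 0 < (r':ℕ) ∧ (r':ℕ) < 2 * pH K + 2 := hr'
  obtain ⟨s, hs⟩ : ∃ s, s = max (((r:ℕ) - 1) / 2) (((r':ℕ) - 1) / 2) + min ((r:ℕ) / 2) ((r':ℕ) / 2) + 1 := ⟨_, rfl⟩
  have hlt : s < 2 * pH K + 3 := by omega
  have hu : um (Ix.slab σ ⟨s, hlt⟩) := by
    show 0 < s ∧ s < 2 * pH K + 2
    omega
  refine ⟨.slab σ ⟨s, hlt⟩, hu, fun j m => ?_⟩
  rw [slab_VV hK hu, slab_VV hK hr, slab_VV hK hr']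
  have e1 : (s - 1) / 2 = max (((r:ℕ) - 1) / 2) (((r':ℕ) - 1) / 2) := by omega
  have e2 : s / 2 = min ((r:ℕ) / 2) ((r':ℕ) / 2) := by omega
  simp only [e1, e2]
  omega

lemma meet_page (hK : 2 ≤ K) {π : Fin (2 * K)} {l : Fin K} {r : Fin (2 * pY K + 2)} (hx : um (.page π (some (l, r)))) {y : Ix K} (hy : um y) :
    VP hK (.page π (some (l, r))) ∩ VP hK y = ∅ ∨ ∃ k : Ix K, um k ∧ VP hK k = VP hK (.page π (some (l, r))) ∩ VP hK y := by
  match y, hy with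
  | .node q, _ => exact small hK q (fun p hp => by have := hp.2; rw [VP_node] at this; exact .inl this)
  | .arc q, _ => exact small hK q (fun p hp => by have := hp.2; rw [VP_arc] at this; exact this)
  | .page π' (some (l', r')), hy =>
    by_cases hc : ∀ i n i' n', VV hK (.page π (some (l, r))) i n → VV hK (.page π' (some (l', r'))) i n →
        VV hK (.page π (some (l, r))) i' n' → VV hK (.page π' (some (l', r'))) i' n' → i = i'
    · exact one_col hK (page_WR hK hx) hc
    · push Not at hc
      obtain ⟨i, n, i', n', v1, v2, v3, v4, hne⟩ := hc
      obtain ⟨rfl, rfl⟩ := two_pp hK hx hy hne v1 v2 v3 v4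
      obtain ⟨k, hk, e⟩ := page_make hK (by omega) (r_half r) (page_PR hK hx) (page_PR hK hy)
        (fun i n h _ => ((page_VV hK hx).1 h).2.1) v1 v2
      exact .inr ⟨k, hk, VP_of_VV hK e⟩
  | .slab σ r', hy =>
    by_cases hc : ∀ i n i' n', VV hK (.page π (some (l, r))) i n → VV hK (.slab σ r') i n →
        VV hK (.page π (some (l, r))) i' n' → VV hK (.slab σ r') i' n' → i = i'
    · exact one_col hK (page_WR hK hx) hc
    · push Not at hc
      obtain ⟨i, n, i', n', v1, v2, v3, v4, hne⟩ := hc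
      have ad := two_ps hK hx (slab_WR hK hy) hne v1 v2 v3 v4
      obtain ⟨a, b, -, -, -, h4, -⟩ := slab_PR hK hy ad l
      obtain ⟨k, hk, e⟩ := page_make hK (by omega) (r_half r) (page_PR hK hx) h4
        (fun i n h _ => ((page_VV hK hx).1 h).2.1) v1 v2
      exact .inr ⟨k, hk, VP_of_VV hK e⟩

theorem meet (hK : 2 ≤ K) {x y : Ix K} (hx : um x) (hy : um y) :
    VP hK x ∩ VP hK y = ∅ ∨ ∃ k : Ix K, um k ∧ VP hK k = VP hK x ∩ VP hK y := by
  match x, y, hx, hy with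
  | .node q, _, _, _ => exact small hK q (fun p hp => by have := hp.1; rw [VP_node] at this; exact .inl this)
  | .arc q, _, _, _ => exact small hK q (fun p hp => by have := hp.1; rw [VP_arc] at this; exact this)
  | .page π (some (l, r)), _, hx, hy => exact meet_page hK hx hy
  | .slab σ r, .node q, _, _ => exact small hK q (fun p hp => by have := hp.2; rw [VP_node] at this; exact .inl this)
  | .slab σ r, .arc q, _, _ => exact small hK q (fun p hp => by have := hp.2; rw [VP_arc] at this; exact this)
  | .slab σ r, .page π (some (l, r')), hx, hy => rw [inter_comm]; exact meet_page hK hy hx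
  | .slab σ r, .slab σ' r', hx, hy =>
    by_cases hc : ∀ i n i' n', VV hK (.slab σ r) i n → VV hK (.slab σ' r') i n →
        VV hK (.slab σ r) i' n' → VV hK (.slab σ' r') i' n' → i = i'
    · exact one_col hK (slab_WR hK hx) hc
    · push Not at hc
      obtain ⟨i, n, i', n', v1, v2, v3, v4, hne⟩ := hc
      by_cases hσ : σ = σ'
      · subst hσ
        obtain ⟨k, hk, e⟩ := slab_make hK hx hy v1 v2
        exact .inr ⟨k, hk, VP_of_VV hK e⟩
      · obtain ⟨π, l, ad, ad', -, -, h⟩ := two_ss hK (slab_WR hK hx) (slab_WR hK hy) hσ hne v1 v2 v3 v4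
        obtain ⟨a, b, -, h2, h3, h4, -⟩ := slab_PR hK hx ad l
        obtain ⟨a', b', -, -, -, h4', -⟩ := slab_PR hK hy ad' l
        obtain ⟨k, hk, e⟩ := page_make hK h2 h3 h4 h4' h v1 v2
        exact .inr ⟨k, hk, VP_of_VV hK e⟩

/-- arcs contain at most one inner column -/
lemma arc_col (hK : 2 ≤ K) {q : Fin (pM K)} {i j : ℕ} {n n' : ℤ} (hi : i < j) (h0 : 1 ≤ n) (h1 : n + 1 ≤ pT K) (h0' : 1 ≤ n')
    (h1' : n' + 1 ≤ pT K) (hj : j < 2 * K) (a : posn K i n ∈ VP hK (.arc q)) (b : posn K j n' ∈ VP hK (.arc q)) : False := by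
  rw [VP_arc] at a b
  have g := posn_gap hi h0 h1 h0' h1'
  have r := posn_inner (by omega : i < 2 * K) h0 h1
  have r' := posn_inner hj h0' h1'
  have a' : posn K i n = ((q:ℕ):ℤ) - 1 ∨ posn K i n = nxt (pM K) q := a
  have b' : posn K j n' = ((q:ℕ):ℤ) - 1 ∨ posn K j n' = nxt (pM K) q := b
  unfold nxt at a' b'
  split_ifs at a' b' <;> omega

/-- every unmarked page or slab has inner vertices in two columns -/
lemma two_cols (hK : 2 ≤ K) {y x : Ix K} (h : ∀ i n, VV hK x i n → VV hK y i n) (hy : ∃ q, y = .node q ∨ y = .arc q)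
    {i j : ℕ} {n n' : ℤ} (hij : i ≠ j) (v1 : VV hK x i n) (v2 : VV hK x j n') (h0 : 1 ≤ n) (h1 : n + 1 ≤ pT K) (h0' : 1 ≤ n')
    (h1' : n' + 1 ≤ pT K) : False := by
  have w1 := h _ _ v1
  have w2 := h _ _ v2
  rw [VV_iff hK v1.1.1 v1.1.2.1 v1.1.2.2] at w1
  rw [VV_iff hK v2.1.1 v2.1.2.1 v2.1.2.2] at w2
  obtain ⟨q, rfl | rfl⟩ := hy
  · have : VP hK (.node q) ⊆ VP hK (.arc q) := by
      rw [VP_node, VP_arc]; intro p hp; exact .inl hp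
    rcases lt_or_gt_of_ne hij with h | h
    · exact arc_col hK h h0 h1 h0' h1' v2.1.1 (this w1) (this w2)
    · exact arc_col hK h h0' h1' h0 h1 v1.1.1 (this w2) (this w1)
  · rcases lt_or_gt_of_ne hij with h | h
    · exact arc_col hK h h0 h1 h0' h1' v2.1.1 w1 w2
    · exact arc_col hK h h0' h1' h0 h1 v1.1.1 w2 w1

lemma page_pts (hK : 2 ≤ K) {π : Fin (2 * K)} {l : Fin K} {r : Fin (2 * pY K + 2)} (hr : um (.page π (some (l, r)))) {i : ℕ}
    (hi : i < 2 * K) (hin : inP K π l i) {y : ℕ} (hy : ((r:ℕ) - 1) / 2 ≤ y) (hy' : y ≤ (r:ℕ) / 2) :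
    VV hK (.page π (some (l, r))) i (hgt K π i y) ∧ 1 ≤ hgt K π i y ∧ hgt K π i y + 1 ≤ pT K := by
  have := r_half r
  refine ⟨?_, hgt_range π.2 hi (by omega) (by omega)⟩
  rw [page_VV hK hr, yo_hgt]
  exact ⟨hi, hin, by omega, by omega⟩

lemma slab_pts (hK : 2 ≤ K) {σ : Fin (2 * K)} {r : Fin (2 * pH K + 3)} (hr : um (.slab σ r)) {i : ℕ} (hi : i < 2 * K) {y : ℕ}
    (hy : ((r:ℕ) - 1) / 2 ≤ y) (hy' : y ≤ (r:ℕ) / 2) :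
    VV hK (.slab σ r) i (uu K σ i + y) ∧ 1 ≤ uu K σ i + y ∧ uu K σ i + y + 1 ≤ pT K := by
  have : (r:ℕ) < 2 * pH K + 2 := hr.2
  refine ⟨?_, um_range hK σ.2 hi (by omega) (by omega)⟩
  rw [slab_VV hK hr]
  exact ⟨hi, by omega, by omega⟩

theorem full (hK : 2 ≤ K) {x y : Ix K} (hx : um x) (hy : um y) (h : VP hK x ⊆ VP hK y) : cc hK x ⊆ cc hK y := by
  have hv : ∀ i n, VV hK x i n → VV hK y i n := fun i n v => by
    have w := v.1
    rw [VV_iff hK w.1 w.2.1 w.2.2] at v ⊢; exact h v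
  match x, y, hx, hy with
  | .node q, y, _, _ =>
    apply circ_sub
    · rintro _ rfl; exact node_circle _
    · rintro _ rfl
      have : ((q:ℕ):ℤ) - 1 ∈ VP hK y := h (by rw [VP_node]; rfl)
      have := this.2
      rwa [← fin_nat_cast] at this
  | .arc q, y, _, _ =>
    apply circ_sub
    · exact fun z hz => arc_circle hz
    · have h1 : ((q:ℕ):ℤ) - 1 ∈ VP hK y := h (by rw [VP_arc]; exact .inl rfl)
      have h2 : nxt (pM K) q ∈ VP hK y := h (by rw [VP_arc]; exact .inr rfl)
      match y with
      | .node q' =>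
        rw [VP_node] at h1 h2
        exact absurd (Eq.trans h1 (Eq.symm h2)) (nxt_ne (pM_ge hK) q.2)
      | .arc q' =>
        rw [VP_arc] at h1 h2
        have M4 := pM_ge hK
        have b1 := q.2
        have b2 := q'.2
        have : q = q' := by
          apply Fin.ext
          have h1' : ((q:ℕ):ℤ) - 1 = ((q':ℕ):ℤ) - 1 ∨ ((q:ℕ):ℤ) - 1 = nxt (pM K) q' := h1
          have h2' : nxt (pM K) q = ((q':ℕ):ℤ) - 1 ∨ nxt (pM K) q = nxt (pM K) q' := h2
          unfold nxt at h1' h2'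
          split_ifs at h1' h2' <;> (try simp only [or_false] at h2') <;> omega
        rw [this]
      | .page π a => exact page_arc_ends hK π.2 q.2 h1.2 h2.2
      | .slab σ r => exact slab_arc_ends hK q.2 h1.2 h2.2
  | .page π (some (l, r)), y, hx, hy =>
    have il := iL_lt (K := K) (π := π) l.2
    have ir := iR_lt (K := K) (π := π) l.2
    have hne := iL_ne_iR hK (π := π) l.2
    have r0 : 0 < (r:ℕ) := hx
    have A := page_pts hK hx il (inP_iL l.2) le_rfl (by omega)
    have B := page_pts hK hx ir (inP_iR l.2) le_rfl (by omega)
    have A' := page_pts hK hx il (inP_iL l.2) (by omega) le_rfl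
    match y, hy with
    | .node q, _ => exact (two_cols hK hv ⟨q, .inl rfl⟩ hne A.1 B.1 A.2.1 A.2.2 B.2.1 B.2.2).elim
    | .arc q, _ => exact (two_cols hK hv ⟨q, .inr rfl⟩ hne A.1 B.1 A.2.1 A.2.2 B.2.1 B.2.2).elim
    | .page π' (some (l', r')), hy =>
      obtain ⟨rfl, rfl⟩ := two_pp hK hx hy hne A.1 (hv _ _ A.1) B.1 (hv _ _ B.1)
      have r1 : 0 < (r':ℕ) := hy
      have C := (page_VV hK hy).1 (hv _ _ A.1)
      have C' := (page_VV hK hy).1 (hv _ _ A'.1)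
      rw [yo_hgt] at C C'
      apply page_sub
      intro l' y hy
      simp only [sg]
      split_ifs
      · omega
      · simp
    | .slab σ r', hy =>
      have ad := two_ps hK hx (slab_WR hK hy) hne A.1 (hv _ _ A.1) B.1 (hv _ _ B.1)
      obtain ⟨a, b, -, -, -, h4, h5⟩ := slab_PR hK hy ad l
      have C := (h4 _ _ (inP_iL l.2)).1 (hv _ _ A.1)
      have C' := (h4 _ _ (inP_iL l.2)).1 (hv _ _ A'.1)
      rw [yo_hgt] at C C'
      have r2 : 0 < (r':ℕ) ∧ (r':ℕ) < 2 * pH K + 2 := hy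
      rcases h5 with ⟨e, f1, f2⟩ | ⟨e, f1, f2⟩
      · apply pageE_sub hK e
        refine ⟨fun m hm hm' l' => ?_, fun _ => ⟨l, ?_⟩⟩
        · simp only [sg]
          split_ifs with hl
          · subst hl
            have := f1 m (by omega)
            omega
          · norm_num
        · simp only [sg, if_true, f2]
          omega
      · apply pageO_sub hK e
        refine ⟨fun m hm hm' l' => ?_, fun m hm => ⟨l, ?_⟩⟩
        · simp only [sg]
          split_ifs with hl
          · subst hl
            have := f1 m (by omega) hm'
            omega
          · norm_num
        · have : m = ((r':ℕ) - 1) / 2 := by omega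
          simp only [sg, if_true, this, f2]
          omega
  | .slab σ r, y, hx, hy =>
    have r0 : 0 < (r:ℕ) ∧ (r:ℕ) < 2 * pH K + 2 := hx
    have A0 := slab_pts hK hx (i := 0) (by omega) le_rfl (by omega)
    have A1 := slab_pts hK hx (i := 1) (by omega) le_rfl (by omega)
    have A2 := slab_pts hK hx (i := 2) (by omega) le_rfl (by omega)
    have A' := slab_pts hK hx (i := 0) (by omega) (y := (r:ℕ) / 2) (by omega) le_rfl
    have no : ∀ (π : Fin (2 * K)) (l : Fin K), inP K π l 0 → inP K π l 1 → inP K π l 2 → False := by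
      intro π l h1 h2 h3
      rcases Nat.mod_two_eq_zero_or_one π with e | e
      · rw [inP_even e] at h1 h2 h3; omega
      · rw [inP_odd e] at h1 h2 h3
        rw [hh_eq (by omega)] at h1 h2 h3
        split_ifs at h1 h2 h3 <;> omega
    match y, hy with
    | .node q, _ => exact (two_cols hK hv ⟨q, .inl rfl⟩ (by omega) A0.1 A1.1 A0.2.1 A0.2.2 A1.2.1 A1.2.2).elim
    | .arc q, _ => exact (two_cols hK hv ⟨q, .inr rfl⟩ (by omega) A0.1 A1.1 A0.2.1 A0.2.2 A1.2.1 A1.2.2).elim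
    | .page π' (some (l', r')), hy =>
      exact (no π' l' ((page_VV hK hy).1 (hv _ _ A0.1)).2.1 ((page_VV hK hy).1 (hv _ _ A1.1)).2.1 ((page_VV hK hy).1 (hv _ _ A2.1)).2.1).elim
    | .slab σ' r', hy =>
      by_cases hσ : σ = σ'
      · subst hσ
        have r1 : 0 < (r':ℕ) ∧ (r':ℕ) < 2 * pH K + 2 := hy
        have C := (slab_VV hK hy).1 (hv _ _ A0.1)
        have C' := (slab_VV hK hy).1 (hv _ _ A'.1)
        apply slab_sub <;> omega
      · obtain ⟨π, l, -, -, -, -, hh⟩ := two_ss hK (slab_WR hK hx) (slab_WR hK hy) hσ (show 0 ≠ 1 by omega) A0.1 (hv _ _ A0.1) A1.1 (hv _ _ A1.1)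
        exact (no π l (hh _ _ A0.1 (hv _ _ A0.1)) (hh _ _ A1.1 (hv _ _ A1.1)) (hh _ _ A2.1 (hv _ _ A2.1))).elim

end
end FatS
end

section
open Metric Set Topology
namespace FatS
section
variable {K : ℕ}

lemma VP_mono (hK : 2 ≤ K) {x y : Ix K} (h : cc hK x ⊆ cc hK y) : VP hK x ⊆ VP hK y := by
  rintro p ⟨hp, hz⟩
  refine ⟨hp, ?_⟩
  have h1 : nsq (pt (p:ℝ)) ≤ 1 := (node_circle _).le
  have h2 : ‖(1:ℂ)‖ = 1 := by simp
  have : Phi (pt (p:ℝ)) 1 ∈ cc hK x := (mem_cc hK h1 h2).2 ⟨hz, fun h => absurd (node_circle _) h.ne⟩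
  exact ((mem_cc hK h1 h2).1 (h this)).1

lemma VV_mono (hK : 2 ≤ K) {x y : Ix K} (h : cc hK x ⊆ cc hK y) {i : ℕ} {n : ℤ} (v : VV hK x i n) : VV hK y i n := by
  have w := v.1
  rw [VV_iff hK w.1 w.2.1 w.2.2] at v ⊢; exact VP_mono hK h v

lemma VP_ne (hK : 2 ≤ K) {x : Ix K} (hx : um x) : (VP hK x).Nonempty := by
  match x, hx with
  | .node q, _ => exact ⟨_, by rw [VP_node]; rfl⟩
  | .arc q, _ => exact ⟨_, by rw [VP_arc]; exact .inl rfl⟩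
  | .page π (some (l, r)), hx =>
    have A := page_pts hK hx (iL_lt l.2) (inP_iL l.2) (y := (r:ℕ) / 2) (by omega) le_rfl
    exact ⟨_, (VV_iff hK A.1.1.1 A.1.1.2.1 A.1.1.2.2).1 A.1⟩
  | .slab σ r, hx =>
    have A := slab_pts hK hx (i := 0) (by omega) (y := (r:ℕ) / 2) (by omega) le_rfl
    exact ⟨_, (VV_iff hK A.1.1.1 A.1.1.2.1 A.1.1.2.2).1 A.1⟩

lemma mk_dim {x : Ix K} (hx : ¬ um x) : dd x = 2 ∨ dd x = 3 := by
  match x, hx with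
  | .node q, h => exact absurd trivial h
  | .arc q, h => exact absurd trivial h
  | .page π none, _ => exact .inl rfl
  | .page π (some (l, r)), h =>
    have : (r:ℕ) = 0 := by
      have : ¬ 0 < (r:ℕ) := h
      omega
    left; simp [dd, pdim, this]
  | .slab σ r, h =>
    have : ¬ (0 < (r:ℕ) ∧ (r:ℕ) < 2 * pH K + 2) := h
    have := r.2
    simp only [dd]; omega

lemma dd_le (x : Ix K) : dd x ≤ 3 := by
  match x with
  | .node q => exact Nat.zero_le _
  | .arc q => simp [dd]
  | .page π a => have := pdim_le (a := a); simp only [dd]; omega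
  | .slab σ r => simp [dd]

lemma pT_cast : (pT K : ℤ) = pH K + 2 * pU K + 2 := by unfold pT; push_cast; rfl
lemma pY_cast : (pY K : ℤ) = pH K + pU K := by unfold pY; push_cast; rfl

lemma mk_page (hK : 2 ≤ K) {π : Fin (2 * K)} {a : Code K} (hx : ¬ um (.page π a)) : ∃ i n, VV hK (.page π a) i n ∧ (n = 0 ∨ n = pT K) := by
  have hi0 : 0 < 2 * K := by omega
  have e1 := pT_cast (K := K)
  have e2 := pY_cast (K := K)
  match a, hx with
  | none, _ =>
    rcases Nat.mod_two_eq_zero_or_one π with e | e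
    · refine ⟨0, pT K, ⟨⟨hi0, by omega, le_rfl⟩, none_V π.2 hi0 (by omega) le_rfl ?_⟩, .inr rfl⟩
      have := fE_le π.2 hi0
      rcases yo_cases (K := K) π 0 (pT K) with h | h <;> omega
    · refine ⟨0, 0, ⟨⟨hi0, by omega, by omega⟩, none_V π.2 hi0 (by omega) (by omega) ?_⟩, .inl rfl⟩
      have := gO_nonneg (K := K) π 0
      rcases yo_cases (K := K) π 0 0 with h | h <;> omega
  | some (l, r), h =>
    have r0 : (r:ℕ) = 0 := by
      have : ¬ 0 < (r:ℕ) := h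
      omega
    have hi := iL_lt (K := K) (π := π) l.2
    rcases Nat.mod_two_eq_zero_or_one π with e | e
    · refine ⟨iL K π l, 0, ⟨⟨hi, by omega, by omega⟩, (page_V π.2 hi (by omega) (by omega)).2 ⟨inP_iL l.2, by omega, ?_⟩⟩, .inl rfl⟩
      have := fE_nonneg (K := K) π (iL K π l)
      rcases yo_cases (K := K) π (iL K π l) 0 with h | h <;> omega
    · refine ⟨iL K π l, pT K, ⟨⟨hi, by omega, by omega⟩, (page_V π.2 hi (by omega) (by omega)).2 ⟨inP_iL l.2, by omega, ?_⟩⟩, .inr rfl⟩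
      have := gO_le π.2 hi
      rcases yo_cases (K := K) π (iL K π l) (pT K) with h | h <;> omega

lemma um_down (hK : 2 ≤ K) {x y : Ix K} (hy : um y) (h : (co hK x ∩ cc hK y).Nonempty) : um x := by
  by_contra hx
  rcases Tlem hK h with rfl | ⟨h1, h2⟩
  · exact hx hy
  have h3 := mk_dim hx
  have h4 := dd_le y
  match x, hx with
  | .node q, h => exact absurd trivial h
  | .arc q, h => exact absurd trivial h
  | .slab σ r, h =>
    have : ¬ (0 < (r:ℕ) ∧ (r:ℕ) < 2 * pH K + 2) := h
    have := r.2
    have e : dd (Ix.slab σ r) = 3 := by simp only [dd]; omega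
    omega
  | .page π a, hx =>
    obtain ⟨i, n, v, hn⟩ := mk_page hK hx
    have w := VV_mono hK h2 v
    match y, hy with
    | .node q, _ => simp [dd] at h1
    | .arc q, _ => simp only [dd] at h1 h3; omega
    | .page π' a', _ => have := pdim_le (a := a'); simp only [dd] at h1 h3; omega
    | .slab σ r, hy =>
      have W := (slab_VV hK hy).1 w
      have : 0 < (r:ℕ) ∧ (r:ℕ) < 2 * pH K + 2 := hy
      have A := um_range hK σ.2 W.1 (m := ((((r:ℕ) - 1) / 2 : ℕ) : ℤ)) (by omega) (by omega)
      have B := um_range hK σ.2 W.1 (m := (((r:ℕ) / 2 : ℕ) : ℤ)) (by omega) (by omega)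
      omega

lemma in_cells (hK : 2 ≤ K) {x : Ix K} {p : E 4} (hp : p ∈ cc hK x) : ∃ j, p ∈ co hK j := by
  have : p ∈ sphere (0 : E 4) 1 := by
    obtain ⟨z, w, h1, h2, rfl, -⟩ := hp
    exact Phi_sphere h1 h2
  rw [← cover hK] at this
  exact mem_iUnion.1 this

abbrev I0 (K : ℕ) : Type := {x : Ix K // um x}
abbrev K1 (K : ℕ) : Type := {x : Ix K // ¬ um x ∧ dd x = 2}
abbrev K2 (K : ℕ) : Type := {x : Ix K // ¬ um x ∧ dd x = 3}

def P0 (hK : 2 ≤ K) : PC (E 4) (I0 K) where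
  d x := dd x.1
  c x := cc hK x.1
  o x := co hK x.1
  cell x := cell hK x.1
  clo j i h := by
    rcases Tlem hK h with e | e
    · rw [e]
    · exact e.2
  dim j i h hne := by
    rcases Tlem hK h with e | e
    · exact absurd (Subtype.ext e) hne
    · exact e.1
  bd i := by
    intro p hp
    obtain ⟨j, hj⟩ := in_cells hK hp
    exact mem_iUnion.2 ⟨⟨j, um_down hK i.2 ⟨p, hj, hp⟩⟩, hj⟩
  inter i j := by
    have sub : ∀ p ∈ cc hK i.1 ∩ cc hK j.1, ∃ k, um k ∧ p ∈ co hK k ∧ VP hK k ⊆ VP hK i.1 ∩ VP hK j.1 := by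
      rintro p ⟨h1, h2⟩
      obtain ⟨k, hk⟩ := in_cells hK h1
      have g : ∀ x : I0 K, p ∈ cc hK x.1 → cc hK k ⊆ cc hK x.1 := fun x hx => by
        rcases Tlem hK ⟨p, hk, hx⟩ with e | e
        · rw [e]
        · exact e.2
      exact ⟨k, um_down hK i.2 ⟨p, hk, h1⟩, hk, subset_inter (VP_mono hK (g i h1)) (VP_mono hK (g j h2))⟩
    rcases meet hK i.2 j.2 with h | ⟨k, hk, h⟩
    · left
      rw [eq_empty_iff_forall_notMem]
      intro p hp
      obtain ⟨k, hk, -, hs⟩ := sub p hp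
      rw [h] at hs
      obtain ⟨q, hq⟩ := VP_ne hK hk
      exact hs hq
    · right
      refine ⟨⟨k, hk⟩, Subset.antisymm (subset_inter ?_ ?_) ?_⟩
      · exact full hK hk i.2 (by rw [h]; exact inter_subset_left)
      · exact full hK hk j.2 (by rw [h]; exact inter_subset_right)
      · intro p hp
        obtain ⟨l, hl, hpl, hs⟩ := sub p hp
        rw [← h] at hs
        exact full hK hl hk hs ((cell hK l).sub hpl)

lemma co_disj (hK : 2 ≤ K) {x y : Ix K} (hne : x ≠ y) : Disjoint (co hK x) (co hK y) := by
  rw [Set.disjoint_left]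
  intro p h1 h2
  rcases Tlem hK ⟨p, h1, (cell hK y).sub h2⟩ with e | e
  · exact hne e
  · rcases Tlem hK ⟨p, h2, (cell hK x).sub h1⟩ with e' | e'
    · exact hne e'.symm
    · omega

def H1 (hK : 2 ≤ K) : Holes (P0 hK) (K1 K) where
  n x := dd x.1
  D x := cc hK x.1
  O x := co hK x.1
  cell x := cell hK x.1
  disj k k' h := co_disj hK fun e => h (Subtype.ext e)
  disj' k i := co_disj hK fun e => k.2.1 (e ▸ i.2)
  bd k := by
    intro p hp
    obtain ⟨j, hj⟩ := in_cells hK hp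
    rcases Tlem hK ⟨p, hj, hp⟩ with e | e
    · left; rw [← e]; exact hj
    · right
      refine mem_iUnion.2 ⟨⟨j, ?_⟩, hj⟩
      by_contra hc
      have := mk_dim hc
      have := k.2.2
      omega
  clo k i h := by
    rcases Tlem hK h with e | e
    · exact absurd (e ▸ i.2) k.2.1
    · exact e.2

def H2 (hK : 2 ≤ K) : Holes (H1 hK).fill (K2 K) where
  n x := dd x.1
  D x := cc hK x.1
  O x := co hK x.1
  cell x := cell hK x.1
  disj k k' h := co_disj hK fun e => h (Subtype.ext e)
  disj' k i := by
    rcases i with i | ⟨k1, j⟩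
    · exact co_disj hK fun e => k.2.1 (e ▸ i.2)
    · refine Disjoint.mono_right ((H1 hK).o_sub_O k1 j) (co_disj hK fun e => ?_)
      have h1 := k.2.2
      have h2 := k1.2.2
      rw [e] at h1; omega
  bd k := by
    rw [(H1 hK).fill_union]
    intro p hp
    obtain ⟨j, hj⟩ := in_cells hK hp
    rcases Tlem hK ⟨p, hj, hp⟩ with e | e
    · left; rw [← e]; exact hj
    · right
      by_cases hc : um j
      · left; exact mem_iUnion.2 ⟨⟨j, hc⟩, hj⟩
      · right
        have := mk_dim hc
        have := k.2.2
        exact mem_iUnion.2 ⟨⟨j, hc, by omega⟩, hj⟩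
  clo k i h := by
    rcases i with i | ⟨k1, j⟩
    · rcases Tlem hK h with e | e
      · exact absurd (e ▸ i.2) k.2.1
      · exact e.2
    · obtain ⟨p, h1, h2⟩ := h
      refine ((H1 hK).c_sub_D k1 j).trans ?_
      rcases Tlem hK ⟨p, (H1 hK).o_sub_O k1 j h1, h2⟩ with e | e
      · have h1 := k.2.2
        have h2 := k1.2.2
        rw [← e] at h1; omega
      · exact e.2

def Q (hK : 2 ≤ K) : PC (E 4) (H2 hK).Ix := (H2 hK).fill

lemma Q_union (hK : 2 ≤ K) : (⋃ i, (Q hK).o i) = sphere 0 1 := by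
  rw [Q, (H2 hK).fill_union, (H1 hK).fill_union, ← cover hK]
  apply Subset.antisymm
  · rintro p ((h | h) | h) <;> obtain ⟨i, hi⟩ := mem_iUnion.1 h <;> exact mem_iUnion.2 ⟨i.1, hi⟩
  · intro p h
    obtain ⟨i, hi⟩ := mem_iUnion.1 h
    by_cases hc : um i
    · exact .inl (.inl (mem_iUnion.2 ⟨⟨i, hc⟩, hi⟩))
    · rcases mk_dim hc with e | e
      · exact .inl (.inr (mem_iUnion.2 ⟨⟨i, hc, e⟩, hi⟩))
      · exact .inr (mem_iUnion.2 ⟨⟨i, hc, e⟩, hi⟩)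

lemma sub_dim (hK : 2 ≤ K) {x y : Ix K} (hx : um x) (hy : ¬ um y) (h : cc hK x ⊆ cc hK y) : dd x < dd y := by
  obtain ⟨p, hp⟩ := (cell hK x).ne
  rcases Tlem hK ⟨p, hp, h ((cell hK x).sub hp)⟩ with e | e
  · exact absurd (e ▸ hx) hy
  · exact e.1

lemma Q_dim (hK : 2 ≤ K) (i : (H2 hK).Ix) : (Q hK).d i ≤ 3 := by
  have a1 : ∀ i : (H1 hK).Ix, (H1 hK).fill.d i ≤ 3 := by
    rintro (i | ⟨k, _ | j⟩)
    · exact dd_le i.1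
    · exact Nat.zero_le _
    · have h := sub_dim hK j.1.2 k.2.1 j.2
      rw [k.2.2] at h
      show dd j.1.1 + 1 ≤ 3
      omega
  rcases i with i | ⟨k, _ | j⟩
  · exact a1 i
  · exact Nat.zero_le _
  · show (H1 hK).fill.d j.1 + 1 ≤ 3
    rcases j with ⟨i | ⟨k1, _ | j⟩, hj⟩
    · have h := sub_dim hK i.2 k.2.1 hj
      rw [k.2.2] at h
      show dd i.1 + 1 ≤ 3
      omega
    · show 0 + 1 ≤ 3
      omega
    · have h := sub_dim hK j.1.2 k1.2.1 j.2
      rw [k1.2.2] at h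
      show dd j.1.1 + 1 + 1 ≤ 3
      omega

end
end FatS
end

section
open Metric Set Topology
namespace FatS
section
variable {K : ℕ}

/-- all circle points of the cell have extreme height -/
def low (hK : 2 ≤ K) (x : Ix K) : Prop :=
  ∀ i n, VV hK x i n → n ≤ 1 + 2 * (pU K : ℤ) ∨ 1 + (pH K : ℤ) ≤ n

lemma mk_low (hK : 2 ≤ K) {x : Ix K} (hx : ¬ um x) : low hK x := by
  intro i n v
  have e2 := pY_cast (K := K)
  obtain ⟨⟨hi, n0, n1⟩, hz⟩ := v
  match x, hx with
  | .node q, h => exact absurd trivial h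
  | .arc q, h => exact absurd trivial h
  | .page π none, _ =>
    obtain ⟨l, hl⟩ := inP_exists (K := K) π hi
    have h := (hz.2 l (pY K) le_rfl).1 (by simp [sg])
    rw [(node_sign π.2 hi le_rfl n0 n1 hl).1] at h
    have a1 := fE_nonneg (K := K) π i
    have a2 := gO_le (K := K) π.2 hi
    rcases yo_cases (K := K) π i n with g | g <;> omega
  | .page π (some (l, r)), h =>
    have r0 : (r:ℕ) = 0 := by
      have : ¬ 0 < (r:ℕ) := h
      omega
    have h := ((page_V π.2 hi n0 n1).1 hz).2.2
    have a1 := fE_le (K := K) π.2 hi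
    have a2 := gO_nonneg (K := K) π i
    rcases yo_cases (K := K) π i n with g | g <;> omega
  | .slab σ r, h =>
    have h1 : ¬ (0 < (r:ℕ) ∧ (r:ℕ) < 2 * pH K + 2) := h
    have h2 := r.2
    have h3 := (slab_V hK hi n0 n1).1 hz
    have h4 := uu_range hK σ.2 hi
    by_cases r0 : (r:ℕ) = 0
    · have := h3.2 0 (by omega) (by omega)
      left; push_cast at this; omega
    · have := h3.1 (pH K) (by omega) le_rfl
      right; omega

lemma low_mono (hK : 2 ≤ K) {x y : Ix K} (h : cc hK x ⊆ cc hK y) (hy : low hK y) : low hK x :=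
  fun i n v => hy i n (VV_mono hK h v)

abbrev Bx (hK : 2 ≤ K) : Type := {x : Ix K // um x ∧ (dd x = 1 ∨ dd x = 2) ∧ low hK x}

def fold (K v : ℕ) : ℕ := if v ≤ 2 * pU K + 1 then v else 2 * pU K + 2 + (v - (pH K - 2 * pU K))
def okv (K v : ℕ) : Prop := v ≤ pT K ∧ (v ≤ 2 * pU K + 1 ∨ pH K ≤ v + 2 * pU K)
lemma fold_lt {v : ℕ} (h : okv K v) : fold K v < 6 * pU K + 6 := by
  obtain ⟨h1, h2⟩ := h
  unfold pT at h1
  unfold fold; split_ifs <;> omega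
lemma fold_inj {v w : ℕ} (h : okv K v) (h' : okv K w) (e : fold K v = fold K w) : v = w := by
  obtain ⟨h1, h2⟩ := h
  obtain ⟨h3, h4⟩ := h'
  unfold fold at e; split_ifs at e <;> omega

def vv : Ix K → ℕ
  | .node _ => 0
  | .arc q => (q:ℕ) % (pT K + 1)
  | .page _ none => 0
  | .page _ (some (_, r)) => (r:ℕ) / 2
  | .slab _ r => (r:ℕ) / 2

lemma okv_low (hK : 2 ≤ K) {x : Ix K} (hx : um x) (hl : low hK x) : okv K (vv x) := by
  have e0 : pT K = pH K + 2 * pU K + 2 := rfl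
  have e1 := pT_cast (K := K)
  have e2 := pY_cast (K := K)
  have e3 : pY K = pH K + pU K := rfl
  match x, hx with
  | .node q, _ => exact ⟨Nat.zero_le _, .inl (Nat.zero_le _)⟩
  | .arc q, _ =>
    have hq : (q:ℕ) < 2 * K * (pT K + 1) := q.2
    have hd : (q:ℕ) / (pT K + 1) < 2 * K := Nat.div_lt_of_lt_mul (by linarith [mul_comm (2*K) (pT K + 1)])
    have hm : (q:ℕ) % (pT K + 1) < pT K + 1 := Nat.mod_lt _ (Nat.succ_pos _)
    have hs := Nat.div_add_mod (q:ℕ) (pT K + 1)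
    have hs' : (((q:ℕ) / (pT K + 1) * (pT K + 1) : ℕ) : ℤ) + (((q:ℕ) % (pT K + 1) : ℕ) : ℤ) = (q:ℕ) := by
      rw [mul_comm]; exact_mod_cast hs
    show okv K ((q:ℕ) % (pT K + 1))
    have key : ∃ n : ℤ, 0 ≤ n ∧ n ≤ pT K ∧ (n = (((q:ℕ) % (pT K + 1) : ℕ) : ℤ) ∨ n = pT K - (((q:ℕ) % (pT K + 1) : ℕ) : ℤ)) ∧
        posn K ((q:ℕ) / (pT K + 1)) n = ((q:ℕ):ℤ) - 1 := by
      by_cases hpar : ((q:ℕ) / (pT K + 1)) % 2 = 1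
      · refine ⟨(((q:ℕ) % (pT K + 1) : ℕ) : ℤ), by positivity, by omega, .inl rfl, ?_⟩
        unfold posn; rw [if_pos hpar]; linarith
      · refine ⟨(pT K : ℤ) - (((q:ℕ) % (pT K + 1) : ℕ) : ℤ), by omega, by omega, .inr rfl, ?_⟩
        unfold posn; rw [if_neg hpar]; linarith
    obtain ⟨n, n0, n1, hn, hp⟩ := key
    have v : VV hK (.arc q) ((q:ℕ) / (pT K + 1)) n := by
      rw [VV_iff hK hd n0 n1, VP_arc, hp]; exact .inl rfl
    have := hl _ _ v
    constructor <;> omega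
  | .page π (some (l, r)), hx =>
    have hi := iL_lt (K := K) (π := π) l.2
    have A := page_pts hK hx hi (inP_iL l.2) (y := (r:ℕ) / 2) (by omega) le_rfl
    have B := hl _ _ A.1
    have R := r_half r
    show okv K ((r:ℕ) / 2)
    have a1 := fE_le (K := K) π.2 hi
    have a2 := gO_nonneg (K := K) π (iL K π l)
    have a3 := fE_nonneg (K := K) π (iL K π l)
    have a4 := gO_le (K := K) π.2 hi
    unfold hgt at B
    constructor
    · omega
    · split_ifs at B <;> omega
  | .slab σ r, hx =>
    have hi : 0 < 2 * K := by omega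
    have h2 : (r:ℕ) < 2 * pH K + 2 := hx.2
    have A := slab_pts hK hx hi (y := (r:ℕ) / 2) (by omega) le_rfl
    have B := hl _ _ A.1
    have h4 := uu_range hK σ.2 hi
    show okv K ((r:ℕ) / 2)
    constructor <;> omega

lemma card_le2 {α : Type} (f : α → ℕ × ℕ) (a b : ℕ) (h : ∀ x, (f x).1 < a ∧ (f x).2 < b) (hf : Function.Injective f) :
    Nat.card α ≤ a * b := by
  have := Nat.card_le_card_of_injective (β := Fin a × Fin b) (fun x => (⟨(f x).1, (h x).1⟩, ⟨(f x).2, (h x).2⟩))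
    (fun x y e => by
      apply hf
      simp only [Prod.mk.injEq, Fin.mk.injEq] at e
      exact Prod.ext e.1 e.2)
  simpa using this

lemma card_le4 {α : Type} (f : α → (ℕ × ℕ) × ℕ × ℕ × ℕ) (a b c d e : ℕ) (h : ∀ x, ((f x).1.1 < a ∧ (f x).1.2 < b) ∧
    (f x).2.1 < c ∧ (f x).2.2.1 < d ∧ (f x).2.2.2 < e) (hf : Function.Injective f) :
    Nat.card α ≤ (a * b) * (c * (d * e)) := by
  have := Nat.card_le_card_of_injective (β := (Fin a × Fin b) × (Fin c × (Fin d × Fin e)))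
    (fun x => ((⟨(f x).1.1, (h x).1.1⟩, ⟨(f x).1.2, (h x).1.2⟩), ⟨(f x).2.1, (h x).2.1⟩,
      ⟨(f x).2.2.1, (h x).2.2.1⟩, ⟨(f x).2.2.2, (h x).2.2.2⟩))
    (fun x y e => by
      apply hf
      simp only [Prod.mk.injEq, Fin.mk.injEq] at e
      refine Prod.ext (Prod.ext e.1.1 e.1.2) (Prod.ext e.2.1 (Prod.ext e.2.2.1 e.2.2.2)))
  simpa using this

lemma card_rel {α β : Type} [Finite β] (R : α → β → Prop) (h : ∀ x, ∃ y, R x y) (hu : ∀ x x' y, R x y → R x' y → x = x') :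
    Nat.card α ≤ Nat.card β := by
  choose f hf using h
  exact Nat.card_le_card_of_injective f fun x x' e => hu x x' (f x) (hf x) (e ▸ hf x')

def pre : Ix K → (ℕ × ℕ) × ℕ × ℕ
  | .node _ => ((0, 0), 0, 0)
  | .arc q => ((0, (q:ℕ) / (pT K + 1)), 0, 0)
  | .page _ none => ((0, 0), 0, 0)
  | .page π (some (l, r)) => ((1, π), l, (r:ℕ) % 2)
  | .slab σ r => ((2, σ), 0, (r:ℕ) % 2)

lemma pre_inj {x y : Ix K} (hx : um x ∧ 0 < dd x) (hy : um y ∧ 0 < dd y) (e : pre x = pre y) (ev : vv x = vv y) : x = y := by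
  obtain ⟨hx, dx⟩ := hx
  obtain ⟨hy, dy⟩ := hy
  match x, hx, dx with
  | .node q, _, dx => exact absurd dx (lt_irrefl 0)
  | .arc q, _, _ =>
    match y, hy, dy with
    | .node q, _, dx => exact absurd dx (lt_irrefl 0)
    | .arc q', _, _ =>
      simp only [pre, vv, Prod.mk.injEq] at e ev
      congr 1; apply Fin.ext
      rw [← Nat.div_add_mod (q:ℕ) (pT K + 1), ← Nat.div_add_mod (q':ℕ) (pT K + 1), e.1.2, ev]
    | .page π' (some (l', r')), _, _ => simp [pre] at e
    | .slab σ' r', _, _ => simp [pre] at e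
  | .page π (some (l, r)), _, _ =>
    match y, hy, dy with
    | .node q, _, dx => exact absurd dx (lt_irrefl 0)
    | .arc q', _, _ => simp [pre] at e
    | .page π' (some (l', r')), _, _ =>
      simp only [pre, vv, Prod.mk.injEq] at e ev
      have h1 : π = π' := Fin.ext e.1.2
      have h2 : l = l' := Fin.ext e.2.1
      have h3 : r = r' := Fin.ext (by omega)
      rw [h1, h2, h3]
    | .slab σ' r', _, _ => simp [pre] at e
  | .slab σ r, _, _ =>
    match y, hy, dy with
    | .node q, _, dx => exact absurd dx (lt_irrefl 0)
    | .arc q', _, _ => simp [pre] at e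
    | .page π' (some (l', r')), _, _ => simp [pre] at e
    | .slab σ' r', _, _ =>
      simp only [pre, vv, Prod.mk.injEq] at e ev
      have h1 : σ = σ' := Fin.ext e.1.2
      have h3 : r = r' := Fin.ext (by omega)
      rw [h1, h3]

lemma pre_lt (hK : 2 ≤ K) (x : Ix K) : ((pre x).1.1 < 3 ∧ (pre x).1.2 < 2 * K) ∧ (pre x).2.1 < K ∧ (pre x).2.2 < 2 := by
  match x with
  | .node q => simp only [pre]; omega
  | .arc q =>
    have hq : (q:ℕ) < 2 * K * (pT K + 1) := q.2
    have hd : (q:ℕ) / (pT K + 1) < 2 * K := Nat.div_lt_of_lt_mul (by linarith [mul_comm (2*K) (pT K + 1)])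
    simp only [pre]; omega
  | .page _ none => simp only [pre]; omega
  | .page π (some (l, r)) => have := π.2; have := l.2; simp only [pre]; omega
  | .slab σ r => have := σ.2; simp only [pre]; omega

lemma card_B (hK : 2 ≤ K) : Nat.card (Bx hK) ≤ (3 * (2 * K)) * (K * (2 * (6 * pU K + 6))) := by
  refine card_le4 (fun x => ((pre x.1).1, (pre x.1).2.1, (pre x.1).2.2, fold K (vv x.1))) _ _ _ _ _ ?_ ?_
  · intro x
    have := pre_lt hK x.1
    exact ⟨this.1, this.2.1, this.2.2, fold_lt (okv_low hK x.2.1 x.2.2.2)⟩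
  · intro x y e
    simp only [Prod.mk.injEq] at e
    apply Subtype.ext
    have d1 := x.2.2.1
    have d2 := y.2.2.1
    refine pre_inj ⟨x.2.1, by omega⟩ ⟨y.2.1, by omega⟩ (Prod.ext e.1 (Prod.ext e.2.1 e.2.2.1)) ?_
    exact fold_inj (okv_low hK x.2.1 x.2.2.2) (okv_low hK y.2.1 y.2.2.2) e.2.2.2

def k1c : Ix K → ℕ × ℕ
  | .page π none => (π, K)
  | .page π (some (l, _)) => (π, l)
  | .slab σ r => (σ, if (r:ℕ) = 0 then 0 else 1)
  | _ => (0, 0)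

lemma slab_mk_dim {σ : Fin (2 * K)} {r : Fin (2 * pH K + 3)} (h : ¬ um (.slab σ r)) : ((r:ℕ) = 0 ∨ (r:ℕ) = 2 * pH K + 2) ∧ dd (.slab σ r) = 3 := by
  have h1 : ¬ (0 < (r:ℕ) ∧ (r:ℕ) < 2 * pH K + 2) := h
  have h2 := r.2
  simp only [dd]; omega

lemma K1_form {x : Ix K} (h : ¬ um x ∧ dd x = 2) : (∃ π, x = .page π none) ∨ ∃ π l r, x = .page π (some (l, r)) ∧ (r:ℕ) = 0 := by
  obtain ⟨h, hd⟩ := h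
  match x, h, hd with
  | .node q, h, _ => exact absurd trivial h
  | .arc q, h, _ => exact absurd trivial h
  | .page π none, _, _ => exact .inl ⟨π, rfl⟩
  | .page π (some (l, r)), h, _ =>
    have : ¬ 0 < (r:ℕ) := h
    exact .inr ⟨π, l, r, rfl, by omega⟩
  | .slab σ r, h, hd => have := (slab_mk_dim h).2; omega

lemma K2_form {x : Ix K} (h : ¬ um x ∧ dd x = 3) : ∃ σ r, x = .slab σ r ∧ ((r:ℕ) = 0 ∨ (r:ℕ) = 2 * pH K + 2) := by
  obtain ⟨h, hd⟩ := h
  match x, h, hd with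
  | .node q, h, _ => exact absurd trivial h
  | .arc q, h, _ => exact absurd trivial h
  | .page π a, _, hd => have := pdim_le (a := a); simp only [dd] at hd; omega
  | .slab σ r, h, hd => exact ⟨σ, r, rfl, (slab_mk_dim h).1⟩

lemma card_K1 : Nat.card (K1 K) ≤ 2 * K * (K + 1) := by
  refine card_le2 (fun x => k1c x.1) _ _ ?_ ?_
  · rintro ⟨x, hx⟩
    rcases K1_form hx with ⟨π, rfl⟩ | ⟨π, l, r, rfl, -⟩
    · exact ⟨π.2, Nat.lt_succ_self _⟩
    · exact ⟨π.2, l.2.trans (Nat.lt_succ_self _)⟩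
  · rintro ⟨x, hx⟩ ⟨y, hy⟩ e
    apply Subtype.ext
    show x = y
    rcases K1_form hx with ⟨π, rfl⟩ | ⟨π, l, r, rfl, h⟩ <;> rcases K1_form hy with ⟨π', rfl⟩ | ⟨π', l', r', rfl, h'⟩ <;>
      simp only [k1c, Prod.mk.injEq] at e
    · rw [Fin.ext e.1]
    · have := l'.2; omega
    · have := l.2; omega
    · have h3 : r = r' := Fin.ext (by omega)
      rw [Fin.ext e.1, Fin.ext e.2, h3]

lemma card_K2 : Nat.card (K2 K) ≤ 2 * K * 2 := by
  refine card_le2 (fun x => k1c x.1) _ _ ?_ ?_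
  · rintro ⟨x, hx⟩
    obtain ⟨σ, r, rfl, h⟩ := K2_form hx
    have := σ.2
    simp only [k1c]; split_ifs <;> omega
  · rintro ⟨x, hx⟩ ⟨y, hy⟩ e
    apply Subtype.ext
    show x = y
    obtain ⟨σ, r, rfl, h⟩ := K2_form hx
    obtain ⟨σ', r', rfl, h'⟩ := K2_form hy
    simp only [k1c, Prod.mk.injEq] at e
    have h3 : r = r' := Fin.ext (by
      have e2 := e.2
      split_ifs at e2 <;> omega)
    rw [Fin.ext e.1, h3]

abbrev cnt (hK : 2 ≤ K) (n : ℕ) : ℕ := Nat.card {i : (H2 hK).Ix // (Q hK).d i = n}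

lemma f0_ge (hK : 2 ≤ K) : pM K ≤ cnt hK 0 := by
  have := Nat.card_le_card_of_injective (α := Fin (pM K)) (β := {i : (H2 hK).Ix // (Q hK).d i = 0})
    (fun q => ⟨.inl (.inl ⟨.node q, trivial⟩), rfl⟩) (fun q q' e => by
      have e1 := congrArg Subtype.val (Sum.inl.inj (Sum.inl.inj (congrArg Subtype.val e)))
      simpa using e1)
  simpa using this

lemma f2_ge (hK : 2 ≤ K) : 2 * K * (K * pY K) ≤ cnt hK 2 := by
  have := Nat.card_le_card_of_injective (α := Fin (2 * K) × (Fin K × Fin (pY K))) (β := {i : (H2 hK).Ix // (Q hK).d i = 2})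
    (fun q => ⟨.inl (.inl ⟨.page q.1 (some (q.2.1, ⟨2 * ((q.2.2 : ℕ) + 1), by have := q.2.2.2; omega⟩)),
      Nat.mul_pos two_pos (Nat.succ_pos _)⟩), by
        show dd (Ix.page q.1 (some (q.2.1, ⟨2 * ((q.2.2 : ℕ) + 1), _⟩))) = 2
        simp [dd, pdim]⟩) (fun q q' e => by
        have e := congrArg Subtype.val (Sum.inl.inj (Sum.inl.inj (congrArg Subtype.val e)))
        simp only [Ix.page.injEq, Option.some.injEq, Prod.mk.injEq, Fin.mk.injEq] at e
        exact Prod.ext e.1 (Prod.ext e.2.1 (Fin.ext (by omega))))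
  simpa using this

lemma dd0_form {x : Ix K} (h : dd x = 0) : ∃ q, x = .node q := by
  match x, h with
  | .node q, _ => exact ⟨q, rfl⟩
  | .arc q, h => simp [dd] at h
  | .page π a, h => have := pdim_le (a := a); simp only [dd] at h; omega
  | .slab σ r, h => simp only [dd] at h; omega

lemma dd3_form {x : Ix K} (h : dd x = 3) : ∃ σ r, x = .slab σ r := by
  match x, h with
  | .node q, h => simp [dd] at h
  | .arc q, h => simp [dd] at h
  | .page π a, h => have := pdim_le (a := a); simp only [dd] at h; omega
  | .slab σ r, h => exact ⟨σ, r, rfl⟩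

lemma f0_le (hK : 2 ≤ K) : cnt hK 0 ≤ pM K + (2 * K * (K + 1) + 2 * K * 2) := by
  have := card_rel (α := {i : (H2 hK).Ix // (Q hK).d i = 0}) (β := Fin (pM K) ⊕ (K1 K ⊕ K2 K))
    (fun x y => match y with
      | .inl q => x.1 = .inl (.inl ⟨.node q, trivial⟩)
      | .inr (.inl k) => x.1 = .inl (.inr ⟨k, none⟩)
      | .inr (.inr k) => x.1 = .inr ⟨k, none⟩) ?_ ?_
  · have h1 := card_K1 (K := K)
    have h2 := card_K2 (K := K)
    rw [Nat.card_sum, Nat.card_sum, Nat.card_fin] at this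
    exact this.trans (Nat.add_le_add_left (Nat.add_le_add h1 h2) _)
  · rintro ⟨((⟨x, hx⟩ | ⟨k, _ | j⟩) | ⟨k, _ | j⟩), hd⟩
    · obtain ⟨q, rfl⟩ := dd0_form (show dd x = 0 from hd)
      exact ⟨.inl q, rfl⟩
    · exact ⟨.inr (.inl k), rfl⟩
    · exact absurd hd (Nat.succ_ne_zero _)
    · exact ⟨.inr (.inr k), rfl⟩
    · exact absurd hd (Nat.succ_ne_zero _)
  · rintro x x' (q | k | k) h h' <;> exact Subtype.ext (Eq.trans h (Eq.symm h'))

lemma f3_le (hK : 2 ≤ K) : cnt hK 3 ≤ 2 * K * (2 * pH K + 3) + Nat.card (K2 K) * (Nat.card (Bx hK) + Nat.card (K1 K) * Nat.card (Bx hK)) := by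
  have := card_rel (α := {i : (H2 hK).Ix // (Q hK).d i = 3}) (β := (Fin (2 * K) × Fin (2 * pH K + 3)) ⊕ (K2 K × (Bx hK ⊕ (K1 K × Bx hK))))
    (fun x y => match y with
      | .inl p => ∃ h, x.1 = .inl (.inl ⟨.slab p.1 p.2, h⟩)
      | .inr (k, .inl b) => ∃ h, x.1 = .inr ⟨k, some ⟨.inl ⟨b.1, b.2.1⟩, h⟩⟩
      | .inr (k, .inr (k1, b)) => ∃ h h', x.1 = .inr ⟨k, some ⟨.inr ⟨k1, some ⟨⟨b.1, b.2.1⟩, h⟩⟩, h'⟩⟩) ?_ ?_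
  · rw [Nat.card_sum, Nat.card_prod, Nat.card_prod, Nat.card_sum, Nat.card_prod, Nat.card_fin, Nat.card_fin] at this
    exact this
  · rintro ⟨((⟨x, hx⟩ | ⟨k, _ | j⟩) | ⟨k, _ | ⟨(⟨x, hx⟩ | ⟨k1, _ | j⟩), hj⟩⟩), hd⟩
    · obtain ⟨σ, r, rfl⟩ := dd3_form (show dd x = 3 from hd)
      exact ⟨.inl (σ, r), hx, rfl⟩
    · exact absurd (show 0 = 3 from hd) (by omega)
    · have h := sub_dim hK j.1.2 k.2.1 j.2
      rw [k.2.2] at h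
      have : dd j.1.1 + 1 = 3 := hd
      omega
    · exact absurd (show 0 = 3 from hd) (by omega)
    · have : dd x + 1 = 3 := hd
      exact ⟨.inr (k, .inl ⟨x, hx, by omega, low_mono hK hj (mk_low hK k.2.1)⟩), hj, rfl⟩
    · exact absurd (show 0 + 1 = 3 from hd) (by omega)
    · have : dd j.1.1 + 1 + 1 = 3 := hd
      exact ⟨.inr (k, .inr (k1, ⟨j.1.1, j.1.2, by omega, low_mono hK j.2 (mk_low hK k1.2.1)⟩)), j.2, hj, rfl⟩
  · rintro x x' (p | ⟨k, b | ⟨k1, b⟩⟩) h h'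
    · obtain ⟨h, e⟩ := h
      obtain ⟨h', e'⟩ := h'
      exact Subtype.ext (e.trans e'.symm)
    · obtain ⟨h, e⟩ := h
      obtain ⟨h', e'⟩ := h'
      exact Subtype.ext (e.trans e'.symm)
    · obtain ⟨h, g, e⟩ := h
      obtain ⟨h', g', e'⟩ := h'
      exact Subtype.ext (e.trans e'.symm)

lemma f0_num (hK : 2 ≤ K) : cnt hK 0 ≤ 64 * K ^ 12 := by
  refine (f0_le hK).trans ?_
  have h1 : 1 ≤ K := by omega
  have a (n : ℕ) (hn : n ≤ 11) : K ^ n ≤ K ^ 11 := Nat.pow_le_pow_right h1 hn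
  have a0 := a 0 (by omega)
  have a1 := a 1 (by omega)
  have a4 := a 4 (by omega)
  have : pM K + (2 * K * (K + 1) + 2 * K * 2) = 2 * K * (K ^ 11 + 24 * K ^ 4 + 3 + (K + 1) + 2) := by
    unfold pM pT pH pU; ring
  rw [this, show 64 * K ^ 12 = 2 * K * (32 * K ^ 11) by ring]
  apply Nat.mul_le_mul_left
  rw [pow_zero] at a0
  rw [pow_one] at a1
  omega

lemma f3_num (hK : 2 ≤ K) : cnt hK 3 ≤ 20000 * K ^ 12 := by
  refine (f3_le hK).trans ?_
  have h1 : 1 ≤ K := by omega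
  have b : Nat.card (Bx hK) ≤ 936 * K ^ 6 := by
    refine (card_B hK).trans ?_
    have : 1 ≤ K ^ 4 := Nat.one_le_pow _ _ h1
    calc _ = 12 * K ^ 2 * (72 * K ^ 4 + 6) := by unfold pU; ring
      _ ≤ 12 * K ^ 2 * (78 * K ^ 4) := Nat.mul_le_mul_left _ (by omega)
      _ = _ := by ring
  have c1 : Nat.card (K1 K) ≤ 4 * K ^ 2 := card_K1.trans (by nlinarith)
  have c2 : Nat.card (K2 K) ≤ 4 * K := card_K2.trans (by omega)
  have e1 : 2 * K * (2 * pH K + 3) ≤ 10 * K ^ 12 := by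
    have : 1 ≤ K ^ 11 := Nat.one_le_pow _ _ h1
    calc _ ≤ 2 * K * (5 * K ^ 11) := Nat.mul_le_mul_left _ (by unfold pH; omega)
      _ = _ := by ring
  have e2 : Nat.card (K2 K) * (Nat.card (Bx hK) + Nat.card (K1 K) * Nat.card (Bx hK)) ≤ 18720 * K ^ 12 := by
    have k2 : 1 ≤ K ^ 2 := Nat.one_le_pow _ _ h1
    calc _ ≤ 4 * K * (936 * K ^ 6 + 4 * K ^ 2 * (936 * K ^ 6)) :=
          Nat.mul_le_mul c2 (Nat.add_le_add b (Nat.mul_le_mul c1 b))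
      _ = 3744 * K ^ 7 * (1 + 4 * K ^ 2) := by ring
      _ ≤ 3744 * K ^ 7 * (5 * K ^ 2) := Nat.mul_le_mul_left _ (by omega)
      _ = 18720 * K ^ 9 := by ring
      _ ≤ 18720 * K ^ 12 := Nat.mul_le_mul_left _ (Nat.pow_le_pow_right h1 (by omega))
  omega

lemma f2_num (hK : 2 ≤ K) : 2 * K ^ 13 ≤ cnt hK 2 := by
  refine le_trans ?_ (f2_ge hK)
  calc 2 * K ^ 13 = 2 * K * (K * K ^ 11) := by ring
    _ ≤ _ := Nat.mul_le_mul_left _ (Nat.mul_le_mul_left _ (by unfold pY pH; omega))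

end
end FatS
end

section
open Metric Set Topology
namespace FatS

lemma finish {ι : Type} [Finite ι] (P : PC (E 4) ι) (hU : (⋃ i, P.o i) = sphere 0 1)
    (hd : ∀ i, P.d i ≤ 3) :
    ∃ C : FinCellulation3, C.StronglyRegular ∧
      ∀ n : Fin 4, C.count n = Nat.card {i : ι // P.d i = n} := by
  classical
  let cnt : Fin 4 → ℕ := fun n => Nat.card {i : ι // P.d i = n}
  let eq : ∀ n : Fin 4, Fin (cnt n) ≃ {i : ι // P.d i = n} := fun n => (Finite.equivFin _).symm
  have hex : ∀ (n : Fin 4) (i : {i : ι // P.d i = n}), ∃ f : E n → Sphere3,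
      ContinuousOn f (closedBall 0 1) ∧ InjOn f (closedBall 0 1) ∧
      Subtype.val '' (f '' closedBall 0 1) = P.c i ∧ Subtype.val '' (f '' ball 0 1) = P.o i := by
    rintro n ⟨i, hi⟩
    have hc := P.cell i
    rw [hi] at hc
    obtain ⟨f, h1, h2, h3, h4⟩ := hc
    have hsub : P.c i ⊆ sphere 0 1 := hU ▸ P.bd i
    have hm : ∀ x ∈ closedBall (0 : E n) 1, f x ∈ sphere (0 : E 4) 1 :=
      fun x hx => hsub (h3 ▸ ⟨x, hx, rfl⟩)
    have h0 : (0 : E n) ∈ closedBall (0 : E n) 1 := by simp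
    let g : E n → Sphere3 := fun x => if h : x ∈ closedBall (0 : E n) 1 then ⟨f x, hm x h⟩
      else ⟨f 0, hm 0 h0⟩
    have hg : ∀ x ∈ closedBall (0 : E n) 1, (g x : E 4) = f x := by
      intro x hx; simp only [g, dif_pos hx]
    refine ⟨g, ?_, ?_, ?_, ?_⟩
    · rw [Topology.IsInducing.subtypeVal.continuousOn_iff]
      exact h1.congr hg
    · intro x hx y hy hxy
      exact h2 hx hy (by rw [← hg x hx, ← hg y hy, hxy])
    · rw [← h3, ← image_comp]
      exact image_congr hg
    · rw [← h4, ← image_comp]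
      exact image_congr fun x hx => hg x (ball_subset_closedBall hx)
  choose f f1 f2 f3 f4 using hex
  have hsig : ∀ (n m : Fin 4) (i : Fin (cnt n)) (j : Fin (cnt m)),
      (eq n i : ι) = eq m j → (⟨n, i⟩ : Σ k : Fin 4, Fin (cnt k)) = ⟨m, j⟩ := by
    intro n m i j h
    have : n = m := Fin.ext (by rw [← (eq n i).2, h, (eq m j).2])
    subst this
    rw [(eq n).injective (Subtype.ext h)]
  have hval : Function.Injective (Subtype.val : Sphere3 → E 4) := Subtype.val_injective
  have hreg : ∀ (n : Fin 4) (i : Fin (cnt n)),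
    IsEmbedding ((Disk (n : ℕ)).restrict (f n (eq n i))) := by
    intro n i
    haveI : CompactSpace (closedBall (0 : E n) 1) :=
        isCompact_iff_compactSpace.1 (isCompact_closedBall _ _)
    exact (Continuous.isClosedEmbedding (continuousOn_iff_continuous_domRestrict.1 (f1 n _))
        (injOn_iff_injective.1 (f2 n _))).isEmbedding
  have hidx : ∀ j : ι, ∃ (n : Fin 4) (i : Fin (cnt n)), (eq n i : ι) = j := by
    intro j
    refine ⟨⟨P.d j, by have := hd j; omega⟩, (eq _).symm ⟨j, rfl⟩, by simp⟩
  refine ⟨⟨cnt, fun n i => f n (eq n i), fun n i => f1 n _, ?_, ?_, ?_, ?_⟩, ⟨?_, ?_⟩, fun n => rfl⟩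
  · intro n i
    have h1 := hreg n i
    have : (OpenDisk (n : ℕ)).restrict (f n (eq n i)) =
      (Disk (n : ℕ)).restrict (f n (eq n i)) ∘ Set.inclusion ball_subset_closedBall := rfl
    rw [this]
    exact h1.comp (IsEmbedding.inclusion _)
  · intro n m i j hne
    rw [← Set.disjoint_image_iff hval, f4, f4, Set.disjoint_left]
    intro x hx hx'
    have hne' : (eq n i : ι) ≠ eq m j := fun h => hne (hsig n m i j h)
    have h1 := P.dim _ _ ⟨x, hx, (P.cell _).sub hx'⟩ hne'
    have h2 := P.dim _ _ ⟨x, hx', (P.cell _).sub hx⟩ hne'.symm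
    omega
  · apply eq_univ_of_forall
    intro x
    have : (x : E 4) ∈ ⋃ i, P.o i := by rw [hU]; exact x.2
    obtain ⟨j, hj⟩ := mem_iUnion.1 this
    obtain ⟨n, i, rfl⟩ := hidx j
    rw [← f4] at hj
    obtain ⟨y, hy, hyx⟩ := hj
    rw [← hval hyx]
    exact mem_iUnion₂.2 ⟨n, i, hy⟩
  · rintro n i _ ⟨b, hb, rfl⟩
    have hbc := sphere_subset_closedBall hb
    have hxc : (f n (eq n i) b : E 4) ∈ P.c (eq n i) := f3 n (eq n i) ▸ ⟨_, ⟨b, hbc, rfl⟩, rfl⟩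
    obtain ⟨j, hj⟩ := mem_iUnion.1 (P.bd _ hxc)
    have hne : j ≠ eq n i := by
      rintro rfl
      rw [← f4] at hj
      obtain ⟨y, ⟨b', hb', rfl⟩, hyx⟩ := hj
      have := f2 n (eq n i) (ball_subset_closedBall hb') hbc (hval hyx)
      rw [this] at hb'
      simp at hb hb'
      linarith
    have hlt := P.dim _ _ ⟨_, hj, hxc⟩ hne
    obtain ⟨m, k, rfl⟩ := hidx j
    rw [(eq n i).2, (eq m k).2] at hlt
    have hj' := (P.cell _).sub hj
    rw [← f3] at hj'
    obtain ⟨y, hy, hyx⟩ := hj'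
    rw [← hval hyx]
    exact mem_iUnion₂.2 ⟨m, hlt, mem_iUnion.2 ⟨k, hy⟩⟩
  · exact hreg
  · intro n m i j
    rcases P.inter (eq n i) (eq m j) with h | ⟨k, h⟩
    · left
      rw [← image_eq_empty (f := (Subtype.val : Sphere3 → E 4)), image_inter hval]
      erw [f3, f3]; exact h
    · right
      obtain ⟨p, l, rfl⟩ := hidx k
      refine ⟨p, l, ?_⟩
      apply hval.image_injective
      rw [image_inter hval]
      erw [f3, f3, f3]; exact h.symm

end FatS
end

section
open Metric Set Topology
namespace FatS
lemma final_num (K : ℕ) (hK : 2 ≤ K) (f0 f1 f2 f3 : ℕ) (g0 : 0 < f0) (h0 : f0 ≤ 64 * K ^ 12) (h2 : 2 * K ^ 13 ≤ f2) (h3 : f3 ≤ 20000 * K ^ 12) :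
    (1 / 30000 : ℝ) * (f0 : ℝ) ^ ((1 : ℝ) / 12) ≤ ((f1 : ℝ) + (f2 : ℝ)) / ((f0 : ℝ) + (f3 : ℝ)) := by
  have a : (f0 : ℝ) ^ ((1 : ℝ) / 12) ≤ 2 * K := by
    have h : (f0 : ℝ) ≤ (2 * K : ℝ) ^ 12 := by
      have : f0 ≤ (2 * K) ^ 12 := h0.trans (by rw [mul_pow]; exact Nat.mul_le_mul_right _ (by norm_num))
      exact_mod_cast this
    calc (f0 : ℝ) ^ ((1 : ℝ) / 12) ≤ ((2 * K : ℝ) ^ 12) ^ ((1 : ℝ) / 12) :=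
          Real.rpow_le_rpow (by positivity) h (by norm_num)
      _ = 2 * K := by
          rw [← Real.rpow_natCast, ← Real.rpow_mul (by positivity)]; norm_num
  have p : (0 : ℝ) < (f0 : ℝ) + f3 := by positivity
  rw [le_div_iff₀ p]
  have h0' : (f0 : ℝ) ≤ 64 * (K:ℝ) ^ 12 := by exact_mod_cast h0
  have h2' : 2 * (K:ℝ) ^ 13 ≤ f2 := by exact_mod_cast h2
  have h3' : (f3 : ℝ) ≤ 20000 * (K:ℝ) ^ 12 := by exact_mod_cast h3
  have f1p : (0:ℝ) ≤ f1 := by positivity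
  have kp : (0:ℝ) ≤ K := by positivity
  calc 1 / 30000 * (f0 : ℝ) ^ ((1 : ℝ) / 12) * ((f0 : ℝ) + f3)
      ≤ 1 / 30000 * (2 * K) * (64 * (K:ℝ) ^ 12 + 20000 * (K:ℝ) ^ 12) := by gcongr
    _ = (40128 / 30000) * (K:ℝ) ^ 13 := by ring
    _ ≤ 2 * (K:ℝ) ^ 13 := by gcongr; norm_num
    _ ≤ f1 + f2 := by linarith

lemma final : ∃ c : ℝ, 0 < c ∧ ∀ N₀ : ℕ, ∃ C : FinCellulation3, C.StronglyRegular ∧ N₀ ≤ C.count 0 ∧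
    c * (C.count 0 : ℝ) ^ ((1 : ℝ) / 12) ≤ ((C.count 1 : ℝ) + (C.count 2 : ℝ)) / ((C.count 0 : ℝ) + (C.count 3 : ℝ)) := by
  refine ⟨1 / 30000, by norm_num, fun N₀ => ?_⟩
  have hK : 2 ≤ N₀ + 2 := by omega
  obtain ⟨C, hC, hn⟩ := finish (Q hK) (Q_union hK) (Q_dim hK)
  have e0 : C.count 0 = cnt hK 0 := hn 0
  have e2 : C.count 2 = cnt hK 2 := hn 2
  have e3 : C.count 3 = cnt hK 3 := hn 3
  have g : N₀ + 2 ≤ C.count 0 := by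
    rw [e0]
    refine le_trans ?_ (f0_ge hK)
    unfold pM
    nlinarith [Nat.zero_le (pT (N₀ + 2)), Nat.zero_le (N₀ * pT (N₀ + 2))]
  refine ⟨C, hC, by omega, ?_⟩
  exact final_num (N₀ + 2) hK _ _ _ _ (by omega) (e0 ▸ f0_num hK) (e2 ▸ f2_num hK) (e3 ▸ f3_num hK)
end FatS
end

/-- A strongly regular cellulation of the 3-sphere with `N` vertices may have
fatness `Ω(N^{1/12})`. -/
theorem fatness_omega_N_pow :
    ∃ c : ℝ, 0 < c ∧ ∀ N₀ : ℕ, ∃ C : FinCellulation3, C.StronglyRegular ∧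
      N₀ ≤ C.count 0 ∧
      c * (C.count 0 : ℝ) ^ ((1 : ℝ) / 12) ≤
        ((C.count 1 : ℝ) + (C.count 2 : ℝ)) / ((C.count 0 : ℝ) + (C.count 3 : ℝ)) := by
  exact FatS.final
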